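/- arXiv:2111.08802 — 2 statements merged into one kernel-verified Lean document; each statement's English description precedes it below -/
import Mathlib

section
/- For every n ≥ 2 there exists a properly embedded complex line in ℂⁿ that cannot be straightened by holomorphic automorphisms: an injective holomorphic proper map F : ℂ → ℂⁿ with F'(z) ≠ 0 for all z, such that for every holomorphic automorphism Φ of ℂⁿ the image Φ(F(ℂ)) is not an affine complex line, i.e., Φ(F(ℂ)) ≠ {a + t·b : t ∈ ℂ} for all a ∈ ℂⁿ and b ∈ ℂⁿ \ {0}. -/
noncomputable section

/-- A holomorphic automorphism of ℂⁿ: a bijective entire map with entire inverse. -/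
def IsHolomorphicAutomorphism {n : ℕ}
    (F : EuclideanSpace ℂ (Fin n) → EuclideanSpace ℂ (Fin n)) : Prop :=
  Differentiable ℂ F ∧ ∃ G : EuclideanSpace ℂ (Fin n) → EuclideanSpace ℂ (Fin n),
    Differentiable ℂ G ∧ (∀ z, G (F z) = z) ∧ (∀ z, F (G z) = z)

section Auxiliary

open Metric Set Filter Topology
open scoped NNReal

section HolomorphicEstimates

variable {E F : Type*} [NormedAddCommGroup E] [NormedSpace ℂ E] [NormedAddCommGroup F]
  [NormedSpace ℂ F] {G : E → F}

lemma norm_fderiv_le_of_norm_le (hG : Differentiable ℂ G) {x : E} {d M : ℝ} (hd : 0 < d)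
    (h : ∀ y ∈ ball x d, ‖G y‖ ≤ M) : ‖fderiv ℂ G x‖ ≤ 2 * M / d := by
  refine Complex.norm_fderiv_le_div_of_mapsTo_ball hG.differentiableOn (fun y hy => ?_) hd
  rw [mem_closedBall, dist_eq_norm]
  linarith [norm_sub_le (G y) (G x), h y hy, h x (mem_ball_self hd)]

lemma norm_sub_le_of_norm_le (hG : Differentiable ℂ G) {a d M : ℝ} (hd : 0 < d)
    (h : ∀ y ∈ ball (0 : E) a, ‖G y‖ ≤ M) {x y : E} (hx : ‖x‖ + d ≤ a) (hy : ‖y‖ + d ≤ a) :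
    ‖G y - G x‖ ≤ 2 * M / d * ‖y - x‖ := by
  refine (convex_closedBall (0 : E) (a - d)).norm_image_sub_le_of_norm_fderiv_le (𝕜 := ℂ)
    (fun z _ => hG z) (fun z hz => norm_fderiv_le_of_norm_le hG hd fun w hw => h w ?_) ?_ ?_
  · rw [mem_closedBall_zero_iff] at hz
    rw [mem_ball, dist_eq_norm] at hw
    rw [mem_ball_zero_iff]
    linarith [norm_le_norm_add_norm_sub z w, norm_sub_rev z w]
  · rw [mem_closedBall_zero_iff]; linarith
  · rw [mem_closedBall_zero_iff]; linarith

lemma norm_fderiv_sub_le (hG : Differentiable ℂ G) {a d M : ℝ} (hd : 0 < d)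
    (h : ∀ y ∈ ball (0 : E) a, ‖G y‖ ≤ M) {x y : E} (hx : ‖x‖ + 2 * d ≤ a)
    (hy : ‖y‖ + 2 * d ≤ a) :
    ‖fderiv ℂ G y - fderiv ℂ G x‖ ≤ 4 * M / d ^ 2 * ‖y - x‖ := by
  set H : E → F := fun w => G (w + (y - x)) - G w with hH
  have hd1 : Differentiable ℂ (fun w => G (w + (y - x))) :=
    hG.comp (differentiable_id.add_const _)
  have hHd : Differentiable ℂ H := hd1.sub hG
  have h1 : fderiv ℂ H x = fderiv ℂ G y - fderiv ℂ G x := by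
    rw [hH, fderiv_fun_sub (hd1 x) (hG x), fderiv_comp_add_right]
    simp
  rw [← h1]
  have h2 := norm_fderiv_le_of_norm_le hHd (x := x) (M := 2 * M / d * ‖y - x‖) hd ?_
  · refine h2.trans (le_of_eq ?_)
    field_simp
    ring
  · intro w hw
    rw [mem_ball, dist_eq_norm] at hw
    have := norm_sub_le_of_norm_le hG hd h (x := w) (y := w + (y - x)) ?_ ?_
    · simpa [hH] using this
    · linarith [norm_le_norm_add_norm_sub x w, norm_sub_rev x w]
    · have : w + (y - x) = y + (w - x) := by abel
      rw [this]
      linarith [norm_add_le y (w - x)]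

lemma approximatesLinearOn_closedBall (hG : Differentiable ℂ G) {a d M : ℝ} (hd : 0 < d)
    (h : ∀ y ∈ ball (0 : E) a, ‖G y‖ ≤ M) {x : E} (hx : ‖x‖ + 3 * d ≤ a) {ρ : ℝ}
    (hρ : ρ ≤ d) {c : ℝ≥0} (hc : 4 * M / d ^ 2 * ρ ≤ c) :
    ApproximatesLinearOn G (fderiv ℂ G x) (closedBall x ρ) c := by
  intro y hy z hz
  have hM : 0 ≤ M := (norm_nonneg _).trans (h 0
    (mem_ball_self (by linarith [norm_nonneg x])))
  refine (convex_closedBall x ρ).norm_image_sub_le_of_norm_fderiv_le' (𝕜 := ℂ)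
    (fun z _ => hG z) (fun w hw => ?_) hz hy
  rw [mem_closedBall, dist_eq_norm] at hw
  refine (norm_fderiv_sub_le hG hd h (x := x) (y := w) (by linarith) ?_).trans ?_
  · linarith [norm_le_norm_add_norm_sub x w, norm_sub_rev x w]
  · refine le_trans ?_ hc
    gcongr

lemma differentiable_fderiv_apply_smul [FiniteDimensional ℂ E] [CompleteSpace F]
    (hG : Differentiable ℂ G) (v w : E) : Differentiable ℂ fun ζ : ℂ => fderiv ℂ G (ζ • v) w := by
  have key : TendstoLocallyUniformlyOn
      (fun (n : ℕ) (ζ : ℂ) => ((n : ℂ) + 1) • (G (ζ • v + ((n : ℂ) + 1)⁻¹ • w) - G (ζ • v)))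
      (fun ζ : ℂ => fderiv ℂ G (ζ • v) w) atTop univ := by
    rw [tendstoLocallyUniformlyOn_iff_forall_isCompact isOpen_univ]
    intro K _ hK
    have : ProperSpace E := FiniteDimensional.proper ℂ E
    obtain ⟨R, hR⟩ := (hK.image (f := fun ζ : ℂ => ζ • v) (by fun_prop)).isBounded.exists_norm_le
    obtain ⟨M, hM⟩ := ((isCompact_closedBall (0 : E) (R + 3 * (‖w‖ + 1))).image
      hG.continuous).isBounded.exists_norm_le
    have hb : ∀ y ∈ ball (0 : E) (R + 3 * (‖w‖ + 1)), ‖G y‖ ≤ M := fun y hy =>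
      hM _ (mem_image_of_mem _ (ball_subset_closedBall hy))
    rw [Metric.tendstoUniformlyOn_iff]
    intro ε hε
    set C := 4 * |M| / (‖w‖ + 1) ^ 2 with hC
    have hlim : Tendsto (fun n : ℕ => C * ‖w‖ * ‖w‖ * (1 / ((n : ℝ) + 1))) atTop (𝓝 0) := by
      simpa using tendsto_one_div_add_atTop_nhds_zero_nat.const_mul (C * ‖w‖ * ‖w‖)
    filter_upwards [hlim.eventually_lt_const hε] with n hn ζ hζ
    have hpos : (0 : ℝ) < (n : ℝ) + 1 := by positivity
    have hne : ((n : ℂ) + 1) ≠ 0 := by exact_mod_cast hpos.ne'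
    have hnorm : ‖((n : ℂ) + 1)‖ = (n : ℝ) + 1 := by
      have : ((n : ℂ) + 1) = ((n + 1 : ℕ) : ℂ) := by push_cast; ring
      rw [this, Complex.norm_natCast]; push_cast; ring
    have hs : ‖((n : ℂ) + 1)⁻¹ • w‖ = ‖w‖ / ((n : ℝ) + 1) := by
      rw [norm_smul, norm_inv, hnorm]; ring
    have hsle : ‖w‖ / ((n : ℝ) + 1) ≤ ‖w‖ :=
      div_le_self (norm_nonneg _) (by linarith [(Nat.cast_nonneg n : (0 : ℝ) ≤ n)])
    have hx : ‖ζ • v‖ ≤ R := hR _ (mem_image_of_mem _ hζ)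
    have hM0 : 0 ≤ C := by positivity
    have happ := approximatesLinearOn_closedBall hG (d := ‖w‖ + 1) (by positivity) hb
      (x := ζ • v) (by linarith) (ρ := ‖w‖ / ((n : ℝ) + 1)) (by linarith)
      (c := ⟨C * (‖w‖ / ((n : ℝ) + 1)), by positivity⟩)
      (by
        change _ ≤ C * (‖w‖ / ((n : ℝ) + 1))
        rw [hC]
        gcongr
        exact le_abs_self M)
    have h1 := happ (ζ • v + ((n : ℂ) + 1)⁻¹ • w) (by
      rw [mem_closedBall, dist_eq_norm]; simp only [add_sub_cancel_left]; exact hs.le) (ζ • v)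
      (mem_closedBall_self (by positivity))
    simp only [add_sub_cancel_left, hs] at h1
    rw [dist_comm, dist_eq_norm]
    have h2 : ((n : ℂ) + 1) • (G (ζ • v + ((n : ℂ) + 1)⁻¹ • w) - G (ζ • v))
        - fderiv ℂ G (ζ • v) w = ((n : ℂ) + 1) • (G (ζ • v + ((n : ℂ) + 1)⁻¹ • w) - G (ζ • v)
        - fderiv ℂ G (ζ • v) (((n : ℂ) + 1)⁻¹ • w)) := by
      rw [smul_sub _ _ (fderiv ℂ G (ζ • v) _), map_smul, smul_smul, mul_inv_cancel₀ hne, one_smul]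
    rw [h2, norm_smul, hnorm]
    refine lt_of_le_of_lt ?_ hn
    calc ((n : ℝ) + 1) * _ ≤ ((n : ℝ) + 1) *
          (C * (‖w‖ / ((n : ℝ) + 1)) * (‖w‖ / ((n : ℝ) + 1))) := by
          gcongr
          exact h1
      _ = _ := by field_simp
  rw [← differentiableOn_univ]
  refine key.differentiableOn (Eventually.of_forall fun n => ?_) isOpen_univ
  have : Differentiable ℂ (fun ζ : ℂ => G (ζ • v + ((n : ℂ) + 1)⁻¹ • w)) :=
    hG.comp (by fun_prop)
  have h2 : Differentiable ℂ (fun ζ : ℂ => G (ζ • v)) := hG.comp (by fun_prop)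
  exact ((this.sub h2).const_smul _).differentiableOn

lemma differentiable_det_fderiv_smul [FiniteDimensional ℂ E] {G : E → E} (hG : Differentiable ℂ G)
    (v : E) : Differentiable ℂ fun ζ : ℂ => (fderiv ℂ G (ζ • v)).det := by
  let b := Module.finBasis ℂ E
  have h1 : (fun ζ : ℂ => (fderiv ℂ G (ζ • v)).det) = fun ζ : ℂ =>
      ∑ σ : Equiv.Perm (Fin (Module.finrank ℂ E)), ((Equiv.Perm.sign σ : ℤ) : ℂ) *
        ∏ i, b.repr (fderiv ℂ G (ζ • v) (b i)) (σ i) := by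
    funext ζ
    rw [ContinuousLinearMap.det, ← LinearMap.det_toMatrix b, Matrix.det_apply']
    simp [LinearMap.toMatrix_apply]
  rw [h1]
  refine Differentiable.fun_sum fun σ _ => Differentiable.const_mul ?_ _
  refine Differentiable.fun_finsetProd fun i _ => ?_
  have h2 : Differentiable ℂ fun x : E => b.repr x (σ i) :=
    (LinearMap.toContinuousLinearMap (b.coord (σ i))).differentiable
  have : CompleteSpace E := FiniteDimensional.complete ℂ E
  exact h2.comp (differentiable_fderiv_apply_smul hG v (b i))

end HolomorphicEstimates

/-- Harnack-type lower bound for zero-free entire functions. -/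
lemma norm_ge_exp_of_zero_free {h : ℂ → ℂ} (hd : Differentiable ℂ h) (h0 : ∀ z, h z ≠ 0)
    {r R D : ℝ} (hrR : r < R) (hr : 0 ≤ r) (hD : ∀ z ∈ ball (0 : ℂ) R, ‖h z‖ ≤ D)
    (h1 : 1 ≤ ‖h 0‖) {z : ℂ} (hz : ‖z‖ ≤ r) :
    Real.exp (-(2 * (Real.log D + 1) * r / (R - r))) ≤ ‖h z‖ := by
  have hR : 0 < R := by linarith
  obtain ⟨g, hg⟩ := ((hd.deriv).div hd h0).isExactOn_univ
  have hg' : ∀ z, HasDerivAt g (deriv h z / h z) z := fun z => hg z (mem_univ z)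
  set f : ℂ → ℂ := fun z => g z - g 0 with hf
  have hf' : ∀ z, HasDerivAt f (deriv h z / h z) z := fun z => (hg' z).sub_const _
  have hexp : ∀ z, h z = h 0 * Complex.exp (f z) := by
    have hder : ∀ z, HasDerivAt (fun z => h z * Complex.exp (-f z)) 0 z := by
      intro z
      have := (hd z).hasDerivAt.mul ((hf' z).neg.cexp)
      convert! this using 1
      field_simp [h0 z]
      ring
    intro z
    have := is_const_of_deriv_eq_zero (fun z => (hder z).differentiableAt)
      (fun z => (hder z).deriv) z 0
    simp only [hf, sub_self, neg_zero, Complex.exp_zero, mul_one] at this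
    have h2 : -(g z - g 0) + f z = 0 := by simp [hf]
    rw [← this, mul_assoc, ← Complex.exp_add, h2, Complex.exp_zero, mul_one]
  have hre : ∀ z, ‖h z‖ = ‖h 0‖ * Real.exp (f z).re := fun z => by
    rw [hexp z, norm_mul, Complex.norm_exp]
  have hD1 : 1 ≤ D := h1.trans (hD 0 (mem_ball_self hR))
  have hM : 0 < Real.log D + 1 := by linarith [Real.log_nonneg hD1]
  have hmaps : MapsTo f (ball 0 R) {z | z.re ≤ Real.log D + 1} := by
    intro w hw
    have h2 : Real.exp (f w).re ≤ D := by
      have := hD w hw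
      rw [hre w] at this
      nlinarith [Real.exp_pos (f w).re]
    have h3 := (Real.le_log_iff_exp_le (by linarith)).2 h2
    change (f w).re ≤ _
    linarith
  have hb := Complex.borelCaratheodory_zero hM
    (fun w _ => (hf' w).differentiableAt.differentiableWithinAt) hmaps hR
    (z := z) (by rw [mem_ball_zero_iff]; linarith) (by simp [hf])
  have hb2 : ‖f z‖ ≤ 2 * (Real.log D + 1) * r / (R - r) := by
    refine hb.trans ?_
    have : 0 < R - r := by linarith
    gcongr
  rw [hre z]
  have h4 : -‖f z‖ ≤ (f z).re := (abs_le.1 (Complex.abs_re_le_norm (f z))).1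
  have h5 : Real.exp (-(2 * (Real.log D + 1) * r / (R - r))) ≤ Real.exp (f z).re :=
    Real.exp_le_exp.2 (by linarith)
  nlinarith [Real.exp_pos (f z).re]

section Barrier

variable {E : Type*} [NormedAddCommGroup E] [NormedSpace ℂ E] [FiniteDimensional ℂ E]

lemma exists_norm_det_le (c : ℝ) : ∃ D : ℝ, ∀ A : E →L[ℂ] E, ‖A‖ ≤ c → ‖A.det‖ ≤ D := by
  have : ProperSpace (E →L[ℂ] E) := FiniteDimensional.proper ℂ _
  obtain ⟨D, hD⟩ := ((isCompact_closedBall (0 : E →L[ℂ] E) c).image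
    ContinuousLinearMap.continuous_det).isBounded.exists_norm_le
  exact ⟨D, fun A hA => hD _ (mem_image_of_mem _ (by simpa using hA))⟩

lemma exists_norm_symm_le (c : ℝ) {η : ℝ} (hη : 0 < η) :
    ∃ N : ℝ≥0, 0 < N ∧ ∀ A : E →L[ℂ] E, ‖A‖ ≤ c → η ≤ ‖A.det‖ →
      ∃ e : E ≃L[ℂ] E, (e : E →L[ℂ] E) = A ∧ ‖(e.symm : E →L[ℂ] E)‖ ≤ N := by
  have : ProperSpace (E →L[ℂ] E) := FiniteDimensional.proper ℂ _
  have : CompleteSpace E := FiniteDimensional.complete ℂ E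
  have hdet : ∀ A : E →L[ℂ] E, η ≤ ‖A.det‖ → ∃ e : E ≃L[ℂ] E, (e : E →L[ℂ] E) = A :=
    fun A hA => ⟨A.toContinuousLinearEquivOfDetNeZero (norm_pos_iff.1 (hη.trans_le hA)), by
      ext; simp⟩
  have hK : IsCompact (closedBall (0 : E →L[ℂ] E) c ∩ {A | η ≤ ‖A.det‖}) :=
    (isCompact_closedBall _ _).inter_right
      (isClosed_le continuous_const ContinuousLinearMap.continuous_det.norm)
  have hcont : ContinuousOn (ContinuousLinearMap.inverse : (E →L[ℂ] E) → (E →L[ℂ] E))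
      (closedBall (0 : E →L[ℂ] E) c ∩ {A | η ≤ ‖A.det‖}) := by
    rintro A ⟨-, hA⟩
    obtain ⟨e, rfl⟩ := hdet A hA
    exact (contDiffAt_map_inverse (n := 0) e).continuousAt.continuousWithinAt
  obtain ⟨N, hN⟩ := (hK.image_of_continuousOn hcont).isBounded.exists_norm_le
  refine ⟨⟨|N| + 1, by positivity⟩, ?_, fun A hA hA' => ?_⟩
  · change (0 : ℝ) < |N| + 1
    positivity
  · obtain ⟨e, rfl⟩ := hdet A hA'
    refine ⟨e, rfl, ?_⟩
    have := hN _ (mem_image_of_mem _ ⟨by simpa using hA, hA'⟩)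
    rw [ContinuousLinearMap.inverse_equiv] at this
    change _ ≤ |N| + 1
    linarith [le_abs_self N]

/-- A uniformly open lower bound for the range of a locally biholomorphic map. -/
lemma exists_mem_range_of_dist_le (M : ℝ) {a a' : ℝ} (ha : 0 ≤ a) (haa' : a < a') :
    ∃ δ : ℝ, 0 < δ ∧ ∀ G : E → E, Differentiable ℂ G → (∀ x, (fderiv ℂ G x).det ≠ 0) →
      1 ≤ ‖(fderiv ℂ G 0).det‖ → (∀ y ∈ ball (0 : E) a', ‖G y‖ ≤ M) →
      ∀ x ∈ closedBall (0 : E) a, ∀ q, dist q (G x) ≤ δ → q ∈ range G := by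
  set d := (a' - a) / 4 with hd'
  have hd : 0 < d := by rw [hd']; linarith
  set c := 2 * M / d
  obtain ⟨D, hD⟩ := exists_norm_det_le (E := E) c
  set η := Real.exp (-(2 * (Real.log D + 1) * a / ((a + d) - a)))
  obtain ⟨N, hN0, hN⟩ := exists_norm_symm_le (E := E) c (Real.exp_pos _ : 0 < η)
  have hN0' : (0 : ℝ) < N := hN0
  set B := 4 * |M| / d ^ 2 with hB
  have hB0 : 0 ≤ B := by positivity
  set ρ := min d (1 / (2 * N * (B + 1))) with hρ
  have hρ0 : 0 < ρ := lt_min hd (by positivity)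
  refine ⟨ρ / (2 * N), by positivity, fun G hG hdet hdet0 hGM x hx q hq => ?_⟩
  rw [mem_closedBall_zero_iff] at hx
  have hb : ∀ y : E, ‖y‖ + d ≤ a' → ‖fderiv ℂ G y‖ ≤ c := fun y hy =>
    norm_fderiv_le_of_norm_le hG hd fun w hw => hGM w (by
      rw [mem_ball, dist_eq_norm] at hw
      rw [mem_ball_zero_iff]
      linarith [norm_le_norm_add_norm_sub y w, norm_sub_rev y w])
  have hη : η ≤ ‖(fderiv ℂ G x).det‖ := by
    set v : E := ((‖x‖⁻¹ : ℝ) : ℂ) • x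
    have hv : ‖v‖ ≤ 1 := by
      rw [norm_smul, Complex.norm_real, norm_inv, norm_norm]
      exact inv_mul_le_one
    have hxv : ((‖x‖ : ℝ) : ℂ) • v = x := by
      rcases eq_or_ne x 0 with h | h
      · simp [h, v]
      · have : ‖x‖ ≠ 0 := norm_ne_zero_iff.2 h
        simp [v, smul_smul, this]
    have := norm_ge_exp_of_zero_free (differentiable_det_fderiv_smul hG v) (fun z => hdet _)
      (r := a) (R := a + d) (D := D) (by linarith) ha (fun z hz => hD _ (hb _ ?_))
      (by simpa using hdet0) (z := (‖x‖ : ℝ)) (by simpa using hx)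
    · rwa [hxv] at this
    · rw [mem_ball_zero_iff] at hz
      rw [norm_smul]
      nlinarith [norm_nonneg z, norm_nonneg v]
  obtain ⟨e, he, heN⟩ := hN _ (hb x (by linarith)) hη
  have happ := approximatesLinearOn_closedBall hG hd hGM (x := x) (by linarith) (ρ := ρ)
    (min_le_left _ _) (c := (2 * N)⁻¹) (by
      have h1 : ρ * (2 * N * (B + 1)) ≤ 1 := by
        have := min_le_right d (1 / (2 * N * (B + 1)))
        rw [← hρ] at this
        rwa [le_div_iff₀ (by positivity)] at this
      have h2 : 4 * M / d ^ 2 ≤ B := by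
        rw [hB]; gcongr; exact le_abs_self M
      push_cast
      rw [← one_div, le_div_iff₀ (by positivity)]
      have : 4 * M / d ^ 2 * ρ ≤ B * ρ := by gcongr
      nlinarith [mul_pos hN0' hρ0])
  have hs := happ.surjOn_closedBall_of_nonlinearRightInverse
    ⟨e.symm, N, fun y => (e.symm : E →L[ℂ] E).le_of_opNorm_le heN y, fun y => by
      rw [← he]; simp⟩ hρ0.le subset_rfl
  obtain ⟨w, -, hw⟩ := hs (show q ∈ _ by
    rw [mem_closedBall]
    refine hq.trans (le_of_eq ?_)
    push_cast
    field_simp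
    ring)
  exact ⟨w, hw⟩

lemma exists_dense_barrier [Nontrivial E] :
    ∃ δ : ℕ → ℝ, (∀ k, 0 < δ k) ∧ ∀ Γ : Set E,
      (∀ (k : ℕ) (e : E), ‖e‖ = 2 * k + 1 → ∃ q ∈ Γ, dist q e ≤ δ k) →
      ∀ G : E → E, Differentiable ℂ G → (∀ x, (fderiv ℂ G x).det ≠ 0) →
        ∃ q ∈ Γ, q ∈ range G := by
  set a : ℕ → ℝ := fun k => 2 - 1 / (k + 1) with ha
  have ha1 : ∀ k, 1 ≤ a k := fun k => by
    have : (1 : ℝ) / (k + 1) ≤ 1 := by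
      rw [div_le_one (by positivity)]; linarith [(Nat.cast_nonneg k : (0 : ℝ) ≤ k)]
    simp only [ha]; linarith
  have ha2 : ∀ k, a k ≤ 2 := fun k => by
    have : (0 : ℝ) ≤ 1 / (k + 1) := by positivity
    simp only [ha]; linarith
  have hlt : ∀ k, a k < a (k + 1) := fun k => by
    have : (1 : ℝ) / ((k + 1 : ℕ) + 1) < 1 / (k + 1) := by
      push_cast; gcongr; linarith
    simp only [ha]; linarith
  choose δ hδ hδ' using fun k : ℕ => exists_mem_range_of_dist_le (E := E) (2 * (k + 1 : ℕ) + 1)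
    (zero_le_one.trans (ha1 k)) (hlt k)
  refine ⟨δ, hδ, fun Γ hΓ G hG hdet => ?_⟩
  by_contra! hcon
  obtain ⟨k₀, hk₀⟩ := exists_nat_gt ‖G 0‖
  have hbound : ∀ R : ℝ, 1 ≤ R → ‖(fderiv ℂ G 0).det‖⁻¹ ≤ R →
      ∀ x ∈ closedBall (0 : E) 1, ‖G ((R : ℂ) • x)‖ < 2 * k₀ + 1 := by
    intro R hR1 hR2
    have hR0 : (R : ℂ) ≠ 0 := by exact_mod_cast (by linarith : R ≠ 0)
    set H : E → E := fun x => G ((R : ℂ) • x) with hH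
    have hHd : Differentiable ℂ H := hG.comp (by fun_prop)
    have hHf : ∀ x, fderiv ℂ H x = (R : ℂ) • fderiv ℂ G ((R : ℂ) • x) := fun x => by
      rw [hH, fderiv_comp_smul]
    have hHdet : ∀ x, (fderiv ℂ H x).det =
        (R : ℂ) ^ Module.finrank ℂ E * (fderiv ℂ G ((R : ℂ) • x)).det := fun x => by
      rw [hHf, ContinuousLinearMap.det, ContinuousLinearMap.toLinearMap_smul, LinearMap.det_smul]
    have hH0 : 1 ≤ ‖(fderiv ℂ H 0).det‖ := by
      have hp : 0 < ‖(fderiv ℂ G 0).det‖ := norm_pos_iff.2 (hdet 0)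
      rw [hHdet, smul_zero, norm_mul, norm_pow, Complex.norm_real,
        Real.norm_of_nonneg (by linarith)]
      have h1 : R ≤ R ^ Module.finrank ℂ E :=
        le_self_pow₀ hR1 (Module.finrank_pos).ne'
      calc (1 : ℝ) = ‖(fderiv ℂ G 0).det‖⁻¹ * ‖(fderiv ℂ G 0).det‖ := by field_simp
        _ ≤ _ := by gcongr; exact hR2.trans h1
    have hstep : ∀ k, k₀ ≤ k → (∀ x ∈ closedBall (0 : E) (a (k + 1)), ‖H x‖ < 2 * (k + 1 : ℕ) + 1) →
        ∀ x ∈ closedBall (0 : E) (a k), ‖H x‖ < 2 * k + 1 := by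
      intro k hk hP x hx
      by_contra! hge
      have h0 : ‖H 0‖ ≤ 2 * k + 1 := by
        have : (k₀ : ℝ) ≤ k := by exact_mod_cast hk
        simp only [hH, smul_zero]
        linarith [(Nat.cast_nonneg k : (0 : ℝ) ≤ k)]
      obtain ⟨y, hy, hy2⟩ := (convex_closedBall (0 : E) (a k)).isPreconnected.intermediate_value
        (mem_closedBall_self (by linarith [ha1 k])) hx hHd.continuous.norm.continuousOn
        (show (2 * k + 1 : ℝ) ∈ Icc ‖H 0‖ ‖H x‖ from ⟨h0, hge⟩)
      obtain ⟨q, hq, hqy⟩ := hΓ k (H y) hy2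
      obtain ⟨w, hw⟩ := hδ' k H hHd
        (fun x => by rw [hHdet]; exact mul_ne_zero (pow_ne_zero _ hR0) (hdet _)) hH0
        (fun z hz => (hP z (ball_subset_closedBall hz)).le) y hy q hqy
      exact hcon q hq ⟨_, hw⟩
    obtain ⟨B, hB⟩ := (((FiniteDimensional.proper ℂ E).isCompact_closedBall (0 : E) 2).image
      hHd.continuous).isBounded.exists_norm_le
    obtain ⟨m, hm⟩ := exists_nat_gt B
    have hall : ∀ j, ∀ x ∈ closedBall (0 : E) (a (k₀ + m - j)),
        ‖H x‖ < 2 * (k₀ + m - j : ℕ) + 1 ∨ m < j := by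
      intro j
      induction j with
      | zero =>
        intro x hx
        left
        have := hB _ (mem_image_of_mem _ (closedBall_subset_closedBall (ha2 _) hx))
        rw [Nat.sub_zero]
        push_cast
        linarith [(Nat.cast_nonneg k₀ : (0 : ℝ) ≤ k₀), (Nat.cast_nonneg m : (0 : ℝ) ≤ m)]
      | succ j ih =>
        intro x hx
        rcases lt_or_ge m (j + 1) with h | h
        · exact Or.inr h
        · left
          refine hstep (k₀ + m - (j + 1)) (by omega) ?_ x hx
          have he : k₀ + m - (j + 1) + 1 = k₀ + m - j := by omega
          rw [he]
          intro y hy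
          exact (ih y hy).resolve_right (by omega)
    intro x hx
    have := (hall m x ?_).resolve_right (lt_irrefl m)
    · rwa [Nat.add_sub_cancel] at this
    · exact closedBall_subset_closedBall (ha1 _) hx
  set R₁ : ℝ := 1 + ‖(fderiv ℂ G 0).det‖⁻¹ with hR₁
  have hR₁' : 0 ≤ ‖(fderiv ℂ G 0).det‖⁻¹ := by positivity
  have hbd : Bornology.IsBounded (range G) := by
    rw [isBounded_iff_forall_norm_le]
    refine ⟨2 * k₀ + 1, ?_⟩
    rintro _ ⟨x, rfl⟩
    set R := R₁ + ‖x‖ with hR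
    have hRp : 0 < R := by positivity
    have hRc : (R : ℂ) ≠ 0 := by exact_mod_cast hRp.ne'
    have := hbound R (by rw [hR, hR₁]; linarith [norm_nonneg x])
      (by rw [hR, hR₁]; linarith [norm_nonneg x]) ((R : ℂ)⁻¹ • x) (by
        rw [mem_closedBall_zero_iff, norm_smul, norm_inv, Complex.norm_real,
          Real.norm_of_nonneg hRp.le, inv_mul_le_one₀ hRp, hR, hR₁]
        linarith)
    rw [smul_smul, mul_inv_cancel₀ hRc, one_smul] at this
    exact this.le
  apply hdet 0
  have hconst : G = fun _ => G 0 := funext fun x => hG.apply_eq_apply_of_bounded hbd x 0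
  rw [hconst, fderiv_fun_const]
  rw [Pi.zero_apply, ContinuousLinearMap.det, ContinuousLinearMap.toLinearMap_zero,
    LinearMap.det_zero]
  exact zero_pow Module.finrank_pos.ne'

end Barrier

section LineComplement

variable {E : Type*} [NormedAddCommGroup E] [NormedSpace ℂ E] [FiniteDimensional ℂ E]

lemma det_ne_zero_of_injective {A : E →L[ℂ] E} (hA : ∀ v, A v = 0 → v = 0) : A.det ≠ 0 := by
  intro h
  obtain ⟨v, hv, hv0⟩ := SetLike.exists_of_lt (LinearMap.bot_lt_ker_of_det_eq_zero h)
  exact hv0 (by simpa using hA v hv)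

/-- A locally biholomorphic self-map omitting a given affine line. -/
lemma exists_locally_biholomorphic_omitting_line (hE : 2 ≤ Module.finrank ℂ E) (a b : E) :
    ∃ H : E → E, Differentiable ℂ H ∧ (∀ x v, fderiv ℂ H x v = 0 → v = 0) ∧
      ∀ x, H x ∉ range fun t : ℂ => a + t • b := by
  have hlt : Submodule.span ℂ {b} < ⊤ := by
    refine lt_top_iff_ne_top.2 fun h => ?_
    have h1 : Module.finrank ℂ (Submodule.span ℂ {b}) ≤ 1 := by
      simpa using finrank_span_le_card (R := ℂ) ({b} : Set E)
    rw [h, finrank_top] at h1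
    omega
  obtain ⟨f, hf0, hf⟩ := Submodule.exists_le_ker_of_lt_top _ hlt
  obtain ⟨m, hm⟩ : ∃ m : E →L[ℂ] ℂ, ∀ x, m x = f x :=
      ⟨LinearMap.toContinuousLinearMap f, fun x => rfl⟩
  have hmb : m b = 0 := by rw [hm]; exact hf (Submodule.mem_span_singleton_self b)
  obtain ⟨w, hw⟩ : ∃ w, m w = 1 := by
    obtain ⟨w, hw⟩ : ∃ w, f w ≠ 0 := by
      by_contra! h
      exact hf0 (LinearMap.ext h)
    exact ⟨(f w)⁻¹ • w, by rw [hm, map_smul, smul_eq_mul, inv_mul_cancel₀ hw]⟩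
  have hder : ∀ x, HasFDerivAt (fun x => a + x + (Complex.exp (m x) - m x) • w)
      (ContinuousLinearMap.id ℂ E + (Complex.exp (m x) • m - m).smulRight w) x := fun x =>
    ((hasFDerivAt_id x).const_add a).add ((m.hasFDerivAt.cexp.sub m.hasFDerivAt).smul_const w)
  refine ⟨fun x => a + x + (Complex.exp (m x) - m x) • w, fun x => (hder x).differentiableAt,
    fun x v hv => ?_, fun x => ?_⟩
  · rw [(hder x).fderiv] at hv
    have h1 := congrArg m hv
    simp [hw] at h1
    simpa [h1] using hv
  · rintro ⟨t, ht⟩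
    have h1 := congrArg m ht
    simp [hw, hmb] at h1

lemma exists_locally_biholomorphic_disjoint (hE : 2 ≤ Module.finrank ℂ E) {Φ Φ' : E → E}
    (hΦ : Differentiable ℂ Φ) (hΦ' : Differentiable ℂ Φ') (h : ∀ z, Φ (Φ' z) = z)
    {Γ : Set E} {a b : E} (hΓ : Φ '' Γ = range fun t : ℂ => a + t • b) :
    ∃ G : E → E, Differentiable ℂ G ∧ (∀ x, (fderiv ℂ G x).det ≠ 0) ∧ ∀ q ∈ Γ, q ∉ range G := by
  obtain ⟨H, hH, hHi, hHr⟩ := exists_locally_biholomorphic_omitting_line hE a b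
  refine ⟨fun x => Φ' (H x), hΦ'.comp hH, fun x => det_ne_zero_of_injective fun v hv => hHi x v ?_,
    ?_⟩
  · have h1 : fderiv ℂ (fun x => Φ (Φ' (H x))) x v = 0 := by
      have hd : DifferentiableAt ℂ (fun x => Φ' (H x)) x := (hΦ'.comp hH) x
      rw [fderiv_fun_comp (f := fun x => Φ' (H x)) x (hΦ _) hd]
      change fderiv ℂ Φ _ (fderiv ℂ (fun x => Φ' (H x)) x v) = 0
      rw [hv, map_zero]
    simpa only [h] using h1
  · rintro q hq ⟨x, rfl⟩
    refine hHr x ?_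
    rw [← hΓ]
    exact ⟨_, hq, h _⟩

end LineComplement

section ShearGroup

variable {E : Type*} [NormedAddCommGroup E] [NormedSpace ℂ E]

lemma exists_bound_and_lipschitz_bound {F : Type*} [NormedAddCommGroup F] [NormedSpace ℂ F]
    [FiniteDimensional ℂ E] {G : E → F} (hG : Differentiable ℂ G) (ρ : ℝ) :
    ∃ B : ℝ, 0 ≤ B ∧ ∀ x y : E, ‖x‖ ≤ ρ → ‖y‖ ≤ ρ →
      ‖G x‖ ≤ B ∧ ‖G x - G y‖ ≤ B * ‖x - y‖ := by
  obtain ⟨M, hM⟩ := (((FiniteDimensional.proper ℂ E).isCompact_closedBall (0 : E) (ρ + 1)).image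
    hG.continuous).isBounded.exists_norm_le
  have hb : ∀ y ∈ closedBall (0 : E) (ρ + 1), ‖G y‖ ≤ M := fun y hy =>
    hM _ (mem_image_of_mem _ hy)
  refine ⟨2 * |M|, by positivity, fun x y hx hy => ⟨?_, ?_⟩⟩
  · have := hb x (by rw [mem_closedBall_zero_iff]; linarith)
    linarith [le_abs_self M, abs_nonneg M]
  · have := norm_sub_le_of_norm_le hG one_pos (fun w hw => hb w (ball_subset_closedBall hw))
      (x := y) (y := x) (by linarith) (by linarith)
    refine this.trans ?_
    rw [div_one]
    gcongr
    exact le_abs_self M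

/-- The group generated by the polynomial shears `x ↦ x + (l x)ᵏ v` with `l v = 0`. -/
def shearGroup (E : Type*) [NormedAddCommGroup E] [NormedSpace ℂ E] : Subgroup (Equiv.Perm E) :=
  Subgroup.closure {σ | ∃ (l : E →L[ℂ] ℂ) (v : E) (k : ℕ), l v = 0 ∧ ∀ x, σ x = x + l x ^ k • v}

/-- The shear `x ↦ x + (l x)ᵏ v`. -/
def shear (l : E →L[ℂ] ℂ) (v : E) (hv : l v = 0) (k : ℕ) : Equiv.Perm E where
  toFun x := x + l x ^ k • v
  invFun x := x - l x ^ k • v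
  left_inv x := by simp [hv]
  right_inv x := by simp [hv]

lemma shear_apply (l : E →L[ℂ] ℂ) (v : E) (hv : l v = 0) (k : ℕ) (x : E) :
    shear l v hv k x = x + l x ^ k • v := rfl

lemma shear_inv_apply (l : E →L[ℂ] ℂ) (v : E) (hv : l v = 0) (k : ℕ) (x : E) :
    (shear l v hv k)⁻¹ x = x - l x ^ k • v := rfl

lemma shear_mem (l : E →L[ℂ] ℂ) (v : E) (hv : l v = 0) (k : ℕ) :
    shear l v hv k ∈ shearGroup E :=
  Subgroup.subset_closure ⟨l, v, k, hv, fun _ => rfl⟩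

lemma shearGroup_induction {p : Equiv.Perm E → Prop} (h1 : p 1)
    (hmul : ∀ σ τ, p σ → p τ → p (σ * τ))
    (hs : ∀ l v hv k, p (shear l v hv k)) {σ : Equiv.Perm E}
    (hσ : σ ∈ shearGroup E) : p σ := by
  induction hσ using Subgroup.closure_induction'' with
  | mem σ hσ =>
    obtain ⟨l, v, k, hv, h⟩ := hσ
    have : σ = shear l v hv k := Equiv.ext h
    rw [this]
    exact hs l v hv k
  | inv_mem σ hσ =>
    obtain ⟨l, v, k, hv, h⟩ := hσ
    have : σ⁻¹ = shear l (-v) (by simp [hv]) k := by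
      rw [inv_eq_iff_mul_eq_one]
      ext x
      simp [shear_apply, h, hv]
    rw [this]
    exact hs _ _ _ _
  | one => exact h1
  | mul σ τ _ _ hσ hτ => exact hmul σ τ hσ hτ

lemma differentiable_of_mem_shearGroup {σ : Equiv.Perm E} (hσ : σ ∈ shearGroup E) :
    Differentiable ℂ σ := by
  refine shearGroup_induction (p := fun σ => Differentiable ℂ σ) differentiable_id
    (fun σ τ h1 h2 => h1.comp h2)
    (fun l v hv k => ?_) hσ
  exact differentiable_id.add ((l.differentiable.pow k).smul_const v)

end ShearGroup

section PolynomialFunctions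

variable {E : Type*} [NormedAddCommGroup E] [NormedSpace ℂ E]

/-- Polynomial functions, presented as linear combinations of powers of linear forms. -/
def polyFun (E : Type*) [NormedAddCommGroup E] [NormedSpace ℂ E] : Submodule ℂ (E → ℂ) :=
  Submodule.span ℂ {f | ∃ (l : E →L[ℂ] ℂ) (k : ℕ), f = fun x => l x ^ k}

lemma pow_mem_polyFun (l : E →L[ℂ] ℂ) (k : ℕ) : (fun x => l x ^ k) ∈ polyFun E :=
  Submodule.subset_span ⟨l, k, rfl⟩

lemma coeff_mem_of_forall_sum_mem {V : Type*} [AddCommGroup V] [Module ℂ V] (W : Submodule ℂ V)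
    (N : ℕ) (v : ℕ → V) (h : ∀ c : ℂ, ∑ j ∈ Finset.range (N + 1), c ^ j • v j ∈ W) {j : ℕ}
    (hj : j ≤ N) : v j ∈ W := by
  rw [← Submodule.Quotient.mk_eq_zero, ← Module.forall_dual_apply_eq_zero_iff ℂ]
  intro φ
  set P : Polynomial ℂ := ∑ j ∈ Finset.range (N + 1),
    Polynomial.monomial j (φ (Submodule.Quotient.mk (v j)))
  have hP : P = 0 := by
    refine Polynomial.funext fun c => ?_
    have := congrArg φ ((Submodule.Quotient.mk_eq_zero W).2 (h c))
    simp only [← Submodule.mkQ_apply, map_sum, map_smul, smul_eq_mul, map_zero] at this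
    simp only [P, Polynomial.eval_finsetSum, Polynomial.eval_monomial, Polynomial.eval_zero]
    rw [← this]
    exact Finset.sum_congr rfl fun _ _ => mul_comm _ _
  have := congrArg (fun p => Polynomial.coeff p j) hP
  simpa [P, Polynomial.finsetSum_coeff, Polynomial.coeff_monomial, Nat.lt_succ_iff, hj] using this

lemma mul_mem_polyFun {f g : E → ℂ} (hf : f ∈ polyFun E) (hg : g ∈ polyFun E) :
    f * g ∈ polyFun E := by
  refine Submodule.span_induction₂ (p := fun f g _ _ => f * g ∈ polyFun E) ?_ ?_ ?_ ?_ ?_ ?_ ?_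
    hf hg
  · rintro _ _ ⟨l, i, rfl⟩ ⟨m, j, rfl⟩
    have key := coeff_mem_of_forall_sum_mem (polyFun E) (i + j)
      (fun k => fun x => l x ^ (i + j - k) * m x ^ k * ((i + j).choose k : ℂ))
      (fun c => ?_) (show j ≤ i + j by omega)
    · have hne : ((i + j).choose j : ℂ) ≠ 0 := by
        exact_mod_cast (Nat.choose_pos (by omega)).ne'
      convert (polyFun E).smul_mem ((i + j).choose j : ℂ)⁻¹ key using 1
      ext x
      simp only [Pi.mul_apply, Pi.smul_apply, smul_eq_mul, Nat.add_sub_cancel]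
      field_simp
    · convert pow_mem_polyFun (l + c • m) (i + j) using 1
      ext x
      simp only [Finset.sum_apply, Pi.smul_apply, smul_eq_mul, add_apply,
        smul_apply]
      rw [add_comm (l x), add_pow]
      refine Finset.sum_congr rfl fun k _ => ?_
      rw [mul_pow]
      ring
  · intro g _; simp
  · intro g _; simp
  · intro f g h _ _ _ h1 h2; rw [add_mul]; exact add_mem h1 h2
  · intro f g h _ _ _ h1 h2; rw [mul_add]; exact add_mem h1 h2
  · intro c f g _ _ h1; rw [smul_mul_assoc]; exact Submodule.smul_mem _ c h1
  · intro c f g _ _ h1; rw [mul_smul_comm]; exact Submodule.smul_mem _ c h1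

lemma fun_pow_mem_polyFun {f : E → ℂ} (hf : f ∈ polyFun E) (k : ℕ) : f ^ k ∈ polyFun E := by
  induction k with
  | zero => exact pow_mem_polyFun (0 : E →L[ℂ] ℂ) 0
  | succ k ih => rw [pow_succ]; exact mul_mem_polyFun ih hf

lemma linear_mem_polyFun (l : E →L[ℂ] ℂ) : (l : E → ℂ) ∈ polyFun E := by
  simpa using pow_mem_polyFun l 1

lemma comp_mem_polyFun {σ : Equiv.Perm E} (hσ : σ ∈ shearGroup E) :
    ∀ f ∈ polyFun E, f ∘ σ ∈ polyFun E := by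
  refine shearGroup_induction (p := fun σ => ∀ f ∈ polyFun E, f ∘ σ ∈ polyFun E)
    (fun f hf => hf) (fun σ τ h1 h2 f hf => h2 _ (h1 f hf)) (fun l v hv k f hf => ?_) hσ
  induction hf using Submodule.span_induction with
  | mem f hf =>
    obtain ⟨m, j, rfl⟩ := hf
    have : (fun x => m x ^ j) ∘ shear l v hv k = ((m : E → ℂ) + m v • fun x => l x ^ k) ^ j := by
      ext x
      simp [shear_apply, mul_comm]
    rw [this]
    exact fun_pow_mem_polyFun (add_mem (linear_mem_polyFun m)
      (Submodule.smul_mem _ _ (pow_mem_polyFun l k))) j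
  | zero => exact zero_mem _
  | add f g _ _ h1 h2 => exact add_mem h1 h2
  | smul c f _ h1 => exact Submodule.smul_mem _ c h1

lemma differentiable_of_mem_polyFun {f : E → ℂ} (hf : f ∈ polyFun E) : Differentiable ℂ f := by
  induction hf using Submodule.span_induction with
  | mem f hf => obtain ⟨m, j, rfl⟩ := hf; exact m.differentiable.pow j
  | zero => exact differentiable_const 0
  | add f g _ _ h1 h2 => exact h1.add h2
  | smul c f _ h1 => exact h1.const_smul c

lemma exists_polynomial_of_mem_polyFun {f : E → ℂ} (hf : f ∈ polyFun E) (p v : E) :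
    ∃ P : Polynomial ℂ, ∀ ζ : ℂ, f (p + ζ • v) = P.eval ζ := by
  induction hf using Submodule.span_induction with
  | mem f hf =>
    obtain ⟨m, j, rfl⟩ := hf
    exact ⟨(Polynomial.C (m p) + Polynomial.X * Polynomial.C (m v)) ^ j, fun ζ => by
      simp only [map_add, map_smul, smul_eq_mul, Polynomial.eval_pow, Polynomial.eval_add,
        Polynomial.eval_mul, Polynomial.eval_C, Polynomial.eval_X]⟩
  | zero => exact ⟨0, fun ζ => by simp⟩
  | add f g _ _ h1 h2 =>
    obtain ⟨P, hP⟩ := h1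
    obtain ⟨Q, hQ⟩ := h2
    exact ⟨P + Q, fun ζ => by simp [hP, hQ]⟩
  | smul c f _ h1 =>
    obtain ⟨P, hP⟩ := h1
    exact ⟨Polynomial.C c * P, fun ζ => by simp [hP]⟩

end PolynomialFunctions

section Displacement

variable {E : Type*} [NormedAddCommGroup E]

/-- `χ` and its inverse move points by at most `ε` on the `(r - ε)`-neighbourhood of `K`. -/
def Displaces (K : Set E) (r ε : ℝ) (χ : Equiv.Perm E) : Prop :=
  ∀ k ∈ K, ∀ y, ‖y - k‖ ≤ r - ε → ‖χ y - y‖ ≤ ε ∧ ‖χ⁻¹ y - y‖ ≤ ε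

namespace Displaces

variable {K : Set E} {r ε ε' : ℝ} {χ χ' : Equiv.Perm E}

lemma one (K : Set E) (r : ℝ) : Displaces K r 0 (1 : Equiv.Perm E) := by
  intro k _ y _; simp

lemma mono (h : Displaces K r ε χ) (hε : ε ≤ ε') : Displaces K r ε' χ := fun k hk y hy =>
  have := h k hk y (by linarith)
  ⟨this.1.trans hε, this.2.trans hε⟩

lemma inv (h : Displaces K r ε χ) : Displaces K r ε χ⁻¹ := fun k hk y hy =>
  ⟨(h k hk y hy).2, by simpa using (h k hk y hy).1⟩

lemma mul (h' : Displaces K r ε' χ') (h : Displaces K r ε χ) (hε : 0 ≤ ε) (hε' : 0 ≤ ε') :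
    Displaces K r (ε + ε') (χ' * χ) := by
  intro k hk y hy
  have h1 := (h k hk y (by linarith)).1
  have h2 := (h' k hk y (by linarith)).2
  have e1 : ‖χ y - k‖ ≤ r - ε' := by
    linarith [norm_sub_le_norm_sub_add_norm_sub (χ y) y k]
  have e2 : ‖χ'⁻¹ y - k‖ ≤ r - ε := by
    linarith [norm_sub_le_norm_sub_add_norm_sub (χ'⁻¹ y) y k]
  have h3 := (h' k hk _ e1).1
  have h4 := (h k hk _ e2).2
  rw [mul_inv_rev, Equiv.Perm.mul_apply, Equiv.Perm.mul_apply]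
  exact ⟨by linarith [norm_sub_le_norm_sub_add_norm_sub (χ' (χ y)) (χ y) y],
    by linarith [norm_sub_le_norm_sub_add_norm_sub (χ⁻¹ (χ'⁻¹ y)) (χ'⁻¹ y) y]⟩

end Displaces

lemma norm_comp_sub_le {f₁ f₂ X₁ X₂ : E → E} {x : E} {a₁ a₂ b₁ L : ℝ} (hL : 0 ≤ L)
    (h1 : ‖f₁ x - x - X₁ x‖ ≤ a₁) (h2 : ‖f₂ (f₁ x) - f₁ x - X₂ (f₁ x)‖ ≤ a₂)
    (hX1 : ‖X₁ x‖ ≤ b₁) (hX2 : ‖X₂ (f₁ x) - X₂ x‖ ≤ L * ‖f₁ x - x‖) :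
    ‖f₂ (f₁ x) - x - (X₁ x + X₂ x)‖ ≤ a₁ + a₂ + L * (a₁ + b₁) := by
  have e : f₂ (f₁ x) - x - (X₁ x + X₂ x) = (f₁ x - x - X₁ x) +
      (f₂ (f₁ x) - f₁ x - X₂ (f₁ x)) + (X₂ (f₁ x) - X₂ x) := by abel
  have h3 : ‖f₁ x - x‖ ≤ a₁ + b₁ := by
    have : f₁ x - x = (f₁ x - x - X₁ x) + X₁ x := by abel
    rw [this]
    exact norm_add_le_of_le h1 hX1
  rw [e]
  refine norm_add_le_of_le (norm_add_le_of_le h1 h2) (hX2.trans ?_)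
  gcongr

end Displacement

section EulerScheme

variable {E : Type*} [NormedAddCommGroup E] [NormedSpace ℂ E]

/-- Parametrised vector fields whose small-time flows are approximated, to second order and
uniformly on bounded sets, by elements of the shear group. -/
structure Flowable (X : ℂ × ℂ → E → E) : Prop where
  bound : ∀ ρ : ℝ, ∃ B : ℝ, 0 ≤ B ∧ ∀ p x y, ‖x‖ ≤ ρ → ‖y‖ ≤ ρ →
    ‖X p x‖ ≤ B * ‖p‖ ∧ ‖X p x - X p y‖ ≤ B * ‖p‖ * ‖x - y‖
  approx : ∀ ρ : ℝ, ∃ C D : ℝ, 0 ≤ C ∧ 0 < D ∧ ∀ p, ‖p‖ ≤ D → ∃ ψ ∈ shearGroup E, ∀ x, ‖x‖ ≤ ρ →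
    ‖ψ x - x - X p x‖ ≤ C * ‖p‖ ^ 2 ∧ ‖ψ⁻¹ x - x + X p x‖ ≤ C * ‖p‖ ^ 2

namespace Flowable

lemma zero : Flowable (fun _ _ => 0 : ℂ × ℂ → E → E) where
  bound ρ := ⟨0, le_rfl, by simp⟩
  approx ρ := ⟨0, 1, le_rfl, one_pos, fun p _ => ⟨1, one_mem _, by simp⟩⟩

lemma comp_smul {X : ℂ × ℂ → E → E} (h : Flowable X) (c : ℂ) :
    Flowable (fun p => X (c • p)) where
  bound ρ := by
    obtain ⟨B, hB0, hB⟩ := h.bound ρ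
    refine ⟨B * ‖c‖, by positivity, fun p x y hx hy => ?_⟩
    have := hB (c • p) x y hx hy
    rwa [norm_smul, ← mul_assoc] at this
  approx ρ := by
    obtain ⟨C, D, hC0, hD0, hC⟩ := h.approx ρ
    refine ⟨C * ‖c‖ ^ 2, D / (‖c‖ + 1), by positivity, by positivity, fun p hp => ?_⟩
    obtain ⟨ψ, hψ, h'⟩ := hC (c • p) (by
      rw [le_div_iff₀ (by positivity)] at hp
      rw [norm_smul]
      nlinarith [norm_nonneg p])
    refine ⟨ψ, hψ, fun x hx => ?_⟩
    have := h' x hx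
    rwa [norm_smul, mul_pow, ← mul_assoc] at this

lemma add {X Y : ℂ × ℂ → E → E} (hX : Flowable X) (hY : Flowable Y) :
    Flowable (fun p x => X p x + Y p x) where
  bound ρ := by
    obtain ⟨B, hB0, hB⟩ := hX.bound ρ
    obtain ⟨B', hB0', hB'⟩ := hY.bound ρ
    refine ⟨B + B', by positivity, fun p x y hx hy => ⟨?_, ?_⟩⟩
    · rw [add_mul]
      exact norm_add_le_of_le (hB p x y hx hy).1 (hB' p x y hx hy).1
    · rw [add_sub_add_comm, add_mul, add_mul]
      exact norm_add_le_of_le (hB p x y hx hy).2 (hB' p x y hx hy).2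
  approx ρ := by
    obtain ⟨B, hB0, hB⟩ := hX.bound (ρ + 1)
    obtain ⟨B', hB0', hB'⟩ := hY.bound (ρ + 1)
    obtain ⟨C, D, hC0, hD0, hC⟩ := hX.approx (ρ + 1)
    obtain ⟨C', D', hC0', hD0', hC'⟩ := hY.approx (ρ + 1)
    set D₀ := min (min D D') (min 1 (1 / (B + C + B' + C' + 1)))
    have hD₀ : 0 < D₀ := lt_min (lt_min hD0 hD0') (lt_min one_pos (by positivity))
    refine ⟨C + C' + B' * (C + B) + B * (C' + B'), D₀, by positivity, hD₀, fun p hp => ?_⟩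
    obtain ⟨ψ, hψ, h⟩ := hC p (hp.trans ((min_le_left _ _).trans (min_le_left _ _)))
    obtain ⟨ψ', hψ', h'⟩ := hC' p (hp.trans ((min_le_left _ _).trans (min_le_right _ _)))
    have hp1 : ‖p‖ ≤ 1 := hp.trans ((min_le_right _ _).trans (min_le_left _ _))
    have hp2 : ‖p‖ * (B + C + B' + C' + 1) ≤ 1 := by
      rw [← le_div_iff₀ (by positivity)]
      exact hp.trans ((min_le_right _ _).trans (min_le_right _ _))
    have hsq : ‖p‖ ^ 2 ≤ ‖p‖ := by nlinarith [norm_nonneg p]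
    have hbd : ∀ {b c : ℝ}, 0 ≤ b → 0 ≤ c → b + c ≤ B + C + B' + C' →
        c * ‖p‖ ^ 2 + b * ‖p‖ ≤ (c + b) * ‖p‖ ∧ (c + b) * ‖p‖ ≤ 1 := fun hb hc hbc =>
      ⟨by nlinarith, by nlinarith [norm_nonneg p]⟩
    have near : ∀ {f : E → E} {V : E → E} {b c : ℝ} {x : E}, 0 ≤ b → 0 ≤ c →
        b + c ≤ B + C + B' + C' → ‖x‖ ≤ ρ → ‖f x - x - V x‖ ≤ c * ‖p‖ ^ 2 → ‖V x‖ ≤ b * ‖p‖ →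
        ‖f x‖ ≤ ρ + 1 := by
      intro f V b c x hb hc hbc hx h1 h2
      have e : f x = x + ((f x - x - V x) + V x) := by abel
      rw [e]
      have := hbd hb hc hbc
      exact (norm_add_le_of_le hx (norm_add_le_of_le h1 h2)).trans (by linarith)
    have hsum : ∀ {b c l : ℝ}, 0 ≤ b → 0 ≤ c → 0 ≤ l → b + c ≤ B + C + B' + C' →
        l * ‖p‖ * (c * ‖p‖ ^ 2 + b * ‖p‖) ≤ l * (c + b) * ‖p‖ ^ 2 := fun hb hc hl hbc =>
      (mul_le_mul_of_nonneg_left (hbd hb hc hbc).1 (by positivity)).trans (le_of_eq (by ring))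
    refine ⟨ψ' * ψ, mul_mem hψ' hψ, fun x hx => ?_⟩
    have hx' : ‖x‖ ≤ ρ + 1 := by linarith
    constructor
    · have h1 := (h x hx').1
      have hb := (hB p x x hx' hx').1
      have hfx := near hB0 hC0 (by linarith) hx h1 hb
      refine (norm_comp_sub_le (L := B' * ‖p‖) (by positivity) h1 (h' _ hfx).1 hb
        (hB' p _ _ hfx hx').2).trans ?_
      have := hsum hB0 hC0 hB0' (by linarith)
      have e1 : 0 ≤ B * (C' + B') * ‖p‖ ^ 2 := by positivity
      linarith
    · have h1 : ‖ψ'⁻¹ x - x - -Y p x‖ ≤ C' * ‖p‖ ^ 2 := by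
        rw [sub_neg_eq_add]; exact (h' x hx').2
      have hb : ‖-Y p x‖ ≤ B' * ‖p‖ := by rw [norm_neg]; exact (hB' p x x hx' hx').1
      have hfx := near (V := fun x => -Y p x) hB0' hC0' (by linarith) hx h1 hb
      have h2 : ‖ψ⁻¹ (ψ'⁻¹ x) - ψ'⁻¹ x - -X p (ψ'⁻¹ x)‖ ≤ C * ‖p‖ ^ 2 := by
        rw [sub_neg_eq_add]; exact (h _ hfx).2
      have key := norm_comp_sub_le (f₁ := ⇑ψ'⁻¹) (f₂ := ⇑ψ⁻¹) (X₁ := fun x => -Y p x)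
        (X₂ := fun x => -X p x) (L := B * ‖p‖) (by positivity) h1
        h2 hb
        (by rw [neg_sub_neg, norm_sub_rev]; exact (hB p _ _ hfx hx').2)
      have := hsum hB0' hC0' hB0 (by linarith)
      have e1 : 0 ≤ B' * (C + B) * ‖p‖ ^ 2 := by positivity
      have e2 : (ψ' * ψ)⁻¹ x - x + (X p x + Y p x) =
          ψ⁻¹ (ψ'⁻¹ x) - x - (-Y p x + -X p x) := by
        rw [mul_inv_rev, Equiv.Perm.mul_apply]; abel
      rw [e2]
      refine key.trans ?_
      linarith

lemma of_shear [FiniteDimensional ℂ E] (l : E →L[ℂ] ℂ) (v : E) (hv : l v = 0) (k : ℕ)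
    (α : ℂ × ℂ →L[ℂ] ℂ) : Flowable (fun p x => α p • l x ^ k • v) where
  bound ρ := by
    obtain ⟨B, hB0, hB⟩ := exists_bound_and_lipschitz_bound
      (G := fun x => l x ^ k • v) ((l.differentiable.pow k).smul_const v) ρ
    refine ⟨‖α‖ * B, by positivity, fun p x y hx hy => ⟨?_, ?_⟩⟩
    · rw [norm_smul]
      calc ‖α p‖ * ‖l x ^ k • v‖ ≤ (‖α‖ * ‖p‖) * B := by
            gcongr
            · exact α.le_opNorm p
            · exact (hB x y hx hy).1
        _ = _ := by ring
    · rw [← smul_sub, norm_smul]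
      calc ‖α p‖ * ‖l x ^ k • v - l y ^ k • v‖ ≤ (‖α‖ * ‖p‖) * (B * ‖x - y‖) := by
            gcongr
            · exact α.le_opNorm p
            · exact (hB x y hx hy).2
        _ = _ := by ring
  approx ρ := by
    refine ⟨0, 1, le_rfl, one_pos, fun p _ =>
      ⟨shear l (α p • v) (by simp [hv]) k, shear_mem _ _ _ _, fun x _ => ?_⟩⟩
    rw [shear_apply, shear_inv_apply, smul_comm]
    simp

end Flowable

/-- The field `(∂ₐ f) u - (∂ᵤ f) a`. -/
def crossField (a u : E) (f : E → ℂ) (y : E) : E :=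
  fderiv ℂ f y a • u - fderiv ℂ f y u • a

lemma flowable_crossField [FiniteDimensional ℂ E] (a u : E) {f : E → ℂ} (hf : f ∈ polyFun E)
    (α : ℂ × ℂ →L[ℂ] ℂ) : Flowable (fun p y => α p • crossField a u f y) := by
  induction hf using Submodule.span_induction with
  | mem f hf =>
    obtain ⟨l, k, rfl⟩ := hf
    have := Flowable.of_shear l ((k : ℂ) • (l a • u - l u • a))
      (by simp [mul_comm]) (k - 1) α
    convert this using 5 with p y
    have h1 : fderiv ℂ (fun x => l x ^ k) y = ((k : ℂ) * l y ^ (k - 1)) • l := by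
      rw [((l.hasFDerivAt (x := y)).pow k).fderiv]
      simp
    simp only [crossField, h1, smul_apply, smul_eq_mul]
    module
  | zero =>
    convert Flowable.zero using 3
    simp [crossField]
  | add f g hf hg h1 h2 =>
    convert h1.add h2 using 3
    rw [crossField, fderiv_add (differentiable_of_mem_polyFun hf _)
      (differentiable_of_mem_polyFun hg _)]
    simp only [crossField, add_apply]
    module
  | smul c f hf h1 =>
    convert h1.comp_smul c using 3
    rw [crossField, fderiv_const_smul (differentiable_of_mem_polyFun hf _)]
    simp only [crossField, smul_apply, map_smul, smul_eq_mul]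
    module

lemma flowable_crossField_pair [FiniteDimensional ℂ E] (a u : E) {f g : E → ℂ}
    (hf : f ∈ polyFun E) (hg : g ∈ polyFun E) :
    Flowable (fun p y => p.1 • crossField a u f y + p.2 • crossField a u g y) :=
  (flowable_crossField a u hf (ContinuousLinearMap.fst ℂ ℂ ℂ)).add
    (flowable_crossField a u hg (ContinuousLinearMap.snd ℂ ℂ ℂ))

end EulerScheme

section Euler

variable {E : Type*} [NormedAddCommGroup E] [NormedSpace ℂ E]

/-- Euler's scheme along the segment from `e` to `e + u`. -/
lemma Flowable.exists_shearGroup_along_segment {X : ℂ × ℂ → E → E} (hX : Flowable X)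
    (hhom : ∀ (s : ℂ) p y, X (s • p) y = s • X p y) {P : E → ℂ × ℂ} {e u : E} {T : Set E}
    {τ D ρ : ℝ} (hτ : 0 < τ)
    (hT : ∀ (x : E) (t : ℝ), 0 ≤ t → t ≤ 1 → ‖x - (e + (t : ℂ) • u)‖ ≤ τ → x ∈ T)
    (hD : ∀ x ∈ T, ‖x‖ ≤ ρ ∧ ‖P x‖ ≤ D ∧ X (P x) x = u) {ι : Type*} {K : ι → Set E}
    {r κ : ι → ℝ} (hκ0 : ∀ i, 0 ≤ κ i)
    (hκ : ∀ i, ∀ x ∈ T, ∀ k ∈ K i, ∀ y, ‖y - k‖ ≤ r i → ‖y‖ ≤ ρ ∧ ‖X (P x) y‖ ≤ κ i)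
    {γ : ℝ} (hγ : 0 < γ) :
    ∃ χ ∈ shearGroup E, (∀ i, Displaces (K i) (r i) (κ i + γ) χ) ∧ ‖χ e - (e + u)‖ ≤ γ := by
  obtain ⟨C, D₀, hC0, hD0, hC⟩ := hX.approx ρ
  have hD' : 0 ≤ D := (norm_nonneg _).trans
    (hD e (hT e 0 le_rfl zero_le_one (by simpa using hτ.le))).2.1
  obtain ⟨n, hn⟩ := exists_nat_gt (max (D / D₀) (C * D ^ 2 / min τ γ))
  have hn0 : (0 : ℝ) < n := lt_of_le_of_lt (by positivity) hn
  have hn1 : D / n ≤ D₀ := by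
    have := (le_max_left _ _).trans hn.le
    rw [div_le_iff₀ hD0] at this
    rw [div_le_iff₀ hn0]; linarith
  have hn2 : C * D ^ 2 / n ≤ min τ γ := by
    have hm : 0 < min τ γ := lt_min hτ hγ
    have := (le_max_right _ _).trans hn.le
    rw [div_le_iff₀ hm] at this
    rw [div_le_iff₀ hn0]; linarith
  have hsn : ‖((n : ℂ)⁻¹)‖ = 1 / n := by rw [norm_inv, Complex.norm_natCast, one_div]
  set η : ℝ := C * D ^ 2 / n ^ 2 with hη
  have hη0 : 0 ≤ η := by positivity
  have hnη : n * η = C * D ^ 2 / n := by rw [hη]; field_simp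
  have key : ∀ j : ℕ, j ≤ n → ∃ χ ∈ shearGroup E,
      (∀ i, Displaces (K i) (r i) (j * (κ i / n + η)) χ) ∧
        ‖χ e - (e + ((j / n : ℝ) : ℂ) • u)‖ ≤ j * η := by
    intro j
    induction j with
    | zero => exact fun _ => ⟨1, one_mem _, fun i => by simpa using Displaces.one _ _, by simp⟩
    | succ j ih =>
      intro hj
      obtain ⟨χ, hχ, hdisp, hend⟩ := ih (by omega)
      have hjn : (j : ℝ) ≤ n := by exact_mod_cast (by omega : j ≤ n)
      have hx : χ e ∈ T := by
        refine hT _ (j / n) (by positivity) (by rw [div_le_one hn0]; exact hjn) (hend.trans ?_)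
        calc (j : ℝ) * η ≤ n * η := by gcongr
          _ ≤ τ := by rw [hnη]; exact hn2.trans (min_le_left _ _)
      obtain ⟨hxρ, hxD, hxu⟩ := hD _ hx
      have hpn : ‖((n : ℂ)⁻¹) • P (χ e)‖ ≤ D / n := by
        rw [norm_smul, hsn, one_div, inv_mul_eq_div]; gcongr
      obtain ⟨ψ, hψ, happ⟩ := hC _ (hpn.trans hn1)
      have hsq : C * ‖((n : ℂ)⁻¹) • P (χ e)‖ ^ 2 ≤ η := by
        rw [hη, mul_div_assoc, ← div_pow]; gcongr
      simp only [hhom] at happ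
      refine ⟨ψ * χ, mul_mem hψ hχ, fun i => ?_, ?_⟩
      · have hψd : Displaces (K i) (r i) (κ i / n + η) ψ := by
          intro k hk y hy
          have h0 : 0 ≤ κ i / n + η := add_nonneg (div_nonneg (hκ0 i) hn0.le) hη0
          obtain ⟨hyρ, hyκ⟩ := hκ i _ hx k hk y (by linarith)
          obtain ⟨h1, h2⟩ := happ y hyρ
          have h3 : ‖((n : ℂ)⁻¹) • X (P (χ e)) y‖ ≤ κ i / n := by
            rw [norm_smul, hsn, one_div, inv_mul_eq_div]; gcongr
          constructor
          · have e1 : ψ y - y = (n : ℂ)⁻¹ • X (P (χ e)) y +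
                (ψ y - y - (n : ℂ)⁻¹ • X (P (χ e)) y) := by abel
            rw [e1]
            exact norm_add_le_of_le h3 (h1.trans hsq)
          · have e1 : ψ⁻¹ y - y = -((n : ℂ)⁻¹ • X (P (χ e)) y) +
                (ψ⁻¹ y - y + (n : ℂ)⁻¹ • X (P (χ e)) y) := by abel
            rw [e1]
            exact norm_add_le_of_le (by rwa [norm_neg]) (h2.trans hsq)
        have h0 : 0 ≤ κ i / n + η := add_nonneg (div_nonneg (hκ0 i) hn0.le) hη0
        refine (hψd.mul (hdisp i) (by positivity) h0).mono (le_of_eq ?_)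
        push_cast; ring
      · have h1 := (happ _ hxρ).1
        rw [hxu] at h1
        have e1 : (ψ * χ) e - (e + (((j + 1 : ℕ) / n : ℝ) : ℂ) • u) =
            (χ e - (e + ((j / n : ℝ) : ℂ) • u)) + (ψ (χ e) - χ e - (n : ℂ)⁻¹ • u) := by
          have : (((j + 1 : ℕ) / n : ℝ) : ℂ) = ((j / n : ℝ) : ℂ) + (n : ℂ)⁻¹ := by
            push_cast; ring
          rw [this, add_smul, Equiv.Perm.mul_apply]
          abel
        rw [e1]
        refine (norm_add_le_of_le hend (h1.trans hsq)).trans (le_of_eq ?_)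
        push_cast; ring
  obtain ⟨χ, hχ, hdisp, hend⟩ := key n le_rfl
  refine ⟨χ, hχ, fun i => (hdisp i).mono ?_, ?_⟩
  · rw [mul_add, hnη, mul_div_cancel₀ _ hn0.ne']
    linarith [hn2.trans (min_le_right _ _)]
  · rw [div_self hn0.ne', Complex.ofReal_one, one_smul] at hend
    refine hend.trans ?_
    rw [hnη]
    exact hn2.trans (min_le_right _ _)

lemma exists_functional_of_norm_lt {ρ : ℝ} {w e₀ : E} (hρ : 0 ≤ ρ) (hw : ρ < ‖w‖) (he₀ : e₀ ≠ 0) :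
    ∃ μ : E →L[ℂ] ℂ, μ w = 1 ∧ μ e₀ ≠ 0 ∧ ‖μ‖ * ρ < 1 := by
  have hw0 : 0 < ‖w‖ := hρ.trans_lt hw
  obtain ⟨μ, hμ, hμw⟩ := exists_dual_vector ℂ w hw0.ne'
  obtain ⟨ν, hν, hνe⟩ := exists_dual_vector ℂ e₀ (norm_ne_zero_iff.2 he₀)
  suffices h : ∃ μ' : E →L[ℂ] ℂ, ‖μ'‖ * ρ < ‖μ' w‖ ∧ μ' e₀ ≠ 0 by
    obtain ⟨μ', h1, h2⟩ := h
    have h3 : 0 < ‖μ' w‖ := (by positivity : 0 ≤ ‖μ'‖ * ρ).trans_lt h1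
    refine ⟨(μ' w)⁻¹ • μ', ?_, ?_, ?_⟩
    · simp [norm_pos_iff.1 h3]
    · simp [norm_pos_iff.1 h3, h2]
    · rw [norm_smul, norm_inv, mul_assoc, inv_mul_lt_iff₀ h3, mul_one]
      exact h1
  have h0 : ‖μ‖ * ρ < ‖μ w‖ := by simp [hμ, hμw, hw]
  by_cases hμe : μ e₀ = 0
  · have hc : Continuous fun t : ℂ => ‖(μ + t • ν) w‖ - ‖μ + t • ν‖ * ρ := by
      simp only [add_apply, smul_apply]
      fun_prop
    have h1 : ∀ᶠ t in 𝓝[≠] (0 : ℂ), 0 < ‖(μ + t • ν) w‖ - ‖μ + t • ν‖ * ρ :=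
      (hc.continuousAt.eventually_mem (Ioi_mem_nhds (by
        have e : μ + (0 : ℂ) • ν = μ := by ext x; simp
        rw [e]; linarith))).filter_mono
        nhdsWithin_le_nhds
    obtain ⟨t, ht, ht0⟩ := (h1.and self_mem_nhdsWithin).exists
    refine ⟨μ + t • ν, by linarith, ?_⟩
    simp only [add_apply, smul_apply, hμe, hνe, smul_eq_mul, zero_add]
    simpa [he₀] using ht0
  · exact ⟨μ, h0, hμe⟩

end Euler

section Push

variable {E : Type*} [NormedAddCommGroup E] [NormedSpace ℂ E]

/-- A shear near the identity on a ball which moves a point outside the ball onto a line,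
transported by an element of the shear group. -/
lemma exists_shearGroup_apply_eq_of_norm_lt [FiniteDimensional ℂ E] {Φ : Equiv.Perm E}
    (hΦ : Φ ∈ shearGroup E) {ρ ρ' : ℝ} (hρ' : 0 ≤ ρ') (h : ∀ y, ‖y‖ ≤ ρ → ‖Φ⁻¹ y‖ ≤ ρ')
    {w e₀ : E} (hw : ρ' < ‖w‖) (he₀ : e₀ ≠ 0) {η : ℝ} (hη : 0 < η) :
    ∃ σ ∈ shearGroup E, (∃ z : ℂ, σ (Φ w) = Φ (z • e₀)) ∧
      ∀ y, ‖y‖ ≤ ρ → ‖σ y - y‖ ≤ η ∧ ‖σ⁻¹ y - y‖ ≤ η := by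
  obtain ⟨μ, hμw, hμe, hμ⟩ := exists_functional_of_norm_lt hρ' hw he₀
  obtain ⟨B, hB0, hB⟩ := exists_bound_and_lipschitz_bound
    (differentiable_of_mem_shearGroup hΦ) (ρ' + 1)
  set v : E := (μ e₀)⁻¹ • e₀ - w
  have hv : μ v = 0 := by simp [v, hμw, hμe]
  have hlim : Tendsto (fun m : ℕ => (‖μ‖ * ρ') ^ m * ‖v‖) atTop (𝓝 0) := by
    simpa using (tendsto_pow_atTop_nhds_zero_of_lt_one (by positivity) hμ).mul_const ‖v‖
  obtain ⟨m, hm⟩ := (hlim.eventually_le_const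
    (show (0 : ℝ) < min 1 (η / (B + 1)) from lt_min one_pos (by positivity))).exists
  have hm1 := hm.trans (min_le_left _ _)
  have hm2 : B * ((‖μ‖ * ρ') ^ m * ‖v‖) ≤ η := by
    have := hm.trans (min_le_right _ _)
    rw [le_div_iff₀ (by positivity)] at this
    have h0 : 0 ≤ (‖μ‖ * ρ') ^ m * ‖v‖ := by positivity
    linarith
  have hsmall : ∀ x, ‖x‖ ≤ ρ' → ‖μ x ^ m • v‖ ≤ (‖μ‖ * ρ') ^ m * ‖v‖ := by
    intro x hx
    rw [norm_smul, norm_pow]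
    gcongr
    exact (μ.le_opNorm x).trans (by gcongr)
  have hmove : ∀ x x', ‖x‖ ≤ ρ' → ‖x' - x‖ ≤ (‖μ‖ * ρ') ^ m * ‖v‖ → ‖Φ x' - Φ x‖ ≤ η := by
    intro x x' hx hx'
    have h1 : ‖x'‖ ≤ ρ' + 1 := by
      have := norm_le_norm_add_norm_sub' x' x
      linarith
    refine (hB x' x h1 (by linarith)).2.trans (le_trans ?_ hm2)
    gcongr
  refine ⟨Φ * shear μ v hv m * Φ⁻¹, mul_mem (mul_mem hΦ (shear_mem _ _ _ _)) (inv_mem hΦ),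
    ⟨(μ e₀)⁻¹, ?_⟩, fun y hy => ⟨?_, ?_⟩⟩
  · simp [shear_apply, hμw, v]
  · have := hmove (Φ⁻¹ y) (shear μ v hv m (Φ⁻¹ y)) (h y hy)
      (by rw [shear_apply, add_sub_cancel_left]; exact hsmall _ (h y hy))
    simpa using this
  · have := hmove (Φ⁻¹ y) ((shear μ v hv m)⁻¹ (Φ⁻¹ y)) (h y hy)
      (by rw [shear_inv_apply, sub_sub_cancel_left, norm_neg]; exact hsmall _ (h y hy))
    simpa [mul_assoc] using this

lemma Polynomial.exists_ray_eval_ne_zero {P : Polynomial ℂ} (hP : P.eval 0 ≠ 0) :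
    ∃ ω : ℂ, ω.re = 1 ∧ ∀ t : ℝ, 0 ≤ t → P.eval (t * ω) ≠ 0 := by
  have hP0 : P ≠ 0 := by rintro rfl; simp at hP
  obtain ⟨θ, hθ⟩ := Infinite.exists_notMem_finset (P.roots.toFinset.image fun ζ => ζ.im / ζ.re)
  refine ⟨⟨1, θ⟩, rfl, fun t ht h0 => ?_⟩
  rcases ht.eq_or_lt with rfl | ht
  · simp at h0; exact hP h0
  · refine hθ (Finset.mem_image.2 ⟨_, by simpa [hP0] using h0, ?_⟩)
    simp [ht.ne']

lemma crossField_mul_eq {a u : E} {ℓ : E →L[ℂ] ℂ} (ha : ℓ a = 1) (hu : ℓ u = 0) {f : E → ℂ}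
    (hf : Differentiable ℂ f) (y : E) :
    crossField a u (f * ⇑ℓ) y = ℓ y • crossField a u f y + f y • u := by
  have h1 : fderiv ℂ (f * ⇑ℓ) y = f y • (ℓ : E →L[ℂ] ℂ) + ℓ y • fderiv ℂ f y := by
    rw [fderiv_mul (hf y) ℓ.differentiableAt, ℓ.fderiv]
  simp only [crossField, h1, add_apply, smul_apply, ha, hu, smul_eq_mul]
  module

lemma norm_crossField_le (a u : E) (f : E → ℂ) (y : E) :
    ‖crossField a u f y‖ ≤ 2 * ‖a‖ * ‖u‖ * ‖fderiv ℂ f y‖ := by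
  have h1 := (fderiv ℂ f y).le_opNorm a
  have h2 := (fderiv ℂ f y).le_opNorm u
  refine (norm_sub_le _ _).trans ?_
  rw [norm_smul, norm_smul]
  nlinarith [norm_nonneg a, norm_nonneg u]

lemma norm_fderiv_cube_mul_pow_le {h : E → ℂ} (hh : Differentiable ℂ h) (l : E →L[ℂ] ℂ) (k : ℕ)
    {y : E} {H : ℝ} (h1 : ‖h y‖ ≤ H) (h2 : ‖fderiv ℂ h y‖ ≤ H) :
    ‖fderiv ℂ (h ^ 3 * ⇑l ^ (k + 1)) y‖ ≤
      (3 + ‖l‖) * H * ‖h y‖ ^ 2 * (‖l y‖ ^ (k + 1) + (k + 1) * ‖l y‖ ^ k) := by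
  have hH : 0 ≤ H := (norm_nonneg _).trans h1
  have e : fderiv ℂ (h ^ 3 * ⇑l ^ (k + 1)) y =
      (h y ^ 3) • (((k + 1 : ℕ) : ℂ) * l y ^ k) • l +
        (l y ^ (k + 1)) • (3 * h y ^ 2) • fderiv ℂ h y := by
    have d1 : HasFDerivAt (h ^ 3) ((3 * h y ^ 2) • fderiv ℂ h y) y := by
      exact ((hh y).hasFDerivAt.pow 3).congr_fderiv (by simp)
    have d2 : HasFDerivAt (⇑l ^ (k + 1)) ((((k + 1 : ℕ) : ℂ) * l y ^ k) • l) y := by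
      exact ((l.hasFDerivAt (x := y)).pow (k + 1)).congr_fderiv (by simp)
    exact (d1.mul d2).fderiv
  have hk : ‖((k + 1 : ℕ) : ℂ)‖ = k + 1 := by rw [Complex.norm_natCast]; push_cast; rfl
  rw [e]
  refine (norm_add_le _ _).trans ?_
  simp only [norm_smul, norm_mul, norm_pow, hk]
  have h3 : ‖(3 : ℂ)‖ = 3 := by simp
  rw [h3]
  have hX : 0 ≤ ‖h y‖ ^ 2 * ‖l y‖ ^ (k + 1) := by positivity
  have hY : 0 ≤ ‖h y‖ ^ 2 * ((k + 1) * ‖l y‖ ^ k) := by positivity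
  have b1 : ‖h y‖ ^ 3 * (((k : ℝ) + 1) * ‖l y‖ ^ k * ‖l‖) ≤
      H * ‖l‖ * (‖h y‖ ^ 2 * ((k + 1) * ‖l y‖ ^ k)) := by
    calc _ = ‖h y‖ * ‖l‖ * (‖h y‖ ^ 2 * ((k + 1) * ‖l y‖ ^ k)) := by ring
      _ ≤ _ := by gcongr
  have b2 : ‖l y‖ ^ (k + 1) * (3 * ‖h y‖ ^ 2 * ‖fderiv ℂ h y‖) ≤
      3 * H * (‖h y‖ ^ 2 * ‖l y‖ ^ (k + 1)) := by
    calc _ = 3 * ‖fderiv ℂ h y‖ * (‖h y‖ ^ 2 * ‖l y‖ ^ (k + 1)) := by ring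
      _ ≤ _ := by gcongr
  have : 0 ≤ H * ‖l‖ * (‖h y‖ ^ 2 * ‖l y‖ ^ (k + 1)) := by positivity
  have : 0 ≤ 3 * H * (‖h y‖ ^ 2 * ((k + 1) * ‖l y‖ ^ k)) := by positivity
  linarith

lemma exists_functional_apply_eq_zero [FiniteDimensional ℂ E] (hE : 2 ≤ Module.finrank ℂ E)
    (u : E) : ∃ ℓ : E →L[ℂ] ℂ, ℓ ≠ 0 ∧ ℓ u = 0 := by
  have hlt : Submodule.span ℂ {u} < ⊤ := by
    refine lt_of_le_of_ne le_top fun h => ?_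
    have h1 := finrank_span_le_card (R := ℂ) ({u} : Set E)
    rw [h, finrank_top] at h1
    simp at h1
    omega
  obtain ⟨φ, hφ0, hφ⟩ := Submodule.exists_le_ker_of_lt_top _ hlt
  refine ⟨φ.toContinuousLinearMap, fun h => hφ0 ?_, ?_⟩
  · ext x; exact congrArg (fun g : E →L[ℂ] ℂ => g x) h
  · exact hφ (Submodule.mem_span_singleton_self u)

lemma norm_pushField_le {h : E → ℂ} (hh : Differentiable ℂ h) (l ℓ : E →L[ℂ] ℂ) (a u : E) (k : ℕ)
    {x y : E} {c q H Λ : ℝ} (hq : 0 < q) (hc : ‖(h x)⁻¹‖ ≤ c) (hl : q ≤ ‖l x‖) (h1 : ‖h y‖ ≤ H)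
    (h2 : ‖fderiv ℂ h y‖ ≤ H) (hΛ : ‖ℓ y - ℓ x‖ ≤ Λ) :
    ‖((h ^ 3 * ⇑l ^ (k + 1)) x)⁻¹ • ((h ^ 3 * ⇑l ^ (k + 1)) y • u +
      (ℓ y - ℓ x) • crossField a u (h ^ 3 * ⇑l ^ (k + 1)) y)‖ ≤
    c ^ 3 * (H * ‖u‖ + Λ * (2 * ‖a‖ * ‖u‖ * ((3 + ‖l‖) * H))) * ‖h y‖ ^ 2 *
      ((‖l y‖ ^ (k + 1) + (k + 1) * ‖l y‖ ^ k) / q ^ (k + 1)) := by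
  have hH : 0 ≤ H := (norm_nonneg _).trans h1
  have hc0 : 0 ≤ c := (norm_nonneg _).trans hc
  have hΛ0 : 0 ≤ Λ := (norm_nonneg _).trans hΛ
  set S := ‖l y‖ ^ (k + 1) + (k + 1) * ‖l y‖ ^ k
  have e1 : ‖((h ^ 3 * ⇑l ^ (k + 1)) x)⁻¹‖ ≤ c ^ 3 * (1 / q ^ (k + 1)) := by
    simp only [Pi.mul_apply, Pi.pow_apply, mul_inv, norm_mul]
    rw [← inv_pow, norm_pow, norm_inv (l x ^ (k + 1)), norm_pow, one_div]
    gcongr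
  have e2 : ‖(h ^ 3 * ⇑l ^ (k + 1)) y • u‖ ≤ H * ‖u‖ * (‖h y‖ ^ 2 * S) := by
    simp only [Pi.mul_apply, Pi.pow_apply, norm_smul, norm_mul, norm_pow]
    calc ‖h y‖ ^ 3 * ‖l y‖ ^ (k + 1) * ‖u‖ = ‖h y‖ * ‖u‖ * (‖h y‖ ^ 2 * ‖l y‖ ^ (k + 1)) := by ring
      _ ≤ _ := by
        have : ‖l y‖ ^ (k + 1) ≤ S := le_add_of_nonneg_right (by positivity)
        gcongr
  have e3 : ‖(ℓ y - ℓ x) • crossField a u (h ^ 3 * ⇑l ^ (k + 1)) y‖ ≤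
      Λ * (2 * ‖a‖ * ‖u‖ * ((3 + ‖l‖) * H)) * (‖h y‖ ^ 2 * S) := by
    rw [norm_smul]
    calc _ ≤ Λ * (2 * ‖a‖ * ‖u‖ * ((3 + ‖l‖) * H * ‖h y‖ ^ 2 * S)) := by
          gcongr
          refine (norm_crossField_le _ _ _ _).trans ?_
          gcongr
          exact norm_fderiv_cube_mul_pow_le hh l k h1 h2
      _ = _ := by ring
  rw [norm_smul]
  calc _ ≤ c ^ 3 * (1 / q ^ (k + 1)) * (H * ‖u‖ * (‖h y‖ ^ 2 * S) +
        Λ * (2 * ‖a‖ * ‖u‖ * ((3 + ‖l‖) * H)) * (‖h y‖ ^ 2 * S)) := by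
        gcongr
        exact norm_add_le_of_le e2 e3
    _ = _ := by ring

lemma tendsto_pow_add_mul_pow_div {q₁ q₂ : ℝ} (h1 : 0 ≤ q₁) (h12 : q₁ < q₂) :
    Tendsto (fun k : ℕ => (q₁ ^ (k + 1) + (k + 1) * q₁ ^ k) / q₂ ^ (k + 1)) atTop (𝓝 0) := by
  have h2 : 0 < q₂ := h1.trans_lt h12
  have hq : q₁ / q₂ < 1 := (div_lt_one h2).2 h12
  have hq0 : 0 ≤ q₁ / q₂ := by positivity
  have t1 := tendsto_pow_atTop_nhds_zero_of_lt_one hq0 hq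
  have t2 := tendsto_self_mul_const_pow_of_lt_one hq0 hq
  have t3 := (t1.const_mul ((q₁ + 1) / q₂)).add (t2.const_mul (1 / q₂))
  simp only [mul_zero, add_zero] at t3
  refine t3.congr fun k => ?_
  rw [div_pow]
  field_simp
  ring

/-- A point can be pushed along a segment by an element of the shear group which is close to the
identity on a ball and tangent to the identity along a compact subset of a hypersurface. -/
lemma exists_shearGroup_push [FiniteDimensional ℂ E] (hE : 2 ≤ Module.finrank ℂ E)
    {h : E → ℂ} (hh : h ∈ polyFun E) (l : E →L[ℂ] ℂ) {e u : E}
    (hseg : ∀ t : ℝ, 0 ≤ t → t ≤ 1 → h (e + (t : ℂ) • u) ≠ 0 ∧ 1 ≤ ‖l (e + (t : ℂ) • u)‖)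
    {r : ℝ} (hr : 0 ≤ r) (hlr : ‖l‖ * r < 1) {K : Set E} (hK : IsCompact K)
    (hhK : ∀ k ∈ K, h k = 0) {γ : ℝ} (hγ : 0 < γ) :
    ∃ χ ∈ shearGroup E, ∃ s, 0 < s ∧ s ≤ γ ∧ Displaces {0} r γ χ ∧ Displaces K s (s / 2) χ ∧
      ‖χ e - (e + u)‖ ≤ γ := by
  have := FiniteDimensional.proper ℂ E
  have hhd := differentiable_of_mem_polyFun hh
  obtain ⟨ℓ, hℓ0, hℓu⟩ := exists_functional_apply_eq_zero hE u
  obtain ⟨a₀, ha₀⟩ : ∃ a, ℓ a ≠ 0 := by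
    by_contra! h0
    exact hℓ0 (ContinuousLinearMap.ext h0)
  obtain ⟨a, ha⟩ : ∃ a, ℓ a = 1 := ⟨(ℓ a₀)⁻¹ • a₀, by simp [ha₀]⟩
  obtain ⟨q, hq1, hq2⟩ := exists_between hlr
  have hq0 : 0 < q := (by positivity : 0 ≤ ‖l‖ * r).trans_lt hq1
  -- the tube
  set σ : Set E := (fun t : ℝ => e + (t : ℂ) • u) '' Icc 0 1 with hσ
  have hσc : IsCompact σ := isCompact_Icc.image (by fun_prop)
  have hUo : IsOpen {x | h x ≠ 0 ∧ q < ‖l x‖} :=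
    (isOpen_ne_fun hhd.continuous continuous_const).inter
      (isOpen_lt continuous_const l.continuous.norm)
  obtain ⟨τ, hτ, hTU⟩ := hσc.exists_cthickening_subset_open hUo (by
    rintro _ ⟨t, ht, rfl⟩
    exact ⟨(hseg t ht.1 ht.2).1, hq2.trans_le (hseg t ht.1 ht.2).2⟩)
  set T := cthickening τ σ
  have hTc : IsCompact T := hσc.cthickening
  obtain ⟨c, hc⟩ := hTc.exists_bound_of_continuousOn
    (hhd.continuous.continuousOn.inv₀ fun x hx => (hTU hx).1)
  obtain ⟨ρ₁, hρ₁⟩ := hTc.isBounded.exists_norm_le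
  obtain ⟨ρ₂, hρ₂⟩ := hK.isBounded.exists_norm_le
  set ρ : ℝ := max ρ₁ (max (ρ₂ + γ) r)
  have hρ0 : 0 ≤ ρ := hr.trans ((le_max_right _ _).trans (le_max_right _ _))
  have hTρ : ∀ x ∈ T, ‖x‖ ≤ ρ := fun x hx => (hρ₁ x hx).trans (le_max_left _ _)
  have hKρ : ∀ k ∈ K, ∀ y, ‖y - k‖ ≤ γ → ‖y‖ ≤ ρ := fun k hk y hy => by
    have h1 := norm_le_norm_add_norm_sub' y k
    have h2 := hρ₂ k hk
    have h3 : ρ₂ + γ ≤ ρ := (le_max_left _ _).trans (le_max_right _ _)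
    linarith
  have hrρ : r ≤ ρ := (le_max_right _ _).trans (le_max_right _ _)
  obtain ⟨B, hB0, hB⟩ := exists_bound_and_lipschitz_bound hhd (ρ + 1)
  have hBd : ∀ y, ‖y‖ ≤ ρ → ‖fderiv ℂ h y‖ ≤ B := fun y hy => by
    refine norm_fderiv_le_of_lip' ℂ hB0 ?_
    filter_upwards [ball_mem_nhds y one_pos] with z hz
    rw [mem_ball, dist_eq_norm] at hz
    refine (hB z y ?_ (by linarith)).2
    linarith [norm_le_norm_add_norm_sub' z y]
  have hc0 : 0 ≤ c := by
    have : e ∈ σ := ⟨0, by simp, by simp⟩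
    exact (norm_nonneg _).trans (hc e (self_subset_cthickening _ this))
  set Λ : ℝ := ‖ℓ‖ * (2 * ρ)
  set C : ℝ := c ^ 3 * (B * ‖u‖ + Λ * (2 * ‖a‖ * ‖u‖ * ((3 + ‖l‖) * B)))
  have hC0 : 0 ≤ C := by positivity
  have hbound : ∀ k : ℕ, ∀ x ∈ T, ∀ y, ‖y‖ ≤ ρ → ∀ b, ‖l y‖ ≤ b →
      ‖((h ^ 3 * ⇑l ^ (k + 1)) x)⁻¹ • ((h ^ 3 * ⇑l ^ (k + 1)) y • u +
        (ℓ y - ℓ x) • crossField a u (h ^ 3 * ⇑l ^ (k + 1)) y)‖ ≤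
      C * ‖h y‖ ^ 2 * ((b ^ (k + 1) + (k + 1) * b ^ k) / q ^ (k + 1)) := by
    intro k x hx y hy b hb
    refine (norm_pushField_le (H := B) (Λ := Λ) (c := c) hhd l ℓ a u k hq0 (hc x hx)
      (hTU hx).2.le ?_ ?_ ?_).trans ?_
    · exact (hB y y (by linarith) (by linarith)).1
    · exact hBd y hy
    · rw [← map_sub]
      refine (ℓ.le_opNorm _).trans (mul_le_mul_of_nonneg_left ?_ (norm_nonneg _))
      linarith [norm_sub_le y x, hTρ x hx]
    · gcongr
  -- the exponent
  have hlim := (tendsto_pow_add_mul_pow_div (by positivity) hq1).const_mul (C * B ^ 2)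
  rw [mul_zero] at hlim
  obtain ⟨k, hk⟩ := (hlim.eventually_le_const (half_pos hγ)).exists
  set f : E → ℂ := h ^ 3 * ⇑l ^ (k + 1) with hf
  have hfp : f ∈ polyFun E :=
    mul_mem_polyFun (fun_pow_mem_polyFun hh 3) (fun_pow_mem_polyFun (linear_mem_polyFun l) _)
  have hfd := differentiable_of_mem_polyFun hfp
  have hfT : ∀ x ∈ T, f x ≠ 0 := fun x hx => mul_ne_zero (pow_ne_zero _ (hTU hx).1)
    (pow_ne_zero _ (norm_pos_iff.1 (hq0.trans (hTU hx).2)))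
  set X : ℂ × ℂ → E → E := fun p y => p.1 • crossField a u (f * ⇑ℓ) y + p.2 • crossField a u f y
  have hX : Flowable X :=
    flowable_crossField_pair a u (mul_mem_polyFun hfp (linear_mem_polyFun ℓ)) hfp
  set P : E → ℂ × ℂ := fun x => ((f x)⁻¹, -((f x)⁻¹ * ℓ x))
  have hXP : ∀ x y, X (P x) y = (f x)⁻¹ • (f y • u + (ℓ y - ℓ x) • crossField a u f y) := by
    intro x y
    simp only [X, P, crossField_mul_eq ha hℓu hfd]
    module
  obtain ⟨D, hD⟩ := hTc.exists_bound_of_continuousOn (f := P) (by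
    have h1 := hfd.continuous.continuousOn.inv₀ hfT
    exact h1.prodMk (h1.mul ℓ.continuous.continuousOn).neg)
  -- the radius of the neighbourhood of `K`
  set M : ℝ := C * B ^ 2 *
    (((‖l‖ * ρ) ^ (k + 1) + (k + 1) * (‖l‖ * ρ) ^ k) / q ^ (k + 1))
  have hM0 : 0 ≤ M := by positivity
  set s : ℝ := min γ (1 / (4 * (M + 1)))
  have hs : 0 < s := lt_min hγ (by positivity)
  have hsM : M * s ^ 2 ≤ s / 4 := by
    have := min_le_right γ (1 / (4 * (M + 1)))
    rw [le_div_iff₀ (by positivity)] at this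
    nlinarith
  obtain ⟨χ, hχ, hdisp, hend⟩ := hX.exists_shearGroup_along_segment (P := P) (e := e) (u := u)
    (T := T) (τ := τ) (D := D) (ρ := ρ) (fun c p y => by simp only [X, Prod.smul_fst,
      Prod.smul_snd, smul_eq_mul, smul_add, smul_smul]) hτ
    (fun x t ht0 ht1 hx => mem_cthickening_of_dist_le x _ τ σ ⟨t, ⟨ht0, ht1⟩, rfl⟩
      (by rwa [dist_eq_norm]))
    (fun x hx => ⟨hTρ x hx, hD x hx, by rw [hXP]; simp [hfT x hx]⟩)
    (K := fun b : Bool => if b then {0} else K) (r := fun b => if b then r else s)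
    (κ := fun b => if b then γ / 2 else s / 4) (by rintro (_ | _) <;> simp <;> positivity)
    (by
      rintro (_ | _) x hx k₀ hk₀ y hy
      · simp only [Bool.false_eq_true, ↓reduceIte] at hk₀ hy ⊢
        have hyρ := hKρ k₀ hk₀ y (hy.trans (min_le_left _ _))
        refine ⟨hyρ, ?_⟩
        rw [hXP]
        refine (hbound k x hx y hyρ (‖l‖ * ρ) ((l.le_opNorm y).trans (by gcongr))).trans
          (le_trans ?_ hsM)
        have h1 := (hB y k₀ (by linarith)
          (by linarith [hKρ k₀ hk₀ k₀ (by simpa using hγ.le)])).2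
        rw [hhK k₀ hk₀, sub_zero] at h1
        calc _ ≤ C * (B * s) ^ 2 *
              (((‖l‖ * ρ) ^ (k + 1) + (k + 1) * (‖l‖ * ρ) ^ k) / q ^ (k + 1)) := by
              gcongr
              exact h1.trans (by gcongr)
          _ = _ := by ring
      · simp only [↓reduceIte, mem_singleton_iff] at hk₀ hy ⊢
        rw [hk₀, sub_zero] at hy
        refine ⟨hy.trans hrρ, ?_⟩
        rw [hXP]
        refine (hbound k x hx y (hy.trans hrρ) (‖l‖ * r) ((l.le_opNorm y).trans
          (by gcongr))).trans (le_trans ?_ hk)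
        gcongr
        exact (hB y y (by linarith) (by linarith)).1)
    (show 0 < min (γ / 2) (s / 4) by positivity)
  refine ⟨χ, hχ, s, hs, min_le_left _ _, ?_, ?_, ?_⟩
  · have := hdisp true
    simp only [↓reduceIte] at this
    exact this.mono (by linarith [min_le_left (γ / 2) (s / 4)])
  · have := hdisp false
    simp only [Bool.false_eq_true, ↓reduceIte] at this
    exact this.mono (by linarith [min_le_right (γ / 2) (s / 4)])
  · exact hend.trans (by linarith [min_le_left (γ / 2) (s / 4)])

end Push

section Hit

variable {E : Type*} [NormedAddCommGroup E] [NormedSpace ℂ E]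

/-- An element of the shear group, close to the identity on a ball and on a compact part of the
image of a line, makes the image of the line pass near a given point outside the ball. -/
lemma exists_shearGroup_hit [FiniteDimensional ℂ E] (hE : 2 ≤ Module.finrank ℂ E) {e₀ : E}
    (he₀ : e₀ ≠ 0) {Φ : Equiv.Perm E} (hΦ : Φ ∈ shearGroup E) {R : ℝ} (hR : 0 ≤ R) (S : ℝ) {e : E}
    (he : R < ‖e‖) {ε : ℝ} (hε : 0 < ε) :
    ∃ Ψ ∈ shearGroup E, Displaces {0} R ε Ψ ∧
      (∀ z : ℂ, ‖z‖ ≤ S → ‖Ψ (Φ (z • e₀)) - Φ (z • e₀)‖ ≤ ε) ∧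
      ∃ z : ℂ, ‖Ψ (Φ (z • e₀)) - e‖ ≤ ε := by
  have hinv : ∀ (σ : Equiv.Perm E) x, σ⁻¹ (σ x) = x := fun σ => σ.symm_apply_apply
  have hinv' : ∀ (σ : Equiv.Perm E) x, σ (σ⁻¹ x) = x := fun σ => σ.apply_symm_apply
  have hΦd := differentiable_of_mem_shearGroup hΦ
  obtain ⟨ν, hν0, hνe⟩ := exists_functional_apply_eq_zero hE e₀
  obtain ⟨w₀, hw₀⟩ : ∃ w, ν w ≠ 0 := by
    by_contra! h0
    exact hν0 (ContinuousLinearMap.ext h0)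
  set h : E → ℂ := ν ∘ ⇑Φ⁻¹
  have hh : h ∈ polyFun E := comp_mem_polyFun (inv_mem hΦ) _ (linear_mem_polyFun ν)
  -- a nearby target off the hypersurface `h = 0`
  obtain ⟨e', hhe', hee', hRe'⟩ : ∃ e', h e' ≠ 0 ∧ ‖e' - e‖ ≤ ε ∧ R < ‖e'‖ := by
    have hc : Continuous fun t : ℂ => Φ (Φ⁻¹ e + t • w₀) := hΦd.continuous.comp (by fun_prop)
    have h0 : Φ (Φ⁻¹ e + (0 : ℂ) • w₀) = e := by simp
    have h1 : ∀ᶠ t in 𝓝 (0 : ℂ), ‖Φ (Φ⁻¹ e + t • w₀) - e‖ < ε :=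
      (hc.sub continuous_const).norm.continuousAt.eventually_lt continuousAt_const
        (by simpa using hε)
    have h2 : ∀ᶠ t in 𝓝 (0 : ℂ), R < ‖Φ (Φ⁻¹ e + t • w₀)‖ :=
      continuousAt_const.eventually_lt hc.norm.continuousAt (by rw [h0]; exact he)
    obtain ⟨t, ht, ht1, ht2⟩ := (dense_compl_singleton (-ν (Φ⁻¹ e) / ν w₀)).inter_nhds_nonempty
      (h1.and h2)
    refine ⟨_, fun hz => ht ?_, ht1.le, ht2⟩
    simp only [h, Function.comp_apply, hinv, map_add, map_smul,
      smul_eq_mul] at hz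
    rw [mem_singleton_iff, eq_div_iff hw₀]
    linear_combination hz
  have he'0 : 0 < ‖e'‖ := hR.trans_lt hRe'
  obtain ⟨g, hg, hge⟩ := exists_dual_vector ℂ e' he'0.ne'
  have he'c : ((‖e'‖ : ℝ) : ℂ) ≠ 0 := by exact_mod_cast he'0.ne'
  obtain ⟨l, hle, hln⟩ : ∃ l : E →L[ℂ] ℂ, l e' = 1 ∧ ‖l‖ = ‖e'‖⁻¹ :=
    ⟨((‖e'‖ : ℝ) : ℂ)⁻¹ • g, by
      rw [smul_apply, hge, smul_eq_mul]
      exact inv_mul_cancel₀ he'c, by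
      rw [norm_smul, hg, norm_inv]; simp⟩
  obtain ⟨P, hP⟩ := exists_polynomial_of_mem_polyFun hh e' e'
  obtain ⟨ω, hω, hωP⟩ := Polynomial.exists_ray_eval_ne_zero (P := P) (by
    rw [← hP]; simpa using hhe')
  have hωn : ∀ t : ℝ, 0 ≤ t → 1 + t ≤ ‖1 + t * ω‖ := fun t ht => by
    have := Complex.re_le_norm (1 + t * ω)
    simpa [hω] using this
  -- radii
  set γ := ε / 2
  have hγ : 0 < γ := half_pos hε
  set K : Set E := (fun z : ℂ => Φ (z • e₀)) '' closedBall 0 S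
  have hK : IsCompact K := (isCompact_closedBall 0 S).image
    (hΦd.continuous.comp (by fun_prop))
  obtain ⟨ρ₂, hρ₂⟩ := hK.isBounded.exists_norm_le
  set ρ := max R (ρ₂ + γ)
  obtain ⟨ρ', hρ'0, hρ'⟩ := exists_bound_and_lipschitz_bound
    (differentiable_of_mem_shearGroup (inv_mem hΦ)) ρ
  obtain ⟨M, hM0, hM⟩ := exists_bound_and_lipschitz_bound hΦd ρ'
  set t₀ := (M + γ) / ‖e'‖
  have ht₀ : 0 ≤ t₀ := by positivity
  set u : E := ((t₀ : ℂ) * ω) • e'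
  have hseg : ∀ t : ℝ, e' + (t : ℂ) • u = e' + (((t * t₀ : ℝ) : ℂ) * ω) • e' := fun t => by
    simp only [u, smul_smul, Complex.ofReal_mul, mul_assoc]
  obtain ⟨χ, hχ, s, hs0, hsγ, hd0, hdK, hend⟩ := exists_shearGroup_push hE hh l (e := e') (u := u)
    (fun t ht0 _ => by
      rw [hseg]
      refine ⟨by rw [hP]; exact hωP _ (by positivity), ?_⟩
      rw [map_add, map_smul, hle, smul_eq_mul, mul_one]
      have h1 := hωn (t * t₀) (by positivity)
      have h2 : 0 ≤ t * t₀ := by positivity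
      linarith) hR (by rw [hln, inv_mul_lt_iff₀ he'0, mul_one]; exact hRe') hK
    (by rintro _ ⟨z, -, rfl⟩; simp [h, hνe]) hγ
  have hfar : ρ' < ‖Φ⁻¹ (χ e')‖ := by
    by_contra! hle'
    have h1 := (hM _ _ hle' hle').1
    rw [hinv'] at h1
    have h2 : e' + u = (1 + (t₀ : ℂ) * ω) • e' := by rw [add_smul, one_smul]
    have h3 : (1 + t₀) * ‖e'‖ ≤ ‖e' + u‖ := by
      rw [h2, norm_smul]
      gcongr
      exact hωn t₀ ht₀
    have h4 : t₀ * ‖e'‖ = M + γ := div_mul_cancel₀ _ he'0.ne'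
    have h5 := norm_le_norm_add_norm_sub (χ e') (e' + u)
    linarith
  obtain ⟨σ, hσ, ⟨z, hz⟩, hσd⟩ := exists_shearGroup_apply_eq_of_norm_lt hΦ hρ'0
    (fun y hy => (hρ' y y hy hy).1) hfar he₀ (show 0 < s / 4 by positivity)
  rw [hinv'] at hz
  have hσ0 : Displaces {0} R (s / 4) σ := by
    intro k hk y hy
    rw [mem_singleton_iff.1 hk, sub_zero] at hy
    exact hσd y (le_trans (by linarith) (le_max_left _ _))
  have hσK : Displaces K s (s / 4) σ := by
    intro k hk y hy
    have := hρ₂ k hk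
    have := norm_le_norm_add_norm_sub' y k
    exact hσd y (le_trans (by linarith) (le_max_right _ _))
  refine ⟨(σ * χ)⁻¹, inv_mem (mul_mem hσ hχ), ?_, fun z' hz' => ?_, z, ?_⟩
  · exact ((hσ0.mul hd0 hγ.le (by positivity)).mono (by simp only [γ] at hsγ ⊢; linarith)).inv
  · have := ((hσK.mul hdK (by positivity) (by positivity)).inv _
      (mem_image_of_mem _ (mem_closedBall_zero_iff.2 hz')) (Φ (z' • e₀))
      (by rw [sub_self, norm_zero]; linarith)).1
    refine this.trans ?_
    simp only [γ] at hsγ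
    linarith
  · rw [← hz, mul_inv_rev, Equiv.Perm.mul_apply, hinv,
      hinv]
    exact hee'

lemma exists_shearGroup_hit_finset [FiniteDimensional ℂ E] (hE : 2 ≤ Module.finrank ℂ E) {e₀ : E}
    (he₀ : e₀ ≠ 0) {Φ : Equiv.Perm E} (hΦ : Φ ∈ shearGroup E) {R : ℝ} (hR : 0 ≤ R) (S : ℝ)
    (A : Finset E) (hA : ∀ e ∈ A, R < ‖e‖) {ε : ℝ} (hε : 0 < ε) :
    ∃ Ψ ∈ shearGroup E, Displaces {0} R ε Ψ ∧
      (∀ z : ℂ, ‖z‖ ≤ S → ‖Ψ (Φ (z • e₀)) - Φ (z • e₀)‖ ≤ ε) ∧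
      ∃ S', S ≤ S' ∧ ∀ e ∈ A, ∃ z : ℂ, ‖z‖ ≤ S' ∧ ‖Ψ (Φ (z • e₀)) - e‖ ≤ ε := by
  classical
  induction A using Finset.induction_on generalizing ε with
  | empty => exact ⟨1, one_mem _, (Displaces.one _ _).mono hε.le, by simp [hε.le], S, le_rfl,
      by simp⟩
  | insert e A _ ih =>
    obtain ⟨Ψ₁, hΨ₁, hd₁, hc₁, S₁, hS₁, hz₁⟩ :=
      ih (fun e he => hA e (Finset.mem_insert_of_mem he)) (half_pos hε)
    obtain ⟨Ψ₂, hΨ₂, hd₂, hc₂, z₂, hz₂⟩ := exists_shearGroup_hit hE he₀ (mul_mem hΨ₁ hΦ) hR S₁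
      (hA e (Finset.mem_insert_self _ _)) (half_pos hε)
    simp only [Equiv.Perm.mul_apply] at hc₂ hz₂
    refine ⟨Ψ₂ * Ψ₁, mul_mem hΨ₂ hΨ₁, ?_, fun z hz => ?_, max S₁ ‖z₂‖, hS₁.trans (le_max_left _ _),
      fun e' he' => ?_⟩
    · simpa using hd₂.mul hd₁ (half_pos hε).le (half_pos hε).le
    · rw [Equiv.Perm.mul_apply]
      linarith [norm_sub_le_norm_sub_add_norm_sub (Ψ₂ (Ψ₁ (Φ (z • e₀)))) (Ψ₁ (Φ (z • e₀)))
        (Φ (z • e₀)), hc₁ z hz, hc₂ z (hz.trans hS₁)]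
    · rcases Finset.mem_insert.1 he' with rfl | he'
      · exact ⟨z₂, le_max_right _ _, hz₂.trans (half_le_self hε.le)⟩
      · obtain ⟨z, hz, hze⟩ := hz₁ e' he'
        refine ⟨z, hz.trans (le_max_left _ _), ?_⟩
        rw [Equiv.Perm.mul_apply]
        linarith [norm_sub_le_norm_sub_add_norm_sub (Ψ₂ (Ψ₁ (Φ (z • e₀)))) (Ψ₁ (Φ (z • e₀))) e',
          hc₂ z hz]

end Hit

section Limit

variable {E : Type*} [NormedAddCommGroup E] [NormedSpace ℂ E]

lemma le_div_two_pow {ε : ℕ → ℝ} (hε : ∀ k, ε (k + 1) ≤ ε k / 2) (k j : ℕ) :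
    ε (k + j) ≤ ε k / 2 ^ j := by
  induction j with
  | zero => simp
  | succ j ih =>
    have := hε (k + j)
    rw [← add_assoc, pow_succ, ← div_div]
    linarith

lemma exists_entire_limit [CompleteSpace E] {f : ℕ → ℂ → E} (hf : ∀ k, Differentiable ℂ (f k))
    {S ε : ℕ → ℝ} (hS : ∀ k, S k + 1 ≤ S (k + 1)) (hε0 : ∀ k, 0 < ε k)
    (hε : ∀ k, ε (k + 1) ≤ ε k / 2)
    (h : ∀ k z, ‖z‖ ≤ S k → ‖f (k + 1) z - f k z‖ ≤ ε k) :
    Tendsto S atTop atTop ∧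
      ∃ F : ℂ → E, Differentiable ℂ F ∧ ∀ k z, ‖z‖ ≤ S k → ‖F z - f k z‖ ≤ 2 * ε k := by
  have hmono : Monotone S := monotone_nat_of_le_succ fun k => by linarith [hS k]
  have hSk : ∀ k : ℕ, S 0 + k ≤ S k := by
    intro k
    induction k with
    | zero => simp
    | succ k ih => push_cast; linarith [hS k]
  have hStop : Tendsto S atTop atTop :=
    tendsto_atTop_mono hSk (tendsto_atTop_add_const_left _ _ tendsto_natCast_atTop_atTop)
  have hgeo : ∀ k z, ‖z‖ ≤ S k → ∀ j, dist (f (j + k) z) (f (j + 1 + k) z) ≤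
      2 * ε k / 2 / 2 ^ j := by
    intro k z hz j
    rw [dist_comm, dist_eq_norm, add_right_comm, mul_div_cancel_left₀ _ two_ne_zero]
    refine (h _ z (hz.trans (hmono (Nat.le_add_left _ _)))).trans ?_
    rw [add_comm]
    exact le_div_two_pow hε k j
  have hex : ∀ z, ∃ a, Tendsto (fun k => f k z) atTop (𝓝 a) := by
    intro z
    obtain ⟨k, hk⟩ := (hStop.eventually_ge_atTop ‖z‖).exists
    obtain ⟨a, ha⟩ := cauchySeq_tendsto_of_complete
      (cauchySeq_of_le_geometric_two (hgeo k z hk))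
    exact ⟨a, (tendsto_add_atTop_iff_nat (f := fun k => f k z) k).1 ha⟩
  choose F hF using hex
  have hFk : ∀ k z, ‖z‖ ≤ S k → ‖F z - f k z‖ ≤ 2 * ε k := by
    intro k z hz
    have := dist_le_of_le_geometric_two_of_tendsto₀ (hgeo k z hz)
      ((tendsto_add_atTop_iff_nat (f := fun k => f k z) k).2 (hF z))
    rwa [zero_add, dist_comm, dist_eq_norm] at this
  have hε_lim : Tendsto (fun k => 2 * ε k) atTop (𝓝 0) := by
    have h1 : Tendsto (fun k : ℕ => ε 0 / 2 ^ k) atTop (𝓝 0) := by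
      simpa [div_eq_mul_inv] using
        (tendsto_pow_atTop_nhds_zero_of_lt_one (by norm_num : (0 : ℝ) ≤ 2⁻¹)
          (by norm_num)).const_mul (ε 0)
    have h2 := squeeze_zero (fun k => (hε0 k).le)
      (fun k => by simpa using le_div_two_pow hε 0 k) h1
    simpa using h2.const_mul 2
  refine ⟨hStop, F, ?_, hFk⟩
  have hunif : TendstoLocallyUniformly f F atTop := by
    rw [Metric.tendstoLocallyUniformly_iff]
    intro η hη x
    refine ⟨ball 0 (‖x‖ + 1), isOpen_ball.mem_nhds (by simp), ?_⟩
    filter_upwards [hStop.eventually_ge_atTop (‖x‖ + 1), hε_lim.eventually_lt_const hη]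
      with k hk hkη y hy
    rw [dist_eq_norm]
    exact (hFk k y ((mem_ball_zero_iff.1 hy).le.trans hk)).trans_lt hkη
  exact differentiableOn_univ.1 ((tendstoLocallyUniformlyOn_univ.2 hunif).differentiableOn
    (Eventually.of_forall fun k => (hf k).differentiableOn) isOpen_univ)

lemma deriv_ne_zero_of_le_norm_sub {F : ℂ → E} (hF : Differentiable ℂ F) {z : ℂ} {c : ℝ}
    (hc : 0 < c) (h : ∀ᶠ z' in 𝓝 z, c * ‖z' - z‖ ≤ ‖F z' - F z‖) : deriv F z ≠ 0 := by
  intro h0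
  have h1 := (hF z).hasDerivAt
  rw [h0, hasDerivAt_iff_isLittleO] at h1
  have h2 := h1.bound (half_pos hc)
  have h3 : ∀ᶠ z' in 𝓝[≠] z, z' ≠ z := self_mem_nhdsWithin
  obtain ⟨z', ⟨h4, h5⟩, h6⟩ := (((h.and h2).filter_mono nhdsWithin_le_nhds).and h3).exists
  rw [smul_zero, sub_zero] at h5
  have : 0 < ‖z' - z‖ := norm_pos_iff.2 (sub_ne_zero.2 h6)
  nlinarith

end Limit

section Construction

variable {E : Type*} [NormedAddCommGroup E] [NormedSpace ℂ E]

/-- An admissible stage of the inductive construction of an embedded line: an automorphism, a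
radius and a tolerance. -/
def Admissible (e₀ : E) (δ : ℝ) (s : Equiv.Perm E × ℝ × ℝ) : Prop :=
  s.1 ∈ shearGroup E ∧ 0 < s.2.2 ∧ s.2.2 ≤ 1 / 4 ∧ s.2.2 ≤ δ / 4 ∧
    ∀ z w : ℂ, ‖z‖ ≤ s.2.1 → ‖w‖ ≤ s.2.1 →
      8 * s.2.2 * ‖z - w‖ ≤ ‖s.1 (z • e₀) - s.1 (w • e₀)‖

/-- The relation between consecutive stages of the construction. -/
def Refines (e₀ : E) (δ : ℝ) (k : ℕ) (s s' : Equiv.Perm E × ℝ × ℝ) : Prop :=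
  (∀ z : ℂ, ‖s'.1 (z • e₀)‖ ≤ 2 * k + 1 / 2 - s.2.2 →
    ‖s.1 (z • e₀)‖ ≤ ‖s'.1 (z • e₀)‖ + s.2.2) ∧
  (∀ z : ℂ, ‖z‖ ≤ s.2.1 → ‖s'.1 (z • e₀) - s.1 (z • e₀)‖ ≤ s.2.2) ∧
  s.2.1 + 1 ≤ s'.2.1 ∧ s'.2.2 ≤ s.2.2 / 2 ∧
  ∀ e, ‖e‖ = 2 * k + 1 → ∃ z : ℂ, ‖z‖ ≤ s'.2.1 ∧ ‖s'.1 (z • e₀) - e‖ ≤ δ / 2 + s.2.2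

lemma exists_admissible_of_mem_shearGroup [FiniteDimensional ℂ E] {e₀ : E} (he₀ : e₀ ≠ 0)
    {Φ : Equiv.Perm E} (hΦ : Φ ∈ shearGroup E) (S : ℝ) {δ η : ℝ} (hδ : 0 < δ) (hη : 0 < η) :
    ∃ ε ≤ η, Admissible e₀ δ (Φ, S, ε) := by
  obtain ⟨M, hM0, hM⟩ := exists_bound_and_lipschitz_bound (differentiable_of_mem_shearGroup hΦ)
    (S * ‖e₀‖)
  obtain ⟨B, hB0, hB⟩ := exists_bound_and_lipschitz_bound
    (differentiable_of_mem_shearGroup (inv_mem hΦ)) M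
  have he : 0 < ‖e₀‖ := norm_pos_iff.2 he₀
  refine ⟨min (min η (1 / 4)) (min (δ / 4) (‖e₀‖ / (8 * (B + 1)))),
    (min_le_left _ _).trans (min_le_left _ _), hΦ, by positivity,
    (min_le_left _ _).trans (min_le_right _ _), (min_le_right _ _).trans (min_le_left _ _),
    fun z z' hz hz' => ?_⟩
  set ε := min (min η (1 / 4)) (min (δ / 4) (‖e₀‖ / (8 * (B + 1))))
  have hε : ε ≤ ‖e₀‖ / (8 * (B + 1)) := (min_le_right _ _).trans (min_le_right _ _)
  rw [le_div_iff₀ (by positivity)] at hε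
  have hn : ∀ z : ℂ, ‖z‖ ≤ S → ‖Φ (z • e₀)‖ ≤ M := fun z hz =>
    by
    have : ‖z • e₀‖ ≤ S * ‖e₀‖ := by rw [norm_smul]; gcongr
    exact (hM _ _ this this).1
  have h1 := (hB _ _ (hn z hz) (hn z' hz')).2
  rw [show Φ⁻¹ (Φ (z • e₀)) = z • e₀ from Φ.symm_apply_apply _,
    show Φ⁻¹ (Φ (z' • e₀)) = z' • e₀ from Φ.symm_apply_apply _, ← sub_smul, norm_smul] at h1
  change 8 * ε * ‖z - z'‖ ≤ ‖Φ (z • e₀) - Φ (z' • e₀)‖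
  refine le_of_mul_le_mul_left ?_ (by positivity : 0 < B + 1)
  calc (B + 1) * (8 * ε * ‖z - z'‖) = ε * (8 * (B + 1)) * ‖z - z'‖ := by ring
    _ ≤ ‖e₀‖ * ‖z - z'‖ := by gcongr
    _ ≤ B * ‖Φ (z • e₀) - Φ (z' • e₀)‖ := by rwa [mul_comm]
    _ ≤ (B + 1) * ‖Φ (z • e₀) - Φ (z' • e₀)‖ := by gcongr; linarith

lemma exists_admissible_refines [FiniteDimensional ℂ E] (hE : 2 ≤ Module.finrank ℂ E) {e₀ : E}
    (he₀ : e₀ ≠ 0) {δ δ' : ℝ} (hδ : 0 < δ) (hδ' : 0 < δ') (k : ℕ) {s : Equiv.Perm E × ℝ × ℝ}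
    (hs : Admissible e₀ δ s) : ∃ s', Admissible e₀ δ' s' ∧ Refines e₀ δ k s s' := by
  obtain ⟨Φ, S, ε⟩ := s
  obtain ⟨hΦ, hε, -, -, -⟩ := hs
  change 0 < ε at hε
  change Φ ∈ shearGroup E at hΦ
  have := FiniteDimensional.proper ℂ E
  obtain ⟨A, hAs, hAf, hA⟩ := (isCompact_sphere (0 : E) (2 * k + 1)).finite_cover_balls
    (half_pos hδ)
  obtain ⟨Ψ, hΨ, hd, hc, S', hS', hz⟩ := exists_shearGroup_hit_finset hE he₀ hΦ
    (R := 2 * k + 1 / 2) (by positivity) S hAf.toFinset (fun e he => by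
      have := hAs (hAf.mem_toFinset.1 he)
      rw [mem_sphere_zero_iff_norm] at this
      linarith) hε
  obtain ⟨ε', hε', hadm⟩ := exists_admissible_of_mem_shearGroup he₀ (mul_mem hΨ hΦ) (S' + 1) hδ'
    (half_pos hε)
  refine ⟨_, hadm, fun z hz' => ?_, hc, by simpa using hS', hε', fun e he => ?_⟩
  · have := (hd 0 rfl (Ψ (Φ (z • e₀))) (by rw [sub_zero]; exact hz')).2
    rw [show Ψ⁻¹ (Ψ (Φ (z • e₀))) = Φ (z • e₀) from Ψ.symm_apply_apply _] at this
    change ‖Φ (z • e₀)‖ ≤ ‖Ψ (Φ (z • e₀))‖ + ε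
    linarith [norm_le_norm_add_norm_sub' (Φ (z • e₀)) (Ψ (Φ (z • e₀)))]
  · obtain ⟨x, hx, hex⟩ := mem_iUnion₂.1 (hA (mem_sphere_zero_iff_norm.2 he))
    obtain ⟨z, hzS, hzx⟩ := hz x (hAf.mem_toFinset.2 hx)
    refine ⟨z, by simp only; linarith, ?_⟩
    rw [mem_ball, dist_comm, dist_eq_norm] at hex
    change ‖Ψ (Φ (z • e₀)) - e‖ ≤ δ / 2 + ε
    linarith [norm_sub_le_norm_sub_add_norm_sub (Ψ (Φ (z • e₀))) x e]

/-- There are properly embedded complex lines passing arbitrarily close to all points of the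
spheres of odd integer radius. -/
theorem exists_embedded_line_dense_in_spheres [FiniteDimensional ℂ E]
    (hE : 2 ≤ Module.finrank ℂ E) {δ : ℕ → ℝ} (hδ : ∀ k, 0 < δ k) :
    ∃ F : ℂ → E, Differentiable ℂ F ∧ Function.Injective F ∧ (∀ z, deriv F z ≠ 0) ∧
      (∀ K, IsCompact K → IsCompact (F ⁻¹' K)) ∧
      ∀ (k : ℕ) (e : E), ‖e‖ = 2 * k + 1 → ∃ q ∈ range F, dist q e ≤ δ k := by
  have := FiniteDimensional.complete ℂ E
  have : Nontrivial E := Module.nontrivial_of_finrank_pos (R := ℂ) (by omega)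
  obtain ⟨e₀, he₀⟩ := exists_ne (0 : E)
  obtain ⟨ε₀, -, hs₀⟩ := exists_admissible_of_mem_shearGroup he₀ (one_mem (shearGroup E)) 0
    (hδ 0) one_pos
  choose! next hadm href using fun (k : ℕ) (s : Equiv.Perm E × ℝ × ℝ)
    (hs : Admissible e₀ (δ k) s) => exists_admissible_refines hE he₀ (hδ k) (hδ (k + 1)) k hs
  let s : ℕ → Equiv.Perm E × ℝ × ℝ := fun k => Nat.rec (1, 0, ε₀) next k
  have hs : ∀ k, Admissible e₀ (δ k) (s k) := by
    intro k
    induction k with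
    | zero => exact hs₀
    | succ k ih => exact hadm k _ ih
  have hr : ∀ k, Refines e₀ (δ k) k (s k) (s (k + 1)) := fun k => href k _ (hs k)
  set Φ : ℕ → Equiv.Perm E := fun k => (s k).1
  set S : ℕ → ℝ := fun k => (s k).2.1
  set ε : ℕ → ℝ := fun k => (s k).2.2
  have hΦ : ∀ k, Φ k ∈ shearGroup E := fun k => (hs k).1
  have hε0 : ∀ k, 0 < ε k := fun k => (hs k).2.1
  have hε1 : ∀ k, ε k ≤ 1 / 4 := fun k => (hs k).2.2.1
  have hε2 : ∀ k, ε k ≤ δ k / 4 := fun k => (hs k).2.2.2.1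
  have hlow : ∀ k z z', ‖z‖ ≤ S k → ‖z'‖ ≤ S k →
    8 * ε k * ‖z - z'‖ ≤ ‖Φ k (z • e₀) - Φ k (z' • e₀)‖ := fun k => (hs k).2.2.2.2
  have hback : ∀ k (z : ℂ), ‖Φ (k + 1) (z • e₀)‖ ≤ 2 * k + 1 / 2 - ε k →
    ‖Φ k (z • e₀)‖ ≤ ‖Φ (k + 1) (z • e₀)‖ + ε k := fun k => (hr k).1
  have hclose : ∀ k (z : ℂ), ‖z‖ ≤ S k → ‖Φ (k + 1) (z • e₀) - Φ k (z • e₀)‖ ≤ ε k :=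
    fun k => (hr k).2.1
  have hS : ∀ k, S k + 1 ≤ S (k + 1) := fun k => (hr k).2.2.1
  have hε : ∀ k, ε (k + 1) ≤ ε k / 2 := fun k => (hr k).2.2.2.1
  have hhit : ∀ (k : ℕ) (e : E), ‖e‖ = 2 * k + 1 →
      ∃ z : ℂ, ‖z‖ ≤ S (k + 1) ∧ ‖Φ (k + 1) (z • e₀) - e‖ ≤ δ k / 2 + ε k :=
    fun k => (hr k).2.2.2.2
  have hfd : ∀ k, Differentiable ℂ fun z : ℂ => Φ k (z • e₀) := fun k =>
    (differentiable_of_mem_shearGroup (hΦ k)).comp (differentiable_id.smul_const e₀)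
  obtain ⟨hStop, F, hF, hFk⟩ := exists_entire_limit hfd hS hε0 hε hclose
  have hFlow : ∀ k z z', ‖z‖ + 1 ≤ S k → ‖z'‖ + 1 ≤ S k →
      4 * ε k * ‖z - z'‖ ≤ ‖F z - F z'‖ := by
    intro k z z' hz hz'
    have h1 := norm_sub_le_of_norm_le (hF.sub (hfd k)) one_pos
      (fun w hw => hFk k w (mem_ball_zero_iff.1 hw).le) hz' hz
    have h2 := hlow k z z' (by linarith) (by linarith)
    simp only [Pi.sub_apply] at h1
    have h3 : Φ k (z • e₀) - Φ k (z' • e₀) =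
        (F z - F z') - (F z - Φ k (z • e₀) - (F z' - Φ k (z' • e₀))) := by abel
    rw [h3] at h2
    have h4 := h2.trans (norm_sub_le _ _)
    rw [div_one] at h1
    linarith
  refine ⟨F, hF, fun z z' hzz => ?_, fun z => ?_, fun K hK => ?_, fun k e he => ?_⟩
  · obtain ⟨k, h1, h2⟩ := ((hStop.eventually_ge_atTop (‖z‖ + 1)).and
      (hStop.eventually_ge_atTop (‖z'‖ + 1))).exists
    have h3 := hFlow k z z' h1 h2
    rw [hzz, sub_self, norm_zero] at h3
    have h4 := hε0 k
    have h5 : ‖z - z'‖ = 0 := by nlinarith [norm_nonneg (z - z')]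
    exact sub_eq_zero.1 (norm_eq_zero.1 h5)
  · obtain ⟨k, hk⟩ := (hStop.eventually_ge_atTop (‖z‖ + 2)).exists
    refine deriv_ne_zero_of_le_norm_sub hF (c := 4 * ε k) (by linarith [hε0 k]) ?_
    filter_upwards [ball_mem_nhds z one_pos] with z' hz'
    rw [mem_ball, dist_eq_norm] at hz'
    exact hFlow k z' z (by linarith [norm_le_norm_add_norm_sub' z' z]) (by linarith)
  · obtain ⟨M, hM⟩ := hK.isBounded.exists_norm_le
    obtain ⟨N, hN⟩ := exists_nat_ge M
    obtain ⟨B, hB0, hB⟩ := exists_bound_and_lipschitz_bound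
      (differentiable_of_mem_shearGroup (inv_mem (hΦ N))) (N + 1)
    have he : 0 < ‖e₀‖ := norm_pos_iff.2 he₀
    refine (isCompact_closedBall (0 : ℂ) (B / ‖e₀‖)).of_isClosed_subset
      (hK.isClosed.preimage hF.continuous) fun z hz => ?_
    have hzN : ‖F z‖ ≤ N := (hM _ hz).trans hN
    obtain ⟨j, hj1, hj2⟩ := ((hStop.eventually_ge_atTop ‖z‖).and (eventually_ge_atTop N)).exists
    have hdown : ∀ i, N ≤ i → i ≤ j → ‖Φ i (z • e₀)‖ ≤ N + 2 * ε i := by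
      intro i hNi hij
      induction hij using Nat.decreasingInduction with
      | self =>
        have := norm_le_norm_add_norm_sub (F z) (Φ j (z • e₀))
        linarith [hFk j z hj1]
      | of_succ i _ ih =>
        have h1 := ih (by omega)
        have h2 : (N : ℝ) ≤ i := by exact_mod_cast hNi
        have h3 : (0 : ℝ) ≤ i := Nat.cast_nonneg i
        have := hback i z (by linarith [hε i, hε1 i])
        linarith [hε i]
    have h1 := (hB _ _ ((hdown N le_rfl hj2).trans (by linarith [hε1 N]))
      ((hdown N le_rfl hj2).trans (by linarith [hε1 N]))).1
    rw [show (Φ N)⁻¹ (Φ N (z • e₀)) = z • e₀ from (Φ N).symm_apply_apply _, norm_smul] at h1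
    rwa [mem_closedBall_zero_iff, le_div_iff₀ he]
  · obtain ⟨z, hz, hze⟩ := hhit k e he
    refine ⟨F z, mem_range_self z, ?_⟩
    rw [dist_eq_norm]
    have h1 := norm_sub_le_norm_sub_add_norm_sub (F z) (Φ (k + 1) (z • e₀)) e
    linarith [hFk (k + 1) z hz, hε k, hε2 k]

end Construction

end Auxiliary

/-- For every n ≥ 2 there is a properly embedded complex line in ℂⁿ that cannot be
straightened: no holomorphic automorphism of ℂⁿ maps its image onto an affine complex line. -/
theorem exists_nonstraightenable_embedded_line (n : ℕ) (hn : 2 ≤ n) :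
    ∃ F : ℂ → EuclideanSpace ℂ (Fin n),
      Differentiable ℂ F ∧ Function.Injective F ∧
      (∀ z : ℂ, deriv F z ≠ 0) ∧
      (∀ K : Set (EuclideanSpace ℂ (Fin n)), IsCompact K → IsCompact (F ⁻¹' K)) ∧
      ∀ Φ : EuclideanSpace ℂ (Fin n) → EuclideanSpace ℂ (Fin n),
        IsHolomorphicAutomorphism Φ →
        ∀ (a b : EuclideanSpace ℂ (Fin n)), b ≠ 0 →
          Φ '' Set.range F ≠ Set.range (fun t : ℂ => a + t • b) := by
  have hE : 2 ≤ Module.finrank ℂ (EuclideanSpace ℂ (Fin n)) := by simpa using hn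
  have : Nontrivial (EuclideanSpace ℂ (Fin n)) :=
    Module.nontrivial_of_finrank_pos (R := ℂ) (by omega)
  obtain ⟨δ, hδ, hΓ⟩ := exists_dense_barrier (E := EuclideanSpace ℂ (Fin n))
  obtain ⟨F, hF, hinj, hd, hp, hdense⟩ := exists_embedded_line_dense_in_spheres hE hδ
  refine ⟨F, hF, hinj, hd, hp, fun Φ ⟨hΦ, G, hG, _, hΦG⟩ a b _ h => ?_⟩
  obtain ⟨H, hH, hHd, hHr⟩ := exists_locally_biholomorphic_disjoint hE hΦ hG hΦG h
  obtain ⟨q, hq, hqr⟩ := hΓ _ hdense H hH hHd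
  exact hHr q hq hqr
end
end

section
/- For every pair of integers 1 ≤ q < n there exists a holomorphic submersion f : 𝔹ⁿ → ℂ^q on the open unit Euclidean ball 𝔹ⁿ = {z ∈ ℂⁿ : ‖z‖ < 1} (i.e., f is holomorphic and its derivative df_z : ℂⁿ → ℂ^q is surjective at every z ∈ 𝔹ⁿ) whose fibres are complete: for every continuous path γ : [0,1) → 𝔹ⁿ such that f ∘ γ is constant and ‖γ(t)‖ → 1 as t → 1⁻, the Euclidean length of γ (its total variation on [0,1)) is infinite. -/
open scoped ENNReal

noncomputable section

open Filter Topology Metric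

lemma IsCompact.exists_norm_sub_lt {E : Type*} [NormedAddCommGroup E] {C : Set E}
    (hC : IsCompact C) {Φ : E → E} (hΦ : Continuous Φ)
    {ε : ℝ} (hε : 0 < ε) : ∃ η > 0, ∀ z ∈ C, ∀ w, ‖w‖ < η → ‖Φ (z + w) - Φ z‖ < ε := by
  have h := hC.uniformContinuousAt_of_continuousAt Φ (fun a _ => hΦ.continuousAt)
    (dist_mem_uniformity hε)
  obtain ⟨η, hη, h'⟩ := Metric.mem_uniformity_dist.1 h
  refine ⟨η, hη, fun z hz w hw => ?_⟩
  have := h' (a := z) (b := z + w) (by simpa [dist_eq_norm] using hw) hz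
  simpa [dist_eq_norm, norm_sub_rev] using this

section Growth

variable {E : Type*} [NormedAddCommGroup E] [NormedSpace ℂ E]

/-- `f` tends to infinity along every closed cone on which `l` vanishes only at the origin. -/
def GrowsAlong (f : E → ℂ) (l : E →L[ℂ] ℂ) : Prop :=
  ∀ κ > 0, ∀ T : ℝ, ∃ R : ℝ, ∀ x, R ≤ ‖x‖ → κ * ‖x‖ ≤ ‖l x‖ → T < ‖f x‖

lemma GrowsAlong.self (l : E →L[ℂ] ℂ) : GrowsAlong l l := by
  intro κ hκ T
  refine ⟨(|T| + 1) / κ, fun x hx hlx => ?_⟩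
  have h1 : |T| + 1 ≤ κ * ‖x‖ := by rwa [div_le_iff₀' hκ] at hx
  linarith [le_abs_self T]

/-- `g` grows faster than linearly at infinity. -/
def Superlinear (g : ℂ → ℂ) : Prop :=
  ∀ B : ℝ, ∃ R : ℝ, ∀ ζ, R ≤ ‖ζ‖ → B * ‖ζ‖ ≤ ‖g ζ‖

lemma GrowsAlong.comp_shear {f : E → ℂ} {l m : E →L[ℂ] ℂ} {v : E} {g : ℂ → ℂ}
    (hf : GrowsAlong f l) (hlv : l v ≠ 0) (hg : Superlinear g) :
    GrowsAlong (fun x => f (x + g (m x) • v)) m := by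
  intro κ hκ T
  have hp : 0 < ‖l v‖ := norm_pos_iff.2 hlv
  obtain ⟨R₀, hR₀⟩ := hf (‖l v‖ / (2 * (‖v‖ + 1))) (by positivity) T
  set D : ℝ := max 1 (4 * ‖l‖ / ‖l v‖) with hD
  have hD1 : 1 ≤ D := le_max_left _ _
  have hD2 : 4 * ‖l‖ ≤ D * ‖l v‖ := by
    have := le_max_right 1 (4 * ‖l‖ / ‖l v‖)
    rwa [← hD, div_le_iff₀ hp] at this
  obtain ⟨R₁, hR₁⟩ := hg (D / κ)
  refine ⟨max (R₁ / κ) (4 * |R₀| * (‖l‖ + 1) / (3 * ‖l v‖)), fun x hx hmx => hR₀ _ ?_ ?_⟩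
  all_goals
    have hx1 : R₁ ≤ ‖m x‖ := by
      have := (le_max_left _ _).trans hx
      rw [div_le_iff₀' hκ] at this
      linarith
    have hx2 : 4 * |R₀| * (‖l‖ + 1) ≤ ‖x‖ * (3 * ‖l v‖) := by
      have := (le_max_right _ _).trans hx
      rwa [div_le_iff₀ (by positivity)] at this
    have hgx : D * ‖x‖ ≤ ‖g (m x)‖ := by
      refine le_trans ?_ (hR₁ _ hx1)
      calc D * ‖x‖ = D / κ * (κ * ‖x‖) := by field_simp
        _ ≤ _ := by gcongr
    have hgx' : ‖x‖ ≤ ‖g (m x)‖ := by nlinarith [norm_nonneg x]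
    have hy1 : 3 / 4 * ‖g (m x)‖ * ‖l v‖ ≤ ‖l (x + g (m x) • v)‖ := by
      have h1 : ‖g (m x)‖ * ‖l v‖ - ‖l‖ * ‖x‖ ≤ ‖l (x + g (m x) • v)‖ := by
        have h2 := norm_sub_le (l (x + g (m x) • v)) (l x)
        have h3 : l (x + g (m x) • v) - l x = g (m x) * l v := by simp
        rw [h3, norm_mul] at h2
        linarith [l.le_opNorm x]
      have : 4 * (‖l‖ * ‖x‖) ≤ ‖g (m x)‖ * ‖l v‖ := by
        calc 4 * (‖l‖ * ‖x‖) = 4 * ‖l‖ * ‖x‖ := by ring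
          _ ≤ D * ‖l v‖ * ‖x‖ := by gcongr
          _ = D * ‖x‖ * ‖l v‖ := by ring
          _ ≤ _ := by gcongr
      linarith
  · have h1 := l.le_opNorm (x + g (m x) • v)
    have h2 : |R₀| * (‖l‖ + 1) ≤ ‖x + g (m x) • v‖ * (‖l‖ + 1) := by
      have : ‖x‖ * ‖l v‖ ≤ ‖g (m x)‖ * ‖l v‖ := by gcongr
      nlinarith [norm_nonneg (x + g (m x) • v)]
    exact (le_abs_self _).trans (le_of_mul_le_mul_right h2 (by positivity))
  · have h1 : ‖x + g (m x) • v‖ ≤ ‖g (m x)‖ * (‖v‖ + 1) := by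
      have := norm_add_le x (g (m x) • v)
      rw [norm_smul] at this
      linarith
    calc ‖l v‖ / (2 * (‖v‖ + 1)) * ‖x + g (m x) • v‖
        ≤ ‖l v‖ / (2 * (‖v‖ + 1)) * (‖g (m x)‖ * (‖v‖ + 1)) := by gcongr
      _ = 1 / 2 * ‖g (m x)‖ * ‖l v‖ := by field_simp
      _ ≤ 3 / 4 * ‖g (m x)‖ * ‖l v‖ := by
        linarith [mul_nonneg (norm_nonneg (g (m x))) (norm_nonneg (l v))]
      _ ≤ _ := hy1

lemma GrowsAlong.exists_lt_norm_add_smul {f : E → ℂ} {l : E →L[ℂ] ℂ} {v : E}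
    (hf : GrowsAlong f l) (hlv : l v ≠ 0) (ρ T : ℝ) :
    ∃ R : ℝ, ∀ z, ‖z‖ ≤ ρ → ∀ τ : ℂ, R ≤ ‖τ‖ → T < ‖f (z + τ • v)‖ := by
  have hp : 0 < ‖l v‖ := norm_pos_iff.2 hlv
  obtain ⟨R₀, hR₀⟩ := hf (‖l v‖ / (2 * (‖v‖ + 1))) (by positivity) T
  refine ⟨max |ρ| (max (4 * (‖l‖ * |ρ|) / ‖l v‖) (4 * |R₀| * (‖l‖ + 1) / (3 * ‖l v‖))),
    fun z hz τ hτ => hR₀ _ ?_ ?_⟩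
  all_goals
    have hz' : ‖z‖ ≤ |ρ| := hz.trans (le_abs_self ρ)
    have h1 : |ρ| ≤ ‖τ‖ := (le_max_left _ _).trans hτ
    have h2 : 4 * (‖l‖ * |ρ|) ≤ ‖τ‖ * ‖l v‖ := by
      have := ((le_max_left _ _).trans (le_max_right _ _)).trans hτ
      rwa [div_le_iff₀ hp] at this
    have h3 : 4 * |R₀| * (‖l‖ + 1) ≤ ‖τ‖ * (3 * ‖l v‖) := by
      have := ((le_max_right _ _).trans (le_max_right _ _)).trans hτ
      rwa [div_le_iff₀ (by positivity)] at this
    have h4 : ‖l‖ * ‖z‖ ≤ ‖l‖ * |ρ| := by gcongr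
    have hy1 : 3 / 4 * ‖τ‖ * ‖l v‖ ≤ ‖l (z + τ • v)‖ := by
      have h5 := norm_sub_le (l (z + τ • v)) (l z)
      have h6 : l (z + τ • v) - l z = τ * l v := by simp
      rw [h6, norm_mul] at h5
      linarith [l.le_opNorm z]
  · have h5 := l.le_opNorm (z + τ • v)
    have h6 : |R₀| * (‖l‖ + 1) ≤ ‖z + τ • v‖ * (‖l‖ + 1) := by
      nlinarith [norm_nonneg (z + τ • v)]
    exact (le_abs_self _).trans (le_of_mul_le_mul_right h6 (by positivity))
  · have h5 : ‖z + τ • v‖ ≤ ‖τ‖ * (‖v‖ + 1) := by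
      have := norm_add_le z (τ • v)
      rw [norm_smul] at this
      linarith
    calc ‖l v‖ / (2 * (‖v‖ + 1)) * ‖z + τ • v‖
        ≤ ‖l v‖ / (2 * (‖v‖ + 1)) * (‖τ‖ * (‖v‖ + 1)) := by gcongr
      _ = 1 / 2 * ‖τ‖ * ‖l v‖ := by field_simp
      _ ≤ 3 / 4 * ‖τ‖ * ‖l v‖ := by linarith [mul_nonneg (norm_nonneg τ) (norm_nonneg (l v))]
      _ ≤ _ := hy1

end Growth

section Profile

lemma superlinear_const_mul_sq {a : ℂ} (ha : a ≠ 0) : Superlinear fun ζ => a * ζ ^ 2 := by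
  intro B
  have hp : 0 < ‖a‖ := norm_pos_iff.2 ha
  refine ⟨B / ‖a‖, fun ζ hζ => ?_⟩
  rw [div_le_iff₀ hp] at hζ
  rw [norm_mul, norm_pow]
  nlinarith [norm_nonneg ζ]

/-- An entire function of superlinear growth separating the half-plane `c ≤ re ζ` from a compact
piece of the half-plane `re ζ ≤ c - δ`. -/
lemma exists_superlinear_separating (c ρ A : ℝ) {δ ε : ℝ} (hδ : 0 < δ) (hε : 0 < ε) :
    ∃ g : ℂ → ℂ, Differentiable ℂ g ∧ Superlinear g ∧
      (∀ ζ : ℂ, ‖ζ‖ ≤ ρ → ζ.re ≤ c - δ → ‖g ζ‖ < ε) ∧ ∀ ζ : ℂ, c ≤ ζ.re → A < ‖g ζ‖ := by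
  set L : ℝ := ρ ^ 2 / δ + |c| + δ + 1 with hL
  set q : ℝ := L + c - δ / 2 with hq
  have hρδ : 0 ≤ ρ ^ 2 / δ := by positivity
  have hc := neg_abs_le c
  have hq0 : 0 < q := by linarith
  have hL0 : 0 < L := by positivity
  have hLδ : ρ ^ 2 < L * δ := by
    have : ρ ^ 2 = ρ ^ 2 / δ * δ := by field_simp
    nlinarith [abs_nonneg c]
  have hqC : (q : ℂ) ≠ 0 := by exact_mod_cast hq0.ne'
  set θ : ℝ := 1 - (L * δ - ρ ^ 2) / q ^ 2 with hθ
  have hsq : ∀ ζ : ℂ, ‖ζ + L‖ ^ 2 = ‖ζ‖ ^ 2 + 2 * L * ζ.re + L ^ 2 := by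
    intro ζ
    rw [← Complex.normSq_eq_norm_sq, ← Complex.normSq_eq_norm_sq, Complex.normSq_apply,
      Complex.normSq_apply]
    simp; ring
  have hsmall : ∀ ζ : ℂ, ‖ζ‖ ≤ ρ → ζ.re ≤ c - δ → (‖ζ + L‖ / q) ^ 2 ≤ θ := by
    intro ζ h1 h2
    have h3 : ‖ζ‖ ^ 2 ≤ ρ ^ 2 := by gcongr
    have h4 : θ = (q ^ 2 - (L * δ - ρ ^ 2)) / q ^ 2 := by rw [hθ]; field_simp
    rw [div_pow, hsq, h4]
    gcongr
    nlinarith [sq_nonneg (c - δ / 2)]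
  have hlarge : ∀ ζ : ℂ, c ≤ ζ.re → 1 + δ / (2 * q) ≤ ‖ζ + L‖ / q := by
    intro ζ h1
    rw [le_div_iff₀ hq0]
    have h2 : (ζ + L).re ≤ ‖ζ + L‖ := Complex.re_le_norm _
    have h3 : (1 + δ / (2 * q)) * q = q + δ / 2 := by field_simp
    simp only [Complex.add_re, Complex.ofReal_re] at h2
    linarith
  have hθ1 : max θ 0 < 1 := by
    have : 0 < (L * δ - ρ ^ 2) / q ^ 2 := by
      have : 0 < L * δ - ρ ^ 2 := by linarith
      positivity
    simp only [max_lt_iff, zero_lt_one, and_true]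
    linarith
  have e1 : ∀ᶠ k : ℕ in atTop, (max θ 0) ^ k < ε :=
    (tendsto_pow_atTop_nhds_zero_of_lt_one (le_max_right _ _) hθ1).eventually_lt_const hε
  have e2 : ∀ᶠ k : ℕ in atTop, A < (1 + δ / (2 * q)) ^ k :=
    (tendsto_pow_atTop_atTop_of_one_lt (by have : 0 < δ / (2 * q) := by positivity
                                           linarith)).eventually_gt_atTop A
  obtain ⟨k, hk1, hk2, hk⟩ := (e1.and (e2.and (eventually_ge_atTop 1))).exists
  have hnorm : ∀ ζ : ℂ, ‖((ζ + L) / q) ^ (2 * k)‖ = ((‖ζ + L‖ / q) ^ 2) ^ k := by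
    intro ζ
    rw [norm_pow, norm_div, pow_mul, Complex.norm_real, Real.norm_of_nonneg hq0.le]
  refine ⟨fun ζ => ((ζ + L) / q) ^ (2 * k), by fun_prop, fun B => ?_, fun ζ h1 h2 => ?_,
    fun ζ h1 => ?_⟩
  · refine ⟨q + 2 * L + 4 * |B| * q ^ 2, fun ζ hζ => ?_⟩
    have hB : 0 ≤ 4 * |B| * q ^ 2 := by positivity
    have h1 : ‖ζ‖ - L ≤ ‖ζ + L‖ := by
      have := norm_sub_le (ζ + L) (L : ℂ)
      rw [add_sub_cancel_right, Complex.norm_real, Real.norm_of_nonneg hL0.le] at this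
      linarith
    have h2 : 1 ≤ (‖ζ + L‖ / q) ^ 2 := by
      apply one_le_pow₀
      rw [le_div_iff₀ hq0]
      linarith
    rw [hnorm]
    refine le_trans ?_ (le_self_pow₀ h2 (by omega))
    rw [div_pow, le_div_iff₀ (by positivity)]
    have h3 : ‖ζ‖ / 2 ≤ ‖ζ + L‖ := by linarith
    have h4 : B * ‖ζ‖ * q ^ 2 ≤ |B| * ‖ζ‖ * q ^ 2 := by gcongr; exact le_abs_self B
    nlinarith [norm_nonneg ζ]
  · rw [hnorm]
    exact (pow_le_pow_left₀ (by positivity) ((hsmall ζ h1 h2).trans (le_max_left _ _)) k).trans_lt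
      hk1
  · rw [hnorm]
    refine hk2.trans_le (pow_le_pow_left₀ (by positivity) ?_ k)
    have h3 := hlarge ζ h1
    have h4 : 0 < δ / (2 * q) := by positivity
    nlinarith

end Profile

section Step

variable {E : Type*} [NormedAddCommGroup E] [InnerProductSpace ℂ E]

/-- Entire maps with Jacobian determinant one whose component `p ∘ Φ` grows along some
functional. -/
structure IsAdmissible (p : E →L[ℂ] ℂ) (Φ : E → E) : Prop where
  differentiable : Differentiable ℂ Φ
  det_fderiv : ∀ z, (fderiv ℂ Φ z).det = 1
  exists_growsAlong : ∃ l : E →L[ℂ] ℂ, l ≠ 0 ∧ GrowsAlong (fun x => p (Φ x)) l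

lemma IsAdmissible.id {p : E →L[ℂ] ℂ} (hp : p ≠ 0) : IsAdmissible p fun x => x :=
  ⟨differentiable_id, fun z => by simp [ContinuousLinearMap.det], p, hp, GrowsAlong.self p⟩

variable [FiniteDimensional ℂ E]

lemma det_fderiv_shear {m : E →L[ℂ] ℂ} {v : E} {g : ℂ → ℂ} (hmv : m v = 0)
    (hg : Differentiable ℂ g) (z : E) :
    (fderiv ℂ (fun x => x + g (m x) • v) z).det = 1 := by
  have h1 : HasFDerivAt (fun x => g (m x)) (deriv g (m z) • m) z :=
    (hg (m z)).hasDerivAt.comp_hasFDerivAt z m.hasFDerivAt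
  have h2 : HasFDerivAt (fun x => x + g (m x) • v)
      (ContinuousLinearMap.id ℂ E + (deriv g (m z) • m).smulRight v) z :=
    (hasFDerivAt_id z).add (h1.smul_const v)
  have h3 : ((ContinuousLinearMap.id ℂ E + (deriv g (m z) • m).smulRight v : E →L[ℂ] E) : E →ₗ[ℂ] E)
      = LinearMap.transvection ((deriv g (m z) • m : E →L[ℂ] ℂ) : E →ₗ[ℂ] ℂ) v := by
    ext x
    simp [LinearMap.transvection.apply]
  rw [h2.fderiv, ContinuousLinearMap.det, h3, LinearMap.transvection.det]
  simp [hmv]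

lemma IsAdmissible.comp_shear {p l m : E →L[ℂ] ℂ} {Φ : E → E} {v : E} {g : ℂ → ℂ}
    (hΦ : IsAdmissible p Φ) (hl : GrowsAlong (fun x => p (Φ x)) l) (hmv : m v = 0) (hm : m ≠ 0)
    (hlv : l v ≠ 0) (hg : Differentiable ℂ g) (hgs : Superlinear g) :
    IsAdmissible p (fun x => Φ (x + g (m x) • v)) ∧
      GrowsAlong (fun x => p (Φ (x + g (m x) • v))) m := by
  have hS : Differentiable ℂ fun x => x + g (m x) • v := by fun_prop
  have hgr := hl.comp_shear (m := m) hlv hgs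
  refine ⟨⟨hΦ.differentiable.comp hS, fun z => ?_, m, hm, hgr⟩, hgr⟩
  have h := fderiv_fun_comp z (hΦ.differentiable _) (hS z)
  rw [h, ContinuousLinearMap.det, ContinuousLinearMap.toLinearMap_comp, LinearMap.det_comp]
  have h1 := hΦ.det_fderiv (z + g (m z) • v)
  have h2 := det_fderiv_shear hmv hg z
  rw [ContinuousLinearMap.det] at h1 h2
  rw [h1, h2, one_mul]

/-- Over a half-space, a component of an admissible map can be made large by a shear in a direction
along which it grows, changing the map little on a compact set in the complementary half-space. -/
lemma IsAdmissible.exists_of_apply_ne_zero {p l m : E →L[ℂ] ℂ} {Φ : E → E} {v : E}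
    (hΦ : IsAdmissible p Φ) (hl : GrowsAlong (fun x => p (Φ x)) l) (hmv : m v = 0) (hm : m ≠ 0)
    (hlv : l v ≠ 0) {C K : Set E} (hC : IsCompact C) (hK : IsCompact K) {c : ℝ}
    (hCc : ∀ z ∈ C, (m z).re < c) (hKc : ∀ z ∈ K, c ≤ (m z).re) {ε : ℝ} (hε : 0 < ε) (T : ℝ) :
    ∃ Ψ, IsAdmissible p Ψ ∧ (∀ z ∈ C, ‖Ψ z - Φ z‖ < ε) ∧ ∀ z ∈ K, T < ‖p (Ψ z)‖ := by
  obtain ⟨η, hη, hηΦ⟩ := hC.exists_norm_sub_lt hΦ.differentiable.continuous hε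
  obtain ⟨c', hc', hCc'⟩ := hC.exists_forall_le' (f := fun z => -(m z).re) (a := -c)
    (by fun_prop) (fun z hz => neg_lt_neg (hCc z hz))
  obtain ⟨ρ₁, hρ₁⟩ := hK.isBounded.exists_norm_le
  obtain ⟨ρ₂, hρ₂⟩ := (hC.image m.continuous).isBounded.exists_norm_le
  obtain ⟨R, hR⟩ := hl.exists_lt_norm_add_smul hlv ρ₁ T
  obtain ⟨g, hg, hgs, hg1, hg2⟩ := exists_superlinear_separating c ρ₂ R
    (δ := c + c') (by linarith) (ε := η / (‖v‖ + 1)) (by positivity)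
  refine ⟨_, (hΦ.comp_shear hl hmv hm hlv hg hgs).1, fun z hz => hηΦ z hz _ ?_, fun z hz => ?_⟩
  · have h1 := hg1 (m z) (hρ₂ _ (Set.mem_image_of_mem _ hz)) (by have := hCc' z hz; linarith)
    rw [lt_div_iff₀ (by positivity)] at h1
    rw [norm_smul]
    nlinarith [norm_nonneg (g (m z))]
  · exact hR z (hρ₁ z hz) _ (hg2 _ (hKc z hz)).le

lemma IsAdmissible.exists_close {p l m : E →L[ℂ] ℂ} {Φ : E → E} {v : E}
    (hΦ : IsAdmissible p Φ) (hl : GrowsAlong (fun x => p (Φ x)) l) (hmv : m v = 0) (hm : m ≠ 0)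
    (hlv : l v ≠ 0) {C : Set E} (hC : IsCompact C) {ε : ℝ} (hε : 0 < ε) :
    ∃ Ψ, IsAdmissible p Ψ ∧ GrowsAlong (fun x => p (Ψ x)) m ∧ ∀ z ∈ C, ‖Ψ z - Φ z‖ < ε := by
  obtain ⟨η, hη, hηΦ⟩ := hC.exists_norm_sub_lt hΦ.differentiable.continuous hε
  obtain ⟨ρ, hρ⟩ := (hC.image m.continuous).isBounded.exists_norm_le
  set a : ℝ := η / (2 * (ρ ^ 2 + 1) * (‖v‖ + 1)) with ha
  have ha0 : 0 < a := by positivity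
  have h := hΦ.comp_shear hl hmv hm hlv (g := fun ζ => (a : ℂ) * ζ ^ 2) (by fun_prop)
    (superlinear_const_mul_sq (by exact_mod_cast ha0.ne'))
  refine ⟨_, h.1, h.2, fun z hz => hηΦ z hz _ ?_⟩
  have h1 := hρ _ (Set.mem_image_of_mem _ hz)
  rw [norm_smul, norm_mul, norm_pow, Complex.norm_real, Real.norm_of_nonneg ha0.le]
  calc a * ‖m z‖ ^ 2 * ‖v‖ ≤ a * (ρ ^ 2 + 1) * (‖v‖ + 1) := by
        have : ‖m z‖ ^ 2 ≤ ρ ^ 2 := by gcongr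
        gcongr <;> linarith
    _ = η / 2 := by rw [ha]; field_simp
    _ < η := by linarith

lemma exists_functional_of_ker_le {l m : E →L[ℂ] ℂ} (hE : 2 ≤ Module.finrank ℂ E) (hl : l ≠ 0)
    (h : ∀ v, m v = 0 → l v = 0) :
    ∃ (μ : E →L[ℂ] ℂ) (v w : E), μ v = 0 ∧ l v ≠ 0 ∧ m w = 0 ∧ μ w ≠ 0 := by
  obtain ⟨v, hv⟩ : ∃ v, l v ≠ 0 := by
    by_contra! hcon
    exact hl (by ext x; simpa using hcon x)
  obtain ⟨w, hw, hw0⟩ : ∃ w, m w = 0 ∧ w ≠ 0 := by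
    have hlt : Module.finrank ℂ ℂ < Module.finrank ℂ E := by
      rw [Module.finrank_self]; omega
    obtain ⟨w, hw, hw0⟩ := (Submodule.ne_bot_iff _).1
      (LinearMap.ker_ne_bot_of_finrank_lt (f := (m : E →ₗ[ℂ] ℂ)) hlt)
    exact ⟨w, by simpa using hw, hw0⟩
  refine ⟨l v • innerSL ℂ w - inner ℂ w v • l, v, w, ?_, hv, hw, ?_⟩
  · simp [mul_comm]
  · simp [h w hw, hv, hw0]

lemma IsAdmissible.exists_step {p m : E →L[ℂ] ℂ} {Φ : E → E} (hE : 2 ≤ Module.finrank ℂ E)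
    (hΦ : IsAdmissible p Φ) (hm : m ≠ 0) {C K : Set E} (hC : IsCompact C) (hK : IsCompact K) {c : ℝ}
    (hCc : ∀ z ∈ C, (m z).re < c) (hKc : ∀ z ∈ K, c ≤ (m z).re) {ε : ℝ} (hε : 0 < ε) (T : ℝ) :
    ∃ Ψ, IsAdmissible p Ψ ∧ (∀ z ∈ C, ‖Ψ z - Φ z‖ < ε) ∧ ∀ z ∈ K, T < ‖p (Ψ z)‖ := by
  obtain ⟨l, hl0, hl⟩ := hΦ.exists_growsAlong
  by_cases h : ∀ v, m v = 0 → l v = 0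
  · obtain ⟨μ, v, w, hμv, hlv, hmw, hμw⟩ := exists_functional_of_ker_le hE hl0 h
    have hμ : μ ≠ 0 := by rintro rfl; simp at hμw
    obtain ⟨Ψ, hΨ, hΨg, hΨC⟩ := hΦ.exists_close hl hμv hμ hlv hC (half_pos hε)
    obtain ⟨Ξ, hΞ, hΞC, hΞK⟩ := hΨ.exists_of_apply_ne_zero hΨg hmw hm hμw hC hK hCc hKc
      (half_pos hε) T
    refine ⟨Ξ, hΞ, fun z hz => ?_, hΞK⟩
    calc ‖Ξ z - Φ z‖ ≤ ‖Ξ z - Ψ z‖ + ‖Ψ z - Φ z‖ := norm_sub_le_norm_sub_add_norm_sub _ _ _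
      _ < ε := by linarith [hΨC z hz, hΞC z hz]
  · push Not at h
    obtain ⟨v, hmv, hlv⟩ := h
    exact hΦ.exists_of_apply_ne_zero hl hmv hm hlv hC hK hCc hKc hε T

/-- A finite family of compact pieces, each separated by a real hyperplane from a compact set `C`
and from all pieces of no greater rank. -/
lemma IsAdmissible.exists_of_finset {ι : Type*} {p : E →L[ℂ] ℂ} {Φ : E → E}
    (hE : 2 ≤ Module.finrank ℂ E) (hΦ : IsAdmissible p Φ) {C : Set E} (hC : IsCompact C)
    (rank : ι → ℕ) (K : ι → Set E) (m : ι → E →L[ℂ] ℂ) (c : ι → ℝ) (s : Finset ι)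
    (hm : ∀ i ∈ s, m i ≠ 0) (hK : ∀ i ∈ s, IsCompact (K i))
    (hKc : ∀ i ∈ s, ∀ z ∈ K i, c i ≤ (m i z).re) (hCc : ∀ i ∈ s, ∀ z ∈ C, (m i z).re < c i)
    (hKK : ∀ i ∈ s, ∀ j ∈ s, i ≠ j → rank i ≤ rank j → ∀ z ∈ K i, (m j z).re < c j)
    {ε : ℝ} (hε : 0 < ε) (T : ℝ) :
    ∃ Ψ, IsAdmissible p Ψ ∧ (∀ z ∈ C, ‖Ψ z - Φ z‖ < ε) ∧
      ∀ i ∈ s, ∀ z ∈ K i, T < ‖p (Ψ z)‖ := by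
  classical
  induction s using Finset.induction_on_max_value rank generalizing ε T with
  | empty => exact ⟨Φ, hΦ, by simpa using fun _ _ => hε, by simp⟩
  | insert a s ha hmax ih =>
    have hsub : ∀ i ∈ s, i ∈ insert a s := fun i hi => Finset.mem_insert_of_mem hi
    have haa := Finset.mem_insert_self a s
    obtain ⟨Ψ, hΨ, hΨC, hΨK⟩ := ih (fun i hi => hm i (hsub i hi)) (fun i hi => hK i (hsub i hi))
      (fun i hi => hKc i (hsub i hi)) (fun i hi => hCc i (hsub i hi))
      (fun i hi j hj => hKK i (hsub i hi) j (hsub j hj)) (half_pos hε) (T + ‖p‖)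
    set D : Set E := C ∪ ⋃ i ∈ s, K i with hD
    have hDc : IsCompact D := hC.union (s.isCompact_biUnion fun i hi => hK i (hsub i hi))
    have hDm : ∀ z ∈ D, (m a z).re < c a := by
      rintro z (hz | hz)
      · exact hCc a haa z hz
      · obtain ⟨i, hi, hz⟩ := Set.mem_iUnion₂.1 hz
        exact hKK i (hsub i hi) a haa (fun h => ha (h ▸ hi)) (hmax i hi) z hz
    obtain ⟨Ξ, hΞ, hΞD, hΞK⟩ := hΨ.exists_step hE (hm a haa) hDc (hK a haa) hDm (hKc a haa)
      (lt_min (half_pos hε) one_pos) T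
    refine ⟨Ξ, hΞ, fun z hz => ?_, fun i hi z hz => ?_⟩
    · have h1 := (hΞD z (Or.inl hz)).trans_le (min_le_left _ _)
      calc ‖Ξ z - Φ z‖ ≤ ‖Ξ z - Ψ z‖ + ‖Ψ z - Φ z‖ := norm_sub_le_norm_sub_add_norm_sub _ _ _
        _ < ε := by linarith [hΨC z hz]
    · rcases Finset.mem_insert.1 hi with rfl | hi
      · exact hΞK z hz
      · have h1 := (hΞD z (Or.inr (Set.mem_iUnion₂.2 ⟨i, hi, hz⟩))).trans_le (min_le_right _ _)
        have h2 := hΨK i hi z hz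
        have h3 : ‖p (Ψ z)‖ - ‖p (Ξ z)‖ ≤ ‖p‖ * ‖Ξ z - Ψ z‖ := by
          calc _ ≤ ‖p (Ψ z) - p (Ξ z)‖ := norm_sub_norm_le _ _
            _ = ‖p (Ξ z - Ψ z)‖ := by rw [map_sub, norm_sub_rev]
            _ ≤ _ := p.le_opNorm _
        nlinarith [norm_nonneg p]

end Step

section Limit

variable {E : Type*} [NormedAddCommGroup E] [NormedSpace ℂ E]

lemma norm_fderiv_sub_le_s18 {f g : E → E} (hf : Differentiable ℂ f) (hg : Differentiable ℂ g) {z : E}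
    {s ε : ℝ} (hs : 0 < s) (h : ∀ w ∈ ball z s, ‖f w - g w‖ ≤ ε) :
    ‖fderiv ℂ f z - fderiv ℂ g z‖ ≤ 2 * ε / s := by
  have h1 : fderiv ℂ (fun w => f w - g w) z = fderiv ℂ f z - fderiv ℂ g z :=
    fderiv_fun_sub (hf z) (hg z)
  rw [← h1]
  refine Complex.norm_fderiv_le_div_of_mapsTo_ball (hf.sub hg).differentiableOn (fun w hw => ?_) hs
  rw [mem_closedBall, dist_eq_norm]
  calc _ ≤ ‖f w - g w‖ + ‖f z - g z‖ := norm_sub_le _ _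
    _ ≤ 2 * ε := by linarith [h w hw, h z (mem_ball_self hs)]

lemma exists_limit_of_geometric [FiniteDimensional ℂ E] {Φ : ℕ → E → E} {r : ℕ → ℝ}
    (hΦ : ∀ b, Differentiable ℂ (Φ b))
    (hdet : ∀ b z, (fderiv ℂ (Φ b) z).det = 1) (hr : Monotone r) (hr1 : Tendsto r atTop (𝓝 1))
    (hlt : ∀ b, r b < 1)
    (hstep : ∀ b, ∀ z ∈ closedBall (0 : E) (r b), ‖Φ (b + 1) z - Φ b z‖ ≤ (1 / 2) ^ b) :
    ∃ F : E → E, DifferentiableOn ℂ F (ball 0 1) ∧ (∀ z ∈ ball 0 1, (fderiv ℂ F z).det = 1) ∧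
      ∀ b, ∀ z ∈ closedBall (0 : E) (r b), ‖F z - Φ b z‖ ≤ 2 * (1 / 2) ^ b := by
  have : CompleteSpace E := FiniteDimensional.complete ℂ E
  have hex : ∀ s < 1, ∃ b, s < r b := fun s hs => (hr1.eventually (lt_mem_nhds hs)).exists
  have hgeo : ∀ b, ∀ z ∈ closedBall (0 : E) (r b), ∀ k,
      dist (Φ (b + k) z) (Φ (b + (k + 1)) z) ≤ (1 / 2) ^ b * (1 / 2) ^ k := by
    intro b z hz k
    rw [dist_comm, dist_eq_norm, ← pow_add, ← add_assoc]
    exact hstep _ z (closedBall_subset_closedBall (hr (Nat.le_add_right b k)) hz)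
  have hlim : ∀ z : E, ∃ y, z ∈ ball (0 : E) 1 → Tendsto (fun b => Φ b z) atTop (𝓝 y) := by
    intro z
    by_cases hz : z ∈ ball (0 : E) 1
    · obtain ⟨b, hb⟩ := hex ‖z‖ (by simpa using hz)
      obtain ⟨y, hy⟩ := cauchySeq_tendsto_of_complete (cauchySeq_of_le_geometric (1 / 2) _
        (by norm_num) (hgeo b z (by simpa using hb.le)))
      refine ⟨y, fun _ => (tendsto_add_atTop_iff_nat b).1 ?_⟩
      simpa [add_comm] using hy
    · exact ⟨0, fun h => absurd h hz⟩
  choose F hF using hlim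
  have hderiv : ∀ z ∈ ball (0 : E) 1, ∃ F' : E →L[ℂ] E, HasFDerivAt F F' z ∧ F'.det = 1 := by
    intro x hx
    rw [mem_ball_zero_iff] at hx
    set s : ℝ := (1 - ‖x‖) / 4 with hs
    have hs0 : 0 < s := by linarith
    obtain ⟨b, hb⟩ := hex (‖x‖ + 2 * s) (by linarith)
    have hU : ∀ z ∈ ball x s, ∀ w ∈ ball z s, w ∈ closedBall (0 : E) (r b) := by
      intro z hz w hw
      rw [mem_ball, dist_eq_norm] at hz hw
      rw [mem_closedBall_zero_iff]
      have h1 := norm_sub_norm_le w z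
      have h2 := norm_sub_norm_le z x
      linarith
    have hD : ∀ z ∈ ball x s, ∀ k, dist (fderiv ℂ (Φ (b + k)) z) (fderiv ℂ (Φ (b + (k + 1))) z) ≤
        2 / s * (1 / 2) ^ k := by
      intro z hz k
      rw [dist_comm, dist_eq_norm]
      refine (norm_fderiv_sub_le_s18 (hΦ _) (hΦ _) hs0 (ε := (1 / 2) ^ k) fun w hw => ?_).trans_eq
        (by ring)
      have h1 := hgeo b w (hU z hz w hw) k
      rw [dist_comm, dist_eq_norm] at h1
      refine h1.trans (mul_le_of_le_one_left (by positivity) (pow_le_one₀ (by norm_num)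
        (by norm_num)))
    have hD' : ∀ z : E, ∃ y, z ∈ ball x s →
        Tendsto (fun k => fderiv ℂ (Φ (b + k)) z) atTop (𝓝 y) := by
      intro z
      by_cases hz : z ∈ ball x s
      · obtain ⟨y, hy⟩ := cauchySeq_tendsto_of_complete (cauchySeq_of_le_geometric (1 / 2) _
          (by norm_num) (hD z hz))
        exact ⟨y, fun _ => hy⟩
      · exact ⟨0, fun h => absurd h hz⟩
    choose G hG using hD'
    have hunif : TendstoUniformlyOn (fun k z => fderiv ℂ (Φ (b + k)) z) G atTop (ball x s) := by
      rw [Metric.tendstoUniformlyOn_iff]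
      intro ε hε
      have h0 : Tendsto (fun k : ℕ => 2 / s * (1 / 2) ^ k / (1 - 1 / 2)) atTop (𝓝 0) := by
        have := ((tendsto_pow_atTop_nhds_zero_of_lt_one (r := (1 / 2 : ℝ)) (by norm_num)
          (by norm_num)).const_mul (2 / s)).div_const (1 - 1 / 2)
        simpa using this
      filter_upwards [h0.eventually_lt_const hε] with k hk z hz
      rw [dist_comm]
      exact (dist_le_of_le_geometric_of_tendsto (1 / 2) _ (by norm_num) (hD z hz) (hG z hz)
        k).trans_lt hk
    have hsub : ∀ z ∈ ball x s, z ∈ ball (0 : E) 1 := by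
      intro z hz
      have := hU z hz z (mem_ball_self hs0)
      rw [mem_closedBall_zero_iff] at this
      rw [mem_ball_zero_iff]
      exact this.trans_lt (hlt b)
    have hxs := mem_ball_self hs0 (x := x)
    refine ⟨G x, hasFDerivAt_of_tendstoUniformlyOn isOpen_ball hunif
      (fun k z _ => (hΦ _ z).hasFDerivAt) (fun z hz => ?_) hxs, ?_⟩
    · have := (tendsto_add_atTop_iff_nat b).2 (hF z (hsub z hz))
      simpa [add_comm] using this
    · have h1 := (ContinuousLinearMap.continuous_det.tendsto (G x)).comp (hG x hxs)
      refine tendsto_nhds_unique h1 ?_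
      simp [Function.comp_def, hdet]
  refine ⟨F, fun z hz => ?_, fun z hz => ?_, fun b z hz => ?_⟩
  · obtain ⟨F', h, -⟩ := hderiv z hz
    exact h.differentiableAt.differentiableWithinAt
  · obtain ⟨F', h, h1⟩ := hderiv z hz
    rwa [h.fderiv]
  · have hz1 : z ∈ ball (0 : E) 1 := closedBall_subset_ball (hlt b) hz
    have h1 : Tendsto (fun k => Φ (b + k) z) atTop (𝓝 (F z)) := by
      have := (tendsto_add_atTop_iff_nat b).2 (hF z hz1)
      simpa [add_comm] using this
    have h2 := dist_le_of_le_geometric_of_tendsto₀ (1 / 2) _ (by norm_num) (hgeo b z hz) h1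
    rw [add_zero, dist_comm, dist_eq_norm] at h2
    exact h2.trans_eq (by ring)

end Limit

section Nets

variable {E : Type*} [NormedAddCommGroup E]

lemma IsCompact.exists_separated_net {s : Set E} (hs : IsCompact s) {a : ℝ} (ha : 0 < a) :
    ∃ N : Finset E, (∀ p ∈ N, p ∈ s) ∧ (∀ p ∈ N, ∀ q ∈ N, p ≠ q → 4 * a ≤ ‖p - q‖) ∧
      ∀ x ∈ s, ∃ p ∈ N, ‖x - p‖ ≤ 5 * a := by
  classical
  obtain ⟨t, hts, htf, htc⟩ := hs.finite_cover_balls ha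
  obtain ⟨N, hN⟩ := (htf.toFinset.powerset.filter fun N : Finset E =>
    ∀ p ∈ N, ∀ q ∈ N, p ≠ q → 4 * a ≤ ‖p - q‖).exists_maximal ⟨∅, by simp⟩
  have hmem := hN.prop
  rw [Finset.mem_filter, Finset.mem_powerset] at hmem
  obtain ⟨hNt, hsep⟩ := hmem
  refine ⟨N, fun p hp => hts (by simpa using hNt hp), hsep, fun x hx => ?_⟩
  obtain ⟨y, hyt, hy⟩ := Set.mem_iUnion₂.1 (htc hx)
  rw [mem_ball, dist_eq_norm] at hy
  suffices h : ∃ p ∈ N, ‖y - p‖ < 4 * a by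
    obtain ⟨p, hp, hyp⟩ := h
    exact ⟨p, hp, by linarith [norm_sub_le_norm_sub_add_norm_sub x y p]⟩
  by_contra! hcon
  have hins : insert y N ∈ htf.toFinset.powerset.filter fun N : Finset E =>
      ∀ p ∈ N, ∀ q ∈ N, p ≠ q → 4 * a ≤ ‖p - q‖ := by
    rw [Finset.mem_filter, Finset.mem_powerset]
    refine ⟨Finset.insert_subset (by simpa using hyt) hNt, fun p hp q hq hpq => ?_⟩
    rcases Finset.mem_insert.1 hp with rfl | hpN <;>
      rcases Finset.mem_insert.1 hq with rfl | hqN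
    · exact absurd rfl hpq
    · exact hcon q hqN
    · rw [norm_sub_rev]; exact hcon p hpN
    · exact hsep p hpN q hqN hpq
  have := hcon y (hN.le_of_ge hins (Finset.subset_insert y N) (Finset.mem_insert_self y N))
  rw [sub_self, norm_zero] at this
  linarith

lemma norm_inv_norm_smul_sub_self [NormedSpace ℂ E] {y : E} (hy : y ≠ 0) :
    ‖((‖y‖⁻¹ : ℝ) : ℂ) • y - y‖ = |‖y‖ - 1| := by
  have hy' : ‖y‖ ≠ 0 := norm_ne_zero_iff.2 hy
  have h1 : ((‖y‖⁻¹ : ℝ) : ℂ) • y - y = ((‖y‖⁻¹ - 1 : ℝ) : ℂ) • y := by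
    push_cast; rw [sub_smul, one_smul]
  rw [h1, norm_smul, Complex.norm_real, Real.norm_eq_abs, ← abs_norm y, ← abs_mul, abs_norm,
    sub_mul, inv_mul_cancel₀ hy', one_mul, abs_sub_comm]

variable (E) in
/-- At every scale the unit sphere has a net splitting into a number of well separated families
that does not depend on the scale. -/
lemma exists_separated_families [NormedSpace ℂ E] [ProperSpace E] :
    ∃ M : ℕ, ∀ a : ℝ, 0 < a → a ≤ 1 → ∃ U : ℕ → Finset E,
      (∀ j, ∀ u ∈ U j, ‖u‖ = 1) ∧
      (∀ j, ∀ u ∈ U j, ∀ u' ∈ U j, u ≠ u' → 3 * a < ‖u - u'‖) ∧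
      ∀ x : E, ‖x‖ = 1 → ∃ j < M, ∃ u ∈ U j, ‖x - u‖ ≤ a / 2 := by
  classical
  obtain ⟨t, -, htf, htc⟩ := (isCompact_closedBall (0 : E) 5).finite_cover_balls
    (e := 1 / 4) (by norm_num)
  refine ⟨htf.toFinset.toList.length, fun a ha ha1 => ?_⟩
  set w : ℕ → E := fun j => htf.toFinset.toList.getD j 0 with hw
  obtain ⟨N, hN1, hN2, hN3⟩ := (isCompact_sphere (0 : E) 1).exists_separated_net ha
  have haC : ‖(a : ℂ)‖ = a := by rw [Complex.norm_real, Real.norm_of_nonneg ha.le]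
  set φ : ℕ → E → E := fun j p => p + (a : ℂ) • w j with hφ
  have hU : ∀ j u, u ∈ ((N.filter fun p => |‖φ j p‖ - 1| ≤ a / 4).image
      fun p => ((‖φ j p‖⁻¹ : ℝ) : ℂ) • φ j p) ↔
      ∃ p ∈ N, |‖φ j p‖ - 1| ≤ a / 4 ∧ ((‖φ j p‖⁻¹ : ℝ) : ℂ) • φ j p = u := by
    intro j u
    simp only [Finset.mem_image, Finset.mem_filter, and_assoc]
  have hne : ∀ y : E, |‖y‖ - 1| ≤ a / 4 → y ≠ 0 := by
    rintro y hy rfl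
    rw [norm_zero] at hy
    norm_num at hy
    linarith
  refine ⟨fun j => (N.filter fun p => |‖φ j p‖ - 1| ≤ a / 4).image
    fun p => ((‖φ j p‖⁻¹ : ℝ) : ℂ) • φ j p, fun j u hu => ?_, fun j u hu u' hu' huu => ?_,
    fun x hx => ?_⟩
  · obtain ⟨p, -, hp, rfl⟩ := (hU j u).1 hu
    rw [norm_smul, Complex.norm_real, Real.norm_of_nonneg (by positivity),
      inv_mul_cancel₀ (norm_ne_zero_iff.2 (hne _ hp))]
  · obtain ⟨p, hpN, hp, rfl⟩ := (hU j u).1 hu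
    obtain ⟨p', hpN', hp', rfl⟩ := (hU j u').1 hu'
    have hpp : p ≠ p' := by rintro rfl; exact huu rfl
    have h1 := hN2 p hpN p' hpN' hpp
    have h2 := norm_inv_norm_smul_sub_self (hne _ hp)
    have h3 := norm_inv_norm_smul_sub_self (hne _ hp')
    have h4 : φ j p - φ j p' = p - p' := by simp [hφ]
    set v := ((‖φ j p‖⁻¹ : ℝ) : ℂ) • φ j p
    set v' := ((‖φ j p'‖⁻¹ : ℝ) : ℂ) • φ j p'
    have h5 : p - p' = (v - v') - (v - φ j p) + (v' - φ j p') := by rw [← h4]; abel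
    have h6 := norm_add_le ((v - v') - (v - φ j p)) (v' - φ j p')
    have h7 := norm_sub_le (v - v') (v - φ j p)
    rw [← h5] at h6
    linarith
  · obtain ⟨p, hpN, hxp⟩ := hN3 x (by simpa using hx)
    have hmem : ((a⁻¹ : ℝ) : ℂ) • (x - p) ∈ closedBall (0 : E) 5 := by
      rw [mem_closedBall_zero_iff, norm_smul, Complex.norm_real,
        Real.norm_of_nonneg (by positivity), inv_mul_le_iff₀ ha]
      linarith
    obtain ⟨y, hyt, hy⟩ := Set.mem_iUnion₂.1 (htc hmem)
    obtain ⟨j, hj, hjy⟩ := List.mem_iff_getElem.1 (Finset.mem_toList.2 (htf.mem_toFinset.2 hyt))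
    have hwj : w j = y := (List.getD_eq_getElem _ _ hj).trans hjy
    have hclose : ‖x - φ j p‖ ≤ a / 4 := by
      have h1 : x - φ j p = (a : ℂ) • (((a⁻¹ : ℝ) : ℂ) • (x - p) - y) := by
        rw [smul_sub, smul_smul, ← Complex.ofReal_mul, mul_inv_cancel₀ ha.ne', hφ]
        simp [hwj, sub_sub]
      rw [mem_ball, dist_eq_norm] at hy
      rw [h1, norm_smul, haC]
      nlinarith
    have hnorm : |‖φ j p‖ - 1| ≤ a / 4 := by
      rw [← hx, abs_sub_comm]
      exact (abs_norm_sub_norm_le _ _).trans hclose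
    refine ⟨j, hj, _, (hU j _).2 ⟨p, hpN, hnorm, rfl⟩, ?_⟩
    have h1 := norm_inv_norm_smul_sub_self (hne _ hnorm)
    have h2 := norm_sub_le_norm_sub_add_norm_sub x (φ j p) (((‖φ j p‖⁻¹ : ℝ) : ℂ) • φ j p)
    rw [norm_sub_rev (φ j p)] at h2
    linarith

end Nets

section Caps

variable {E : Type*} [NormedAddCommGroup E] [InnerProductSpace ℂ E]

/-- The part of the closed ball of radius `R` cut off by the real hyperplane orthogonal to `u` at
height `r`. -/
def cap (u : E) (r R : ℝ) : Set E := {z | ‖z‖ ≤ R ∧ r ≤ (inner ℂ u z).re}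

lemma isCompact_cap [ProperSpace E] (u : E) (r R : ℝ) : IsCompact (cap u r R) := by
  have h : cap u r R = closedBall 0 R ∩ {z | r ≤ (inner ℂ u z).re} := by
    ext z; simp [cap]
  rw [h]
  exact (isCompact_closedBall _ _).inter_right (isClosed_le (by fun_prop) (by fun_prop))

lemma re_inner_le_norm_of_norm_eq_one {u : E} (hu : ‖u‖ = 1) (z : E) :
    (inner ℂ u z).re ≤ ‖z‖ := by
  have := re_inner_le_norm (𝕜 := ℂ) u z
  rwa [hu, one_mul] at this

lemma re_inner_lt_of_mem_cap {u u' z : E} (hu : ‖u‖ = 1) (hu' : ‖u'‖ = 1) {r R a : ℝ} (ha : 0 < a)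
    (hr : 0 < r) (hR : 1 / 2 ≤ R) (haR : a ^ 2 = 2 * (R - r)) (huu : 3 * a < ‖u - u'‖)
    (hz : z ∈ cap u r R) : (inner ℂ u' z).re < r := by
  by_contra! hcon
  obtain ⟨hzR, hzu⟩ := hz
  have h1 : 2 * r ≤ ‖u + u'‖ * R := by
    have h2 := re_inner_le_norm (𝕜 := ℂ) (u + u') z
    rw [inner_add_left, map_add] at h2
    simp only [RCLike.re_to_complex] at h2
    have : ‖u + u'‖ * ‖z‖ ≤ ‖u + u'‖ * R := by gcongr
    linarith
  have h2 := parallelogram_law_with_norm ℂ u u'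
  rw [hu, hu'] at h2
  have h3 : (2 * r) ^ 2 ≤ (‖u + u'‖ * R) ^ 2 := by gcongr
  have h4 : (3 * a) ^ 2 < ‖u - u'‖ ^ 2 := by gcongr
  have h5 : ‖u + u'‖ ^ 2 < 4 - 9 * a ^ 2 := by nlinarith
  have h6 : 4 * r ^ 2 ≤ (4 - 9 * a ^ 2) * R ^ 2 := by nlinarith [sq_nonneg R]
  have h7 : 9 * a ^ 2 * R ^ 2 ≤ 2 * a ^ 2 * (R + r) := by nlinarith
  have hrR : r < R := by nlinarith [sq_pos_of_pos ha]
  have h8 : 9 * R ^ 2 ≤ 2 * (R + r) := by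
    have := sq_pos_of_pos ha
    nlinarith
  nlinarith

lemma mem_cap_of_near {u y z : E} (hu : ‖u‖ = 1) {r R a : ℝ} (hR : 1 / 2 ≤ R)
    (haR : a ^ 2 = 2 * (R - r)) (hz : ‖z‖ = R) (hy : ‖y - (‖y‖ : ℂ) • u‖ ≤ a / 2)
    (hyz : ‖z - y‖ ≤ a / 16) : z ∈ cap u r R := by
  refine ⟨hz.le, ?_⟩
  have h1 : ‖z - (R : ℂ) • u‖ ≤ 5 / 8 * a := by
    have h2 : z - (R : ℂ) • u = (z - y) + (y - (‖y‖ : ℂ) • u) + ((‖y‖ - R : ℝ) : ℂ) • u := by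
      push_cast; rw [sub_smul]; abel
    have h3 : ‖((‖y‖ - R : ℝ) : ℂ) • u‖ ≤ a / 16 := by
      rw [norm_smul, hu, mul_one, Complex.norm_real, Real.norm_eq_abs, ← hz, abs_sub_comm]
      exact (abs_norm_sub_norm_le _ _).trans hyz
    rw [h2]
    exact (norm_add₃_le).trans (by linarith)
  have h2 : ‖z - (R : ℂ) • u‖ ^ 2 = 2 * R ^ 2 - 2 * R * (inner ℂ u z).re := by
    have hsym : (inner ℂ z u).re = (inner ℂ u z).re := by
      rw [← inner_conj_symm, Complex.conj_re]
    rw [norm_sub_sq (𝕜 := ℂ), hz, norm_smul, hu, inner_smul_right, Complex.norm_real,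
      Real.norm_of_nonneg (by linarith), RCLike.re_to_complex, Complex.re_ofReal_mul, hsym]
    ring
  have h3 : ‖z - (R : ℂ) • u‖ ^ 2 ≤ (5 / 8 * a) ^ 2 := by gcongr
  have h4 : R * (2 * R - 2 * (inner ℂ u z).re) ≤ R * (2 * (R - r)) := by nlinarith
  have := le_of_mul_le_mul_left h4 (by linarith)
  linarith

end Caps

section Labyrinth

/-- The inner radius of the `b`-th shell of the unit ball. -/
def shellRadius (b : ℕ) : ℝ := (b + 1) / (b + 2)

/-- The distance of consecutive layers when the `b`-th shell is divided into `2 * M` layers. -/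
def layerGap (M b : ℕ) : ℝ := 1 / ((b + 2) * (b + 3) * (2 * M))

/-- The radius of the `i`-th layer of the `b`-th shell. -/
def layerRadius (M b i : ℕ) : ℝ := shellRadius b + i * layerGap M b

/-- The half chord of a cap whose height is the distance of consecutive layers. -/
def netScale (M b : ℕ) : ℝ := √(2 * layerGap M b)

lemma shellRadius_lt_one (b : ℕ) : shellRadius b < 1 := by
  rw [shellRadius, div_lt_one (by positivity)]
  linarith

lemma half_le_shellRadius (b : ℕ) : 1 / 2 ≤ shellRadius b := by
  rw [shellRadius, div_le_div_iff₀ (by positivity) (by positivity)]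
  have : (0 : ℝ) ≤ b := b.cast_nonneg
  linarith

lemma tendsto_shellRadius : Tendsto shellRadius atTop (𝓝 1) := by
  have h := (tendsto_natCast_div_add_atTop (𝕜 := ℝ) (1 : ℝ)).comp (tendsto_add_atTop_nat 1)
  refine h.congr fun b => ?_
  simp only [Function.comp, shellRadius]
  push_cast
  ring

lemma layerGap_pos {M : ℕ} (hM : 0 < M) (b : ℕ) : 0 < layerGap M b := by
  have : (0 : ℝ) < M := by exact_mod_cast hM
  rw [layerGap]; positivity

lemma layerRadius_two_mul {M : ℕ} (hM : 0 < M) (b : ℕ) :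
    layerRadius M b (2 * M) = shellRadius (b + 1) := by
  have : (0 : ℝ) < M := by exact_mod_cast hM
  have : (0 : ℝ) ≤ b := b.cast_nonneg
  rw [layerRadius, shellRadius, shellRadius, layerGap]
  push_cast
  field_simp
  ring

lemma layerRadius_strictMono {M : ℕ} (hM : 0 < M) (b : ℕ) : StrictMono (layerRadius M b) := by
  intro i j hij
  have h := layerGap_pos hM b
  have : (i : ℝ) < j := by exact_mod_cast hij
  unfold layerRadius
  gcongr

lemma shellRadius_le_layerRadius {M : ℕ} (hM : 0 < M) (b i : ℕ) :
    shellRadius b ≤ layerRadius M b i := by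
  have h := (layerRadius_strictMono hM b).monotone i.zero_le
  simpa [layerRadius] using h

lemma shellRadius_monotone : Monotone shellRadius :=
  monotone_nat_of_le_succ fun b =>
    (shellRadius_le_layerRadius one_pos b _).trans_eq (layerRadius_two_mul one_pos b)

lemma netScale_pos {M : ℕ} (hM : 0 < M) (b : ℕ) : 0 < netScale M b :=
  Real.sqrt_pos.2 (by linarith [layerGap_pos hM b])

lemma netScale_sq {M : ℕ} (hM : 0 < M) (b i : ℕ) :
    netScale M b ^ 2 = 2 * (layerRadius M b (i + 1) - layerRadius M b i) := by
  rw [netScale, Real.sq_sqrt (by linarith [layerGap_pos hM b]), layerRadius, layerRadius]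
  push_cast
  ring

lemma inv_le_netScale {M : ℕ} (hM : 0 < M) (b : ℕ) :
    (M : ℝ)⁻¹ * (1 / ((b + 3 : ℕ) : ℝ)) ≤ netScale M b := by
  have h0 : (1 : ℝ) ≤ M := by exact_mod_cast hM
  have h1 : (0 : ℝ) ≤ b := b.cast_nonneg
  refine Real.le_sqrt_of_sq_le ?_
  rw [layerGap]
  push_cast
  have h2 : ((M : ℝ)⁻¹ * (1 / (b + 3))) ^ 2 = 1 / (M ^ 2 * (b + 3) ^ 2) := by
    field_simp
  have h3 : (2 : ℝ) * (1 / ((b + 2) * (b + 3) * (2 * M))) = 1 / (M * ((b + 2) * (b + 3))) := by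
    field_simp
  rw [h2, h3]
  gcongr
  · nlinarith
  · nlinarith

lemma netScale_le_one {M : ℕ} (hM : 0 < M) (b : ℕ) : netScale M b ≤ 1 := by
  have h0 : (1 : ℝ) ≤ M := by exact_mod_cast hM
  have h1 : (0 : ℝ) ≤ b := b.cast_nonneg
  rw [netScale, Real.sqrt_le_one, layerGap, ← mul_div_assoc, div_le_one (by positivity)]
  have : (1 : ℝ) ≤ (b + 2) * (b + 3) := by nlinarith
  nlinarith

variable {E : Type*} [NormedAddCommGroup E] [InnerProductSpace ℂ E]

/-- The cap in direction `u` spanning the `j`-th pair of layers of the `b`-th shell. -/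
def layerCap (M b j : ℕ) (u : E) : Set E :=
  cap u (layerRadius M b (2 * j + 1)) (layerRadius M b (2 * j + 2))

lemma layerCap_subset_closedBall {M : ℕ} (b : ℕ) {j : ℕ} (hj : j < M) (u : E) :
    layerCap M b j u ⊆ closedBall 0 (shellRadius (b + 1)) := by
  intro z hz
  have hM : 0 < M := by omega
  rw [mem_closedBall_zero_iff, ← layerRadius_two_mul hM]
  exact hz.1.trans ((layerRadius_strictMono hM b).monotone (by omega))

variable [FiniteDimensional ℂ E]

lemma IsAdmissible.exists_of_shell {p : E →L[ℂ] ℂ} {Φ : E → E} (hE : 2 ≤ Module.finrank ℂ E)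
    (hΦ : IsAdmissible p Φ) {M : ℕ} (hM : 0 < M) (b : ℕ) {U : ℕ → Finset E}
    (hU : ∀ j, ∀ u ∈ U j, ‖u‖ = 1)
    (hUU : ∀ j, ∀ u ∈ U j, ∀ u' ∈ U j, u ≠ u' → 3 * netScale M b < ‖u - u'‖)
    {ε : ℝ} (hε : 0 < ε) (T : ℝ) :
    ∃ Ψ, IsAdmissible p Ψ ∧ (∀ z ∈ closedBall 0 (shellRadius b), ‖Ψ z - Φ z‖ < ε) ∧
      ∀ j < M, ∀ u ∈ U j, ∀ z ∈ layerCap M b j u, T < ‖p (Ψ z)‖ := by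
  have : ProperSpace E := FiniteDimensional.proper ℂ E
  have hmono := layerRadius_strictMono hM b
  have hhalf : ∀ i, 1 / 2 ≤ layerRadius M b i := fun i =>
    (half_le_shellRadius b).trans (shellRadius_le_layerRadius hM b i)
  suffices h : ∃ Ψ, IsAdmissible p Ψ ∧ (∀ z ∈ closedBall 0 (shellRadius b), ‖Ψ z - Φ z‖ < ε) ∧
      ∀ i ∈ (Finset.range M).sigma U, ∀ z ∈ layerCap M b i.1 i.2, T < ‖p (Ψ z)‖ by
    obtain ⟨Ψ, h1, h2, h3⟩ := h
    exact ⟨Ψ, h1, h2, fun j hj u hu => h3 ⟨j, u⟩ (by simp [hj, hu])⟩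
  refine hΦ.exists_of_finset hE (isCompact_closedBall 0 (shellRadius b))
    (fun i : (_ : ℕ) × E => i.1) (fun i => layerCap M b i.1 i.2) (fun i => innerSL ℂ i.2)
    (fun i => layerRadius M b (2 * i.1 + 1)) _ ?_ ?_ ?_ ?_ ?_ hε T
  all_goals simp only [Finset.mem_sigma, Finset.mem_range]
  · rintro ⟨j, u⟩ ⟨-, hu⟩ h
    have := congrArg norm h
    rw [innerSL_apply_norm, hU j u hu, norm_zero] at this
    exact one_ne_zero this
  · rintro ⟨j, u⟩ -
    exact isCompact_cap _ _ _
  · rintro ⟨j, u⟩ - z hz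
    exact hz.2
  · rintro ⟨j, u⟩ ⟨-, hu⟩ z hz
    rw [mem_closedBall_zero_iff] at hz
    refine ((re_inner_le_norm_of_norm_eq_one (hU j u hu) z).trans hz).trans_lt ?_
    have := hmono (Nat.succ_pos (2 * j))
    simpa [layerRadius] using this
  · rintro ⟨j, u⟩ ⟨-, hu⟩ ⟨j', u'⟩ ⟨-, hu'⟩ hne hjj z hz
    rcases hjj.lt_or_eq with hlt | heq
    · refine ((re_inner_le_norm_of_norm_eq_one (hU j' u' hu') z).trans hz.1).trans_lt ?_
      exact hmono (by simp only at hlt ⊢; omega)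
    · obtain rfl : j = j' := heq
      have huu : u ≠ u' := fun h => hne (by rw [h])
      exact re_inner_lt_of_mem_cap (hU j u hu) (hU j u' hu') (netScale_pos hM b)
        (by linarith [hhalf (2 * j + 1)]) (hhalf _) (netScale_sq hM b _) (hUU j u hu u' hu' huu) hz

/-- There is a volume preserving holomorphic map on the ball whose image under a given functional is
large on a labyrinth of caps accumulating at the sphere. -/
lemma exists_large_on_labyrinth {p : E →L[ℂ] ℂ} (hE : 2 ≤ Module.finrank ℂ E) (hp : p ≠ 0) :
    ∃ M : ℕ, 0 < M ∧ ∃ U : ℕ → ℕ → Finset E, ∃ F : E → E,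
      DifferentiableOn ℂ F (ball 0 1) ∧ (∀ z ∈ ball (0 : E) 1, (fderiv ℂ F z).det = 1) ∧
      (∀ b j, ∀ u ∈ U b j, ‖u‖ = 1) ∧
      (∀ b, ∀ x : E, ‖x‖ = 1 → ∃ j < M, ∃ u ∈ U b j, ‖x - u‖ ≤ netScale M b / 2) ∧
      ∀ b, ∀ j < M, ∀ u ∈ U b j, ∀ z ∈ layerCap M b j u, b ≤ ‖p (F z)‖ := by
  have : ProperSpace E := FiniteDimensional.proper ℂ E
  have : Nontrivial E := Module.nontrivial_of_finrank_pos (R := ℂ) (by omega)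
  obtain ⟨M, h⟩ := exists_separated_families E
  have hM : 0 < M := by
    obtain ⟨U, -, -, hU⟩ := h 1 one_pos le_rfl
    obtain ⟨x, hx⟩ := exists_norm_eq E zero_le_one
    obtain ⟨j, hj, -⟩ := hU x hx
    omega
  choose U hU hUU hUc using fun b => h (netScale M b) (netScale_pos hM b) (netScale_le_one hM b)
  choose! S hS hSclose hSlarge using fun (b : ℕ) (Φ : E → E) (hΦ : IsAdmissible p Φ) =>
    hΦ.exists_of_shell hE hM b (hU b) (hUU b) (ε := (1 / 2) ^ b) (by positivity) (b + ‖p‖)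
  let Φ : ℕ → E → E := fun b => Nat.rec (fun x => x) S b
  have hΦ : ∀ b, IsAdmissible p (Φ b) := fun b =>
    Nat.rec (IsAdmissible.id hp) (fun b ih => hS b (Φ b) ih) b
  obtain ⟨F, hF, hdet, hclose⟩ := exists_limit_of_geometric (fun b => (hΦ b).differentiable)
    (fun b => (hΦ b).det_fderiv) shellRadius_monotone tendsto_shellRadius shellRadius_lt_one
    (fun b z hz => (hSclose b (Φ b) (hΦ b) z hz).le)
  refine ⟨M, hM, U, F, hF, hdet, hU, hUc, fun b j hj u hu z hz => ?_⟩
  have h1 : (b : ℝ) + ‖p‖ < ‖p (Φ (b + 1) z)‖ := hSlarge b (Φ b) (hΦ b) j hj u hu z hz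
  have h2 : ‖F z - Φ (b + 1) z‖ ≤ 1 := by
    refine (hclose (b + 1) z (layerCap_subset_closedBall b hj u hz)).trans ?_
    rw [pow_succ]
    have : ((1 : ℝ) / 2) ^ b ≤ 1 := pow_le_one₀ (by norm_num) (by norm_num)
    linarith
  have h3 : ‖p (Φ (b + 1) z) - p (F z)‖ ≤ ‖p‖ := by
    rw [← map_sub, ← norm_neg, ← map_neg, neg_sub]
    exact (p.le_opNorm _).trans (mul_le_of_le_one_right (norm_nonneg _) h2)
  linarith [norm_sub_norm_le (p (Φ (b + 1) z)) (p (F z))]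

end Labyrinth

section Length

variable {E : Type*} [NormedAddCommGroup E]

lemma exists_norm_eq_of_divergent {γ : ℝ → E} (hγ : ContinuousOn γ (Set.Ico 0 1))
    (hlim : Tendsto (fun t => ‖γ t‖) (𝓝[<] 1) (𝓝 1)) {s : ℝ} (hs : s ∈ Set.Ico (0 : ℝ) 1)
    {ρ : ℝ} (hsρ : ‖γ s‖ ≤ ρ) (hρ : ρ < 1) : ∃ t ∈ Set.Ico s 1, ‖γ t‖ = ρ := by
  obtain ⟨t, hρt, hst⟩ :=
    ((hlim.eventually (lt_mem_nhds hρ)).and (Ioo_mem_nhdsLT hs.2)).exists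
  have hsub : Set.Icc s t ⊆ Set.Ico 0 1 := fun x hx => ⟨hs.1.trans hx.1, hx.2.trans_lt hst.2⟩
  obtain ⟨x, hx, hxρ⟩ :=
    intermediate_value_Icc hst.1.le (hγ.norm.mono hsub) ⟨hsρ, hρt.le⟩
  exact ⟨x, ⟨hx.1, hx.2.trans_lt hst.2⟩, hxρ⟩

/-- A divergent path that crosses a shell while avoiding its caps is not too short there. -/
lemma exists_shell_crossing [InnerProductSpace ℂ E] {γ : ℝ → E}
    (hγ : ContinuousOn γ (Set.Ico 0 1)) (hlim : Tendsto (fun t => ‖γ t‖) (𝓝[<] 1) (𝓝 1))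
    {M : ℕ} (hM : 0 < M) {b : ℕ} {U : ℕ → Finset E} (hU : ∀ j, ∀ u ∈ U j, ‖u‖ = 1)
    (hUc : ∀ x : E, ‖x‖ = 1 → ∃ j < M, ∃ u ∈ U j, ‖x - u‖ ≤ netScale M b / 2)
    (havoid : ∀ t ∈ Set.Ico (0 : ℝ) 1, ∀ j < M, ∀ u ∈ U j, γ t ∉ layerCap M b j u)
    {s : ℝ} (hs : s ∈ Set.Ico (0 : ℝ) 1) (hγs : ‖γ s‖ = shellRadius b) :
    ∃ s' ∈ Set.Ico s 1, ‖γ s'‖ = shellRadius (b + 1) ∧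
      ENNReal.ofReal (netScale M b / 16) ≤ eVariationOn γ (Set.Icc s s') := by
  obtain ⟨s', hs', hγs'⟩ := exists_norm_eq_of_divergent hγ hlim hs
    (hγs.le.trans (shellRadius_monotone b.le_succ)) (shellRadius_lt_one (b + 1))
  refine ⟨s', hs', hγs', ?_⟩
  by_contra! hcon
  have hpos : 0 < ‖γ s‖ := by linarith [half_le_shellRadius b]
  have hne : (‖γ s‖ : ℂ) ≠ 0 := by exact_mod_cast hpos.ne'
  obtain ⟨j, hj, u, hu, hxu⟩ := hUc ((‖γ s‖ : ℂ)⁻¹ • γ s) (by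
    rw [norm_smul, norm_inv, Complex.norm_real, norm_norm, inv_mul_cancel₀ hpos.ne'])
  have hsub : Set.Icc s s' ⊆ Set.Ico 0 1 := fun x hx => ⟨hs.1.trans hx.1, hx.2.trans_lt hs'.2⟩
  have hmono := (layerRadius_strictMono hM b).monotone
  obtain ⟨t, ht, htρ⟩ := intermediate_value_Icc hs'.1 (hγ.norm.mono hsub)
    (show layerRadius M b (2 * j + 2) ∈ Set.Icc ‖γ s‖ ‖γ s'‖ from
      ⟨hγs.le.trans (shellRadius_le_layerRadius hM b _),
        (hmono (by omega)).trans_eq ((layerRadius_two_mul hM b).trans hγs'.symm)⟩)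
  refine havoid t (hsub ht) j hj u hu (mem_cap_of_near (y := γ s) (hU j u hu)
    ((half_le_shellRadius b).trans (shellRadius_le_layerRadius hM b _)) (netScale_sq hM b _)
    htρ ?_ ?_)
  · have h1 : γ s - (‖γ s‖ : ℂ) • u = (‖γ s‖ : ℂ) • ((‖γ s‖ : ℂ)⁻¹ • γ s - u) := by
      rw [smul_sub, smul_inv_smul₀ hne]
    rw [h1, norm_smul, Complex.norm_real, norm_norm]
    exact (mul_le_of_le_one_left (norm_nonneg _)
      (hγs.le.trans (shellRadius_lt_one b).le)).trans hxu
  · have h1 := (eVariationOn.edist_le γ ht (Set.left_mem_Icc.2 hs'.1)).trans_lt hcon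
    rw [edist_dist, dist_eq_norm] at h1
    exact ((ENNReal.ofReal_lt_ofReal_iff_of_nonneg (norm_nonneg _)).1 h1).le

lemma not_summable_netScale {M : ℕ} (hM : 0 < M) (b₀ : ℕ) :
    ¬ Summable fun k => netScale M (b₀ + k) / 16 := by
  intro h
  have hM' : (0 : ℝ) < M := by exact_mod_cast hM
  have h1 : Summable fun k => netScale M (k + b₀) := by
    simpa [add_comm] using h.mul_right 16
  have h2 : Summable fun b : ℕ => (M : ℝ)⁻¹ * (1 / ((b + 3 : ℕ) : ℝ)) :=
    .of_nonneg_of_le (fun b => by positivity) (inv_le_netScale hM) ((summable_nat_add_iff b₀).1 h1)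
  rw [summable_mul_left_iff (inv_ne_zero hM'.ne')] at h2
  exact Real.not_summable_one_div_natCast
    ((summable_nat_add_iff (f := fun b : ℕ => 1 / (b : ℝ)) 3).1 h2)

/-- A divergent path avoiding all but finitely many caps of a labyrinth has infinite length. -/
lemma eVariationOn_eq_top_of_avoids [InnerProductSpace ℂ E] {γ : ℝ → E}
    (hγ : ContinuousOn γ (Set.Ico 0 1)) (hlim : Tendsto (fun t => ‖γ t‖) (𝓝[<] 1) (𝓝 1))
    (hγ0 : ‖γ 0‖ < 1) {M : ℕ} (hM : 0 < M) {U : ℕ → ℕ → Finset E}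
    (hU : ∀ b j, ∀ u ∈ U b j, ‖u‖ = 1)
    (hUc : ∀ b, ∀ x : E, ‖x‖ = 1 → ∃ j < M, ∃ u ∈ U b j, ‖x - u‖ ≤ netScale M b / 2)
    (havoid : ∀ᶠ b in atTop, ∀ t ∈ Set.Ico (0 : ℝ) 1, ∀ j < M, ∀ u ∈ U b j,
      γ t ∉ layerCap M b j u) :
    eVariationOn γ (Set.Ico (0 : ℝ) 1) = ⊤ := by
  obtain ⟨b₀, hb₀⟩ := eventually_atTop.1 (havoid.and (tendsto_shellRadius.eventually
    (lt_mem_nhds hγ0)))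
  obtain ⟨s₀, hs₀, hγs₀⟩ := exists_norm_eq_of_divergent hγ hlim ⟨le_rfl, one_pos⟩
    (hb₀ b₀ le_rfl).2.le (shellRadius_lt_one b₀)
  choose! S hS hSnorm hSvar using fun (k : ℕ) (s : ℝ)
    (h : s ∈ Set.Ico (0 : ℝ) 1 ∧ ‖γ s‖ = shellRadius (b₀ + k)) =>
    exists_shell_crossing hγ hlim hM (hU (b₀ + k)) (hUc (b₀ + k))
      (hb₀ (b₀ + k) (Nat.le_add_right _ _)).1 h.1 h.2
  let I : ℕ → ℝ := fun k => Nat.rec s₀ S k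
  have hI : ∀ k, I k ∈ Set.Ico (0 : ℝ) 1 ∧ ‖γ (I k)‖ = shellRadius (b₀ + k) := by
    intro k
    induction k with
    | zero => exact ⟨hs₀, hγs₀⟩
    | succ k ih =>
      have h := hS k (I k) ih
      exact ⟨⟨ih.1.1.trans h.1, h.2⟩, hSnorm k (I k) ih⟩
  have hmono : Monotone I := monotone_nat_of_le_succ fun k => (hS k (I k) (hI k)).1
  have hnonneg : ∀ k, 0 ≤ netScale M (b₀ + k) / 16 := fun k => by
    linarith [netScale_pos hM (b₀ + k)]
  have hle : ∀ n : ℕ, ENNReal.ofReal (∑ k ∈ Finset.range n, netScale M (b₀ + k) / 16) ≤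
      eVariationOn γ (Set.Ico (0 : ℝ) 1) := by
    intro n
    have hsub : Set.Icc (I 0) (I n) ⊆ Set.Ico 0 1 := fun x hx =>
      ⟨(hI 0).1.1.trans hx.1, hx.2.trans_lt (hI n).1.2⟩
    rw [ENNReal.ofReal_sum_of_nonneg fun k _ => hnonneg k]
    calc _ ≤ ∑ k ∈ Finset.range n, eVariationOn γ (Set.Icc (I k) (I (k + 1))) :=
          Finset.sum_le_sum fun k _ => hSvar k (I k) (hI k)
      _ = eVariationOn γ (Set.Icc (I 0) (I n)) := eVariationOn.sum' γ hmono
      _ ≤ _ := eVariationOn.mono γ hsub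
  have htop := (not_summable_iff_tendsto_nat_atTop_of_nonneg hnonneg).1
    (not_summable_netScale hM b₀)
  by_contra hne
  obtain ⟨n, hn⟩ := (htop.eventually_gt_atTop
    (eVariationOn γ (Set.Ico (0 : ℝ) 1)).toReal).exists
  exact absurd hn (not_lt.2 ((ENNReal.ofReal_le_iff_le_toReal hne).1 (hle n)))

end Length

/-- The ball of ℂⁿ admits a holomorphic submersion onto ℂ^q (1 ≤ q < n) all of whose fibres
are complete: every divergent path contained in a fibre has infinite Euclidean length. -/
theorem exists_submersion_of_ball_with_complete_fibres (q n : ℕ) (hq : 1 ≤ q) (hqn : q < n) :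
    ∃ f : EuclideanSpace ℂ (Fin n) → EuclideanSpace ℂ (Fin q),
      DifferentiableOn ℂ f (Metric.ball (0 : EuclideanSpace ℂ (Fin n)) 1) ∧
      (∀ z ∈ Metric.ball (0 : EuclideanSpace ℂ (Fin n)) 1,
        Function.Surjective (fderiv ℂ f z)) ∧
      ∀ γ : ℝ → EuclideanSpace ℂ (Fin n),
        ContinuousOn γ (Set.Ico (0 : ℝ) 1) →
        (∀ t ∈ Set.Ico (0 : ℝ) 1, γ t ∈ Metric.ball (0 : EuclideanSpace ℂ (Fin n)) 1) →
        (∀ s ∈ Set.Ico (0 : ℝ) 1, ∀ t ∈ Set.Ico (0 : ℝ) 1, f (γ s) = f (γ t)) →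
        Filter.Tendsto (fun t => ‖γ t‖) (nhdsWithin 1 (Set.Iio 1)) (nhds 1) →
        eVariationOn γ (Set.Ico (0 : ℝ) 1) = ⊤ := by
  let P : EuclideanSpace ℂ (Fin n) →L[ℂ] EuclideanSpace ℂ (Fin q) :=
    (EuclideanSpace.equiv (Fin q) ℂ).symm.toContinuousLinearMap.comp
      (ContinuousLinearMap.pi fun i => EuclideanSpace.proj (Fin.castLE hqn.le i))
  have hP : ∀ z i, P z i = z (Fin.castLE hqn.le i) := fun z i => rfl
  have hPsurj : Function.Surjective P := by
    intro y
    refine ⟨WithLp.toLp 2 fun i => if h : (i : ℕ) < q then y ⟨i, h⟩ else 0, ?_⟩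
    ext i
    simp [hP]
  let i₀ : Fin q := ⟨0, hq⟩
  let p : EuclideanSpace ℂ (Fin n) →L[ℂ] ℂ := EuclideanSpace.proj (Fin.castLE hqn.le i₀)
  have hp : p ≠ 0 := by
    intro h
    have := DFunLike.congr_fun h (EuclideanSpace.single (Fin.castLE hqn.le i₀) 1)
    simp [p] at this
  obtain ⟨M, hM, U, F, hF, hdet, hU, hUc, hlarge⟩ := exists_large_on_labyrinth
    (by rw [finrank_euclideanSpace_fin]; omega) hp
  refine ⟨fun z => P (F z), P.differentiable.comp_differentiableOn hF, fun z hz => ?_,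
    fun γ hγ hγball hfib hlim => ?_⟩
  · have hFz : DifferentiableAt ℂ F z := hF.differentiableAt (isOpen_ball.mem_nhds hz)
    have h : fderiv ℂ (fun z => P (F z)) z = P.comp (fderiv ℂ F z) :=
      (P.hasFDerivAt.comp z hFz.hasFDerivAt).fderiv
    rw [h]
    have hunit : IsUnit (fderiv ℂ F z).toLinearMap := by
      rw [LinearMap.isUnit_iff_isUnit_det]
      exact isUnit_iff_exists_inv.2 ⟨1, by simpa using hdet z hz⟩
    exact hPsurj.comp ((Module.End.isUnit_iff _).1 hunit).surjective
  · have h0 : (0 : ℝ) ∈ Set.Ico (0 : ℝ) 1 := ⟨le_rfl, one_pos⟩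
    refine eVariationOn_eq_top_of_avoids hγ hlim (by simpa using hγball 0 h0) hM hU hUc ?_
    filter_upwards [tendsto_natCast_atTop_atTop.eventually_gt_atTop ‖p (F (γ 0))‖] with
      b hb t ht j hj u hu hmem
    have h1 : p (F (γ t)) = p (F (γ 0)) := congrArg (fun y => y i₀) (hfib t ht 0 h0)
    have h2 := hlarge b j hj u hu (γ t) hmem
    rw [h1] at h2
    linarith
end
end
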